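/- Let Γ and Γ* be non-elementary hyperbolic groups and let π be a probability measure on Γ̄ = Γ × Γ* with finite first moment whose marginals μ on Γ and μ* on Γ* are non-elementary. Suppose l(Γ,μ) ≥ l(Γ*,μ*). Then the harmonic measure ν_π on (∂Γ × ∂Γ*, q̄) is exact dimensional: for ν_π-almost every ξ̄ ∈ ∂Γ × ∂Γ*, lim_{r→0} log ν_π(B̄(ξ̄,r))/log r = (h(π) − h(μ*))/l(Γ,μ) + h(μ*)/l(Γ*,μ*); in particular the Hausdorff dimension of ν_π equals (h(π) − h(μ*))/l(Γ,μ) + h(μ*)/l(Γ*,μ*). -/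

import Mathlib

open MeasureTheory Filter Topology Metric Set
open scoped ENNReal Classical

noncomputable section

namespace HMDim

/-! ### Gromov products and hyperbolicity -/

/-- The Gromov product `(x|y)_o = (d(x,o)+d(o,y)-d(x,y))/2`. -/
def gp {X : Type*} [MetricSpace X] (o x y : X) : ℝ :=
  (dist x o + dist o y - dist x y) / 2

/-- `X` is `δ`-hyperbolic. -/
def IsHyperbolicWith (X : Type*) [MetricSpace X] (δ : ℝ) : Prop :=
  ∀ x y z w : X, min (gp w x z) (gp w z y) - δ ≤ gp w x y

/-- `X` is hyperbolic: `δ`-hyperbolic for some `δ ≥ 0`. -/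
def IsHyperbolic (X : Type*) [MetricSpace X] : Prop :=
  ∃ δ : ℝ, 0 ≤ δ ∧ IsHyperbolicWith X δ

/-- `X` is `C`-roughly geodesic for some `C ≥ 0`: any two points are joined by a
`C`-rough geodesic. -/
def IsRoughGeodesicSpace (X : Type*) [MetricSpace X] : Prop :=
  ∃ C : ℝ, 0 ≤ C ∧ ∀ x y : X, ∃ (b : ℝ) (γ : ℝ → X), 0 ≤ b ∧ γ 0 = x ∧ γ b = y ∧
    ∀ s ∈ Set.Icc (0:ℝ) b, ∀ t ∈ Set.Icc (0:ℝ) b, abs (dist (γ s) (γ t) - |s - t|) ≤ C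

/-- Bounded growth at some scale: there are `0 < r < R` and `N` such that every ball of
radius `R` is covered by at most `N` balls of radius `r`. -/
def HasBoundedGrowthAtSomeScale (X : Type*) [MetricSpace X] : Prop :=
  ∃ (r R : ℝ) (N : ℕ), 0 < r ∧ r < R ∧
    ∀ x : X, ∃ s : Finset X, s.card ≤ N ∧ Metric.ball x R ⊆ ⋃ y ∈ s, Metric.ball y r

/-! ### The Gromov boundary -/

/-- A sequence is divergent if it is Cauchy for the Gromov-product quasi-metric, i.e.
`(u n | u m)_o → ∞`. -/
def IsDivergent {X : Type*} [MetricSpace X] (o : X) (u : ℕ → X) : Prop :=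
  Tendsto (fun pr : ℕ × ℕ => gp o (u pr.1) (u pr.2)) atTop atTop

/-- The type of divergent sequences. -/
def DivSeq (X : Type*) [MetricSpace X] (o : X) : Type _ := {u : ℕ → X // IsDivergent o u}

/-- Two divergent sequences are equivalent when `(u n | v m)_o → ∞`. -/
def bndRel {X : Type*} [MetricSpace X] (o : X) (u v : DivSeq X o) : Prop :=
  Tendsto (fun pr : ℕ × ℕ => gp o (u.1 pr.1) (v.1 pr.2)) atTop atTop

/-- The Gromov boundary: equivalence classes of divergent sequences. -/
def Boundary (X : Type*) [MetricSpace X] (o : X) : Type _ := Quot (bndRel o)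

/-- The boundary point of a divergent sequence. -/
def mkB {X : Type*} [MetricSpace X] (o : X) (u : DivSeq X o) : Boundary X o :=
  Quot.mk _ u

/-- The extended Gromov product of two boundary points: the infimum over pairs of
representatives of the liminf of Gromov products. -/
def gpB {X : Type*} [MetricSpace X] (o : X) (ξ η : Boundary X o) : ℝ :=
  sInf {t : ℝ | ∃ u v : DivSeq X o, mkB o u = ξ ∧ mkB o v = η ∧
    t = Filter.liminf (fun pr : ℕ × ℕ => gp o (u.1 pr.1) (v.1 pr.2)) atTop}

/-- The quasi-metric `q(ξ,η) = exp(-(ξ|η)_o)` on the boundary (`0` on the diagonal). -/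
def qB {X : Type*} [MetricSpace X] (o : X) (ξ η : Boundary X o) : ℝ :=
  if ξ = η then 0 else Real.exp (-(gpB o ξ η))

/-- The extended Gromov product of an interior point with a boundary point. -/
def gpXB {X : Type*} [MetricSpace X] (o : X) (x : X) (ξ : Boundary X o) : ℝ :=
  sInf {t : ℝ | ∃ u : DivSeq X o, mkB o u = ξ ∧
    t = Filter.liminf (fun m : ℕ => gp o x (u.1 m)) atTop}

/-- Quasi-metric between an interior point and a boundary point. -/
def qXB {X : Type*} [MetricSpace X] (o : X) (x : X) (ξ : Boundary X o) : ℝ :=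
  Real.exp (-(gpXB o x ξ))

/-- The open ball of a quasi-metric. -/
def qball {A : Type*} (q : A → A → ℝ) (ξ : A) (r : ℝ) : Set A := {η | q ξ η < r}

/-- The max quasi-metric `q̄` on the product of two boundaries. -/
def qbb {X Xs : Type*} [MetricSpace X] [MetricSpace Xs] (o : X) (os : Xs)
    (ξ η : Boundary X o × Boundary Xs os) : ℝ :=
  max (qB o ξ.1 η.1) (qB os ξ.2 η.2)

/-- Boundaries are measurable spaces, with the σ-algebra generated by quasi-metric balls. -/
instance (X : Type*) [MetricSpace X] (o : X) : MeasurableSpace (Boundary X o) :=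
  MeasurableSpace.generateFrom {s | ∃ ξ r, s = qball (qB o) ξ r}

/-! ### The boundary action of isometries -/

lemma gp_isometry_le {X : Type*} [MetricSpace X] (o : X) (g : X ≃ᵢ X) (x y : X) :
    gp o x y - dist o (g o) ≤ gp o (g x) (g y) := by
  have e1 : dist (g x) (g o) = dist x o := g.dist_eq x o
  have e2 : dist (g o) (g y) = dist o y := g.dist_eq o y
  have e3 : dist (g x) (g y) = dist x y := g.dist_eq x y
  have e4 : dist (g o) o = dist o (g o) := dist_comm _ _
  have t1 : dist (g x) (g o) ≤ dist (g x) o + dist o (g o) := dist_triangle _ _ _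
  have t2 : dist (g o) (g y) ≤ dist (g o) o + dist o (g y) := dist_triangle _ _ _
  simp only [gp]
  linarith [t1, t2, e1, e2, e3, e4]

lemma isDivergent_comp {X : Type*} [MetricSpace X] (o : X) (g : X ≃ᵢ X) {u : ℕ → X}
    (h : IsDivergent o u) : IsDivergent o fun n => g (u n) := by
  have h' := tendsto_atTop_add_const_right atTop (-(dist o (g o)))
    (h : Tendsto (fun pr : ℕ × ℕ => gp o (u pr.1) (u pr.2)) atTop atTop)
  refine tendsto_atTop_mono (fun pr => ?_) h'
  have := gp_isometry_le o g (u pr.1) (u pr.2)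
  simpa [sub_eq_add_neg] using this

lemma bndRel_comp {X : Type*} [MetricSpace X] (o : X) (g : X ≃ᵢ X) {u v : DivSeq X o}
    (h : bndRel o u v) :
    bndRel o ⟨fun n => g (u.1 n), isDivergent_comp o g u.2⟩
      ⟨fun n => g (v.1 n), isDivergent_comp o g v.2⟩ := by
  have h' := tendsto_atTop_add_const_right atTop (-(dist o (g o)))
    (h : Tendsto (fun pr : ℕ × ℕ => gp o (u.1 pr.1) (v.1 pr.2)) atTop atTop)
  refine tendsto_atTop_mono (fun pr => ?_) h'
  have := gp_isometry_le o g (u.1 pr.1) (v.1 pr.2)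
  simpa [sub_eq_add_neg] using this

/-- The induced action of an isometry on the Gromov boundary. -/
def bAct {X : Type*} [MetricSpace X] (o : X) (g : X ≃ᵢ X) :
    Boundary X o → Boundary X o :=
  Quot.map (fun u : DivSeq X o =>
      (⟨fun n => g (u.1 n), isDivergent_comp o g u.2⟩ : DivSeq X o))
    (fun _ _ h => bndRel_comp o g h)

/-! ### Random walks on countable groups -/

/-- Convolution of two measures (as `ℝ≥0∞`-valued functions) on a group. -/
def conv {G : Type*} [Group G] (p q : G → ℝ≥0∞) : G → ℝ≥0∞ :=
  fun x => ∑' y : G, p y * q (y⁻¹ * x)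

/-- The `n`-fold convolution power `π_n` of `p`. -/
def piN {G : Type*} [Group G] (p : G → ℝ≥0∞) : ℕ → G → ℝ≥0∞
  | 0 => fun x => if x = 1 then 1 else 0
  | n + 1 => conv (piN p n) p

/-- The Shannon entropy `H(π_n)` of the `n`-th convolution power. -/
def entropySeq {G : Type*} [Group G] (p : G → ℝ≥0∞) (n : ℕ) : ℝ :=
  ∑' x : G, Real.negMulLog ((piN p n x).toReal)

/-- The first moment of `π_n` with respect to a displacement function `f`. -/
def momentSeq {G : Type*} [Group G] (p : G → ℝ≥0∞) (f : G → ℝ) (n : ℕ) : ℝ :=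
  ∑' x : G, (piN p n x).toReal * f x

/-- `h` is the asymptotic entropy of the `p`-random walk:
`h = lim (1/n) H(π_n)`. -/
def HasEntropy {G : Type*} [Group G] (p : G → ℝ≥0∞) (h : ℝ) : Prop :=
  Tendsto (fun n : ℕ => entropySeq p n / n) atTop (nhds h)

/-- `l` is the drift (rate of escape) of the `p`-random walk with respect to the
displacement `f`: `l = lim (1/n) Σ_x f(x) π_n(x)`. -/
def HasDrift {G : Type*} [Group G] (p : G → ℝ≥0∞) (f : G → ℝ) (l : ℝ) : Prop :=
  Tendsto (fun n : ℕ => momentSeq p f n / n) atTop (nhds l)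

/-- `p` is a probability distribution. -/
def IsProb {G : Type*} (p : G → ℝ≥0∞) : Prop := ∑' x : G, p x = 1

/-- Finite first moment with respect to a displacement function `f`. -/
def FiniteFirstMoment {G : Type*} (p : G → ℝ≥0∞) (f : G → ℝ) : Prop :=
  ∑' x : G, p x * ENNReal.ofReal (f x) ≠ ∞

/-- The pushforward of a distribution `p` by a map `f` (e.g. a marginal). -/
def marginalStar {G A : Type*} (p : G → ℝ≥0∞) (f : G → A) : A → ℝ≥0∞ :=
  fun a => ∑' x : G, if f x = a then p x else 0

/-- A subgroup is non-elementary (in the relevant sense) if it contains a free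
subgroup of rank 2. -/
def IsNonElementarySubgroup {G : Type*} [Group G] (H : Subgroup G) : Prop :=
  ∃ φ : FreeGroup (Fin 2) →* G, Function.Injective φ ∧ φ.range ≤ H

/-- A measure `p` on a group is non-elementary if the subgroup generated by its
support contains a free subgroup of rank 2. -/
def IsNonElemMeasure {G : Type*} [Group G] (p : G → ℝ≥0∞) : Prop :=
  IsNonElementarySubgroup (Subgroup.closure {x : G | p x ≠ 0})

/-- A group containing a free subgroup of rank 2 (a non-elementary group). -/
def HasFreeSubgroup (G : Type*) [Group G] : Prop :=
  ∃ φ : FreeGroup (Fin 2) →* G, Function.Injective φ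

/-! ### Path space -/

/-- The position `w_n = x_1 ⋯ x_n` of the random walk with increments `ω`. -/
def walk {G : Type*} [Group G] (ω : ℕ → G) (n : ℕ) : G := ((List.range n).map ω).prod

/-- The cylinder set `[w̄_0, …, w̄_n]` of trajectories whose positions agree with those
of `ω` up to time `n`. -/
def cyl {G : Type*} [Group G] (ω : ℕ → G) (n : ℕ) : Set (ℕ → G) :=
  {ω' | ∀ i ≤ n, walk ω' i = walk ω i}

/-- `P` is the distribution of the increments of the `p`-random walk: the product
measure `p^{⊗ℕ}` on the path space. -/
def IsRWMeasure {G : Type*} [Group G] [MeasurableSpace G] (p : G → ℝ≥0∞)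
    (P : Measure (ℕ → G)) : Prop :=
  IsProbabilityMeasure P ∧
    ∀ (n : ℕ) (g : ℕ → G), P {ω | ∀ i < n, ω i = g i} = ∏ i ∈ Finset.range n, p (g i)

/-- `ν` is the harmonic measure on the boundary of `X` for the random walk with path
measure `P` and orbit map `z`: the image of `P` under the a.s.-defined boundary map. -/
def IsHarmonic {Ω X : Type*} [MeasurableSpace Ω] [MetricSpace X] (o : X)
    (P : Measure Ω) (z : Ω → ℕ → X) (ν : Measure (Boundary X o)) : Prop :=
  ∃ bnd : Ω → Boundary X o, Measurable bnd ∧ ν = P.map bnd ∧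
    ∀ᵐ ω ∂P, ∃ h : IsDivergent o (z ω), bnd ω = mkB o ⟨z ω, h⟩

/-- `ν` is the harmonic measure on the product of the boundaries of `X` and `Xs` for
the random walk with path measure `P` and orbit maps `z`, `zs`. -/
def IsJointHarmonic {Ω X Xs : Type*} [MeasurableSpace Ω] [MetricSpace X] [MetricSpace Xs]
    (o : X) (os : Xs) (P : Measure Ω) (z : Ω → ℕ → X) (zs : Ω → ℕ → Xs)
    (ν : Measure (Boundary X o × Boundary Xs os)) : Prop :=
  ∃ bnd : Ω → Boundary X o × Boundary Xs os, Measurable bnd ∧ ν = P.map bnd ∧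
    ∀ᵐ ω ∂P, ∃ (h1 : IsDivergent o (z ω)) (h2 : IsDivergent os (zs ω)),
      bnd ω = (mkB o ⟨z ω, h1⟩, mkB os ⟨zs ω, h2⟩)

/-- `cond` is a disintegration (system of conditional measures) of `P` with respect to
the map `f`, over the pushforward `νB = f_* P`. -/
def IsDisintegration {A B : Type*} [MeasurableSpace A] [MeasurableSpace B]
    (P : Measure A) (f : A → B) (νB : Measure B) (cond : B → Measure A) : Prop :=
  νB = P.map f ∧ (∀ᵐ b ∂νB, IsProbabilityMeasure (cond b)) ∧
    (∀ᵐ b ∂νB, cond b (f ⁻¹' {b}) = 1) ∧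
    ∀ s : Set A, MeasurableSet s → P s = ∫⁻ b, cond b s ∂νB

/-! ### Hausdorff dimension for quasi-metrics -/

/-- Diameter of a set for a quasi-metric. -/
def qdiam {A : Type*} (q : A → A → ℝ) (E : Set A) : ℝ≥0∞ :=
  ⨆ x ∈ E, ⨆ y ∈ E, ENNReal.ofReal (q x y)

/-- Hausdorff pre-measure (content) at scale `Δ`. -/
def qHContent {A : Type*} (q : A → A → ℝ) (α Δ : ℝ) (E : Set A) : ℝ≥0∞ :=
  ⨅ (c : ℕ → Set A) (_ : E ⊆ ⋃ i, c i) (_ : ∀ i, qdiam q (c i) ≤ ENNReal.ofReal Δ),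
    ∑' i, qdiam q (c i) ^ α

/-- The `α`-dimensional Hausdorff measure of a set for a quasi-metric. -/
def qHMeasure {A : Type*} (q : A → A → ℝ) (α : ℝ) (E : Set A) : ℝ≥0∞ :=
  ⨆ (Δ : ℝ) (_ : 0 < Δ), qHContent q α Δ E

/-- The Hausdorff dimension of a set for a quasi-metric. -/
def qdimSet {A : Type*} (q : A → A → ℝ) (E : Set A) : ℝ :=
  sSup {α : ℝ | 0 ≤ α ∧ 0 < qHMeasure q α E}

/-- The upper Hausdorff dimension of a measure. -/
def qdimUpper {A : Type*} [MeasurableSpace A] (q : A → A → ℝ) (ν : Measure A) : ℝ :=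
  sInf {d : ℝ | ∃ E : Set A, MeasurableSet E ∧ ν Eᶜ = 0 ∧ d = qdimSet q E}

/-- The lower Hausdorff dimension of a measure. -/
def qdimLower {A : Type*} [MeasurableSpace A] (q : A → A → ℝ) (ν : Measure A) : ℝ :=
  sInf {d : ℝ | ∃ E : Set A, MeasurableSet E ∧ 0 < ν E ∧ d = qdimSet q E}

/-- The Hausdorff dimension of `ν` exists and equals `D`. -/
def HasDim {A : Type*} [MeasurableSpace A] (q : A → A → ℝ) (ν : Measure A) (D : ℝ) : Prop :=
  qdimUpper q ν = D ∧ qdimLower q ν = D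

/-- `ν` is exact dimensional with dimension `D` for the quasi-metric `q`:
`lim_{r→0} log ν(B(ξ,r))/log r = D` for `ν`-a.e. `ξ`. -/
def ExactDim {A : Type*} [MeasurableSpace A] (q : A → A → ℝ) (ν : Measure A) (D : ℝ) : Prop :=
  ∀ᵐ ξ ∂ν, Tendsto (fun r : ℝ => Real.log (ν (qball q ξ r)).toReal / Real.log r)
    (nhdsWithin 0 (Set.Ioi 0)) (nhds D)

/-! ### Differential entropy -/

/-- The differential entropy
`h(∂X*, μ*) = Σ_g μ*(g) ∫ log (d gν/dν) d(gν)` of a measure on the isometry group with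
respect to a boundary measure. -/
def diffEntropy {Xs : Type*} [MetricSpace Xs] (os : Xs) (pstar : (Xs ≃ᵢ Xs) → ℝ≥0∞)
    (νs : Measure (Boundary Xs os)) : ℝ :=
  ∑' g : (Xs ≃ᵢ Xs), (pstar g).toReal *
    ∫ η, Real.log ((Measure.rnDeriv (νs.map (bAct os g)) νs η).toReal)
      ∂(νs.map (bAct os g))

/-! ### Word metrics and hyperbolic groups -/

/-- The word length of `g` with respect to a (symmetrized) generating set `S`. -/
def wordLength {G : Type*} [Group G] (S : Set G) (g : G) : ℕ :=
  sInf {n : ℕ | ∃ f : Fin n → G, (∀ i, f i ∈ S ∨ (f i)⁻¹ ∈ S) ∧ g = (List.ofFn f).prod}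

/-- The metric of `G` is quasi-isometric to a word metric of a finite generating set. -/
def IsQIToWordMetric (G : Type*) [Group G] [MetricSpace G] : Prop :=
  ∃ S : Finset G, Subgroup.closure (S : Set G) = ⊤ ∧
    ∃ Λ c : ℝ, 1 ≤ Λ ∧ 0 ≤ c ∧ ∀ g : G,
      (wordLength (S : Set G) g : ℝ) / Λ - c ≤ dist (1 : G) g ∧
      dist (1 : G) g ≤ Λ * (wordLength (S : Set G) g) + c

/-- The metric of `G` is left invariant. -/
def LeftInvariantMetric (G : Type*) [Group G] [MetricSpace G] : Prop :=
  ∀ g x y : G, dist (g * x) (g * y) = dist x y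

/-- `G`, with its metric, is a hyperbolic group: the metric is left invariant,
hyperbolic and quasi-isometric to a word metric. -/
def IsHypGroupMetric (G : Type*) [Group G] [MetricSpace G] : Prop :=
  LeftInvariantMetric G ∧ IsHyperbolic G ∧ IsQIToWordMetric G

/-! ### Groups of isometries of a product -/

/-- First component of an element of a subgroup of `Isom X × Isom X*`. -/
def proj1 {X Xs : Type*} [MetricSpace X] [MetricSpace Xs]
    {Γb : Subgroup ((X ≃ᵢ X) × (Xs ≃ᵢ Xs))} (γ : Γb) : X ≃ᵢ X :=
  (γ : (X ≃ᵢ X) × (Xs ≃ᵢ Xs)).1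

/-- Second component of an element of a subgroup of `Isom X × Isom X*`. -/
def proj2 {X Xs : Type*} [MetricSpace X] [MetricSpace Xs]
    {Γb : Subgroup ((X ≃ᵢ X) × (Xs ≃ᵢ Xs))} (γ : Γb) : Xs ≃ᵢ Xs :=
  (γ : (X ≃ᵢ X) × (Xs ≃ᵢ Xs)).2

/-- Displacement `d̄(ō, γ·ō)` of the base point `ō = (o,o*)` (the metric of the product
is the max metric). -/
def disp {X Xs : Type*} [MetricSpace X] [MetricSpace Xs]
    {Γb : Subgroup ((X ≃ᵢ X) × (Xs ≃ᵢ Xs))} (o : X) (os : Xs) (γ : Γb) : ℝ :=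
  dist (o, os) (proj1 γ o, proj2 γ os)

/-- Finite exponential growth relative to a displacement function `f`:
`#{x : f(x) < r} ≤ c e^{c r}`. -/
def FinExpGrowth {G : Type*} (f : G → ℝ) : Prop :=
  ∃ c : ℝ, 0 < c ∧ ∀ r : ℝ, 0 < r →
    {x : G | f x < r}.Finite ∧ ({x : G | f x < r}.ncard : ℝ) ≤ c * Real.exp (c * r)

/-! ### The events of Lemmas `A` and `E_n(η)` -/

/-- The event `A_{ε,n} = ∩_{t ≥ n} {z̄_∞ exists and q̄(z̄_t, z̄_∞) ≤ e^{-(l*-ε)n}}`. -/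
def Aev {X Xs : Type*} [MetricSpace X] [MetricSpace Xs]
    (Γb : Subgroup ((X ≃ᵢ X) × (Xs ≃ᵢ Xs))) (o : X) (os : Xs) (ε lst : ℝ) (n : ℕ) :
    Set (ℕ → Γb) :=
  {ω | ∃ (h1 : IsDivergent o (fun t => proj1 (walk ω t) o))
        (h2 : IsDivergent os (fun t => proj2 (walk ω t) os)),
      ∀ t, n ≤ t →
        max (qXB o (proj1 (walk ω t) o) (mkB o ⟨_, h1⟩))
            (qXB os (proj2 (walk ω t) os) (mkB os ⟨_, h2⟩))
          ≤ Real.exp (-((lst - ε) * n))}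

/-- The event
`E_{ε,n}(η) = {P^η([w̄_0,…,w̄_n] ∩ A_{ε,n}) ≤ e^{n(h*+ε)} P([w̄_0,…,w̄_n] ∩ A_{ε,n})}`. -/
def Eev {X Xs : Type*} [MetricSpace X] [MetricSpace Xs]
    (Γb : Subgroup ((X ≃ᵢ X) × (Xs ≃ᵢ Xs))) [MeasurableSpace Γb] (o : X) (os : Xs)
    (P : Measure (ℕ → Γb)) (condP : Boundary Xs os → Measure (ℕ → Γb))
    (hst ε lst : ℝ) (η : Boundary Xs os) (n : ℕ) : Set (ℕ → Γb) :=
  {ω | condP η (cyl ω n ∩ Aev Γb o os ε lst n) ≤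
        ENNReal.ofReal (Real.exp (n * (hst + ε))) * P (cyl ω n ∩ Aev Γb o os ε lst n)}

/-! ### Special measures -/

/-- The measure `π^ρ = ρ μ×μ + (1-ρ) μ_diag` on `Γ × Γ`. -/
def pRho {Γ : Type*} (p : Γ → ℝ≥0∞) (ρ : ℝ) : Γ × Γ → ℝ≥0∞ :=
  fun g => ENNReal.ofReal ρ * (p g.1 * p g.2) +
    ENNReal.ofReal (1 - ρ) * (if g.1 = g.2 then p g.1 else 0)

/-- The uniform distribution on the symmetrized free basis of `F_{m+1}`. -/
def symFreeBasisUniform (m : ℕ) : FreeGroup (Fin (m + 1)) → ℝ≥0∞ :=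
  fun g => if ∃ i : Fin (m + 1), g = FreeGroup.of i ∨ g = (FreeGroup.of i)⁻¹
    then ENNReal.ofReal (1 / (2 * (m + 1))) else 0

/-- The homomorphism `F_{m+1} → F_m` sending `x_i ↦ y_i` for `i ≤ m` and `x_{m+1} ↦ 1`. -/
def projHom (m : ℕ) : FreeGroup (Fin (m + 1)) →* FreeGroup (Fin m) :=
  FreeGroup.lift (fun i => if h : (i : ℕ) < m then FreeGroup.of (⟨i, h⟩ : Fin m) else 1)

section Geo
variable {X : Type*} [MetricSpace X]

lemma gp_nonneg (o x y : X) : 0 ≤ gp o x y := by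
  unfold gp; linarith [dist_triangle x o y]

lemma gp_comm (o x y : X) : gp o x y = gp o y x := by
  unfold gp; rw [dist_comm x o, dist_comm o y, dist_comm x y]; ring

lemma gp_self (o x : X) : gp o x x = dist o x := by
  unfold gp; rw [dist_comm x o, dist_self]; ring

lemma gp_le_left (o x y : X) : gp o x y ≤ dist o x := by
  unfold gp; linarith [dist_triangle o x y, dist_comm x o]

lemma gp_le_right (o x y : X) : gp o x y ≤ dist o y := by
  rw [gp_comm]; exact gp_le_left _ _ _

lemma dist_eq_gp (o x y : X) : dist x y = dist o x + dist o y - 2 * gp o x y := by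
  unfold gp; rw [dist_comm x o]; ring

lemma hyp3 {δ : ℝ} (h : IsHyperbolicWith X δ) (hδ : 0 ≤ δ) (o x y z w : X) :
    min (gp o x y) (min (gp o y z) (gp o z w)) - 2 * δ ≤ gp o x w := by
  have h1 := h x w y o
  have h2 := h y w z o
  have h3 : min (gp o x y) (min (gp o y z) (gp o z w)) - δ ≤ min (gp o x y) (gp o y w) := by
    refine le_min ?_ ?_
    · linarith [min_le_left (gp o x y) (min (gp o y z) (gp o z w))]
    · linarith [min_le_right (gp o x y) (min (gp o y z) (gp o z w))]
  linarith

lemma chain_dyadic {δ : ℝ} (hδ : 0 ≤ δ) (h : IsHyperbolicWith X δ) (o : X) (u : ℕ → X) (A : ℝ) :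
    ∀ p i j : ℕ, i < j → j - i ≤ 2 ^ p →
      (∀ k, i ≤ k → k < j → A ≤ gp o (u k) (u (k + 1))) →
      A - p * δ ≤ gp o (u i) (u j) := by
  intro p
  induction p with
  | zero =>
    intro i j hij hp hA
    have : j = i + 1 := by simp at hp; omega
    subst this
    simpa using hA i le_rfl hij
  | succ p ih =>
    intro i j hij hp hA
    by_cases hs : j - i ≤ 2 ^ p
    · have := ih i j hij hs hA
      push_cast
      nlinarith
    · have hpos : 0 < 2 ^ p := by positivity
      have h1 := ih i (i + 2 ^ p) (by omega) (by omega) (fun k hk hk' => hA k hk (by omega))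
      have h2 := ih (i + 2 ^ p) j (by omega) (by rw [pow_succ] at hp; omega)
        (fun k hk hk' => hA k (by omega) (by omega))
      have h3 := h (u i) (u j) (u (i + 2 ^ p)) o
      have h4 := le_min h1 h2
      push_cast
      linarith

lemma chain_lin {δ : ℝ} (hδ : 0 ≤ δ) (h : IsHyperbolicWith X δ) (o : X) (u : ℕ → X)
    {a : ℝ} (ha : 0 < a) (N0 M : ℕ)
    (hA : ∀ k, N0 ≤ k → k < M → a * k ≤ gp o (u k) (u (k + 1))) :
    ∀ d n m : ℕ, m - n ≤ d → N0 ≤ n → 2 * δ ≤ a * n → 1 ≤ n → n < m → m ≤ M →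
      a * n - δ * (Nat.log 2 n + 2) ≤ gp o (u n) (u m) := by
  intro d
  induction d with
  | zero => intro n m h1 _ _ _ h2; omega
  | succ d ih =>
    intro n m hd hn hna hn1 hnm hmM
    have key : ∀ m', n < m' → m' ≤ 2 * n → m' ≤ M →
        a * n - (Nat.log 2 n + 1 : ℕ) * δ ≤ gp o (u n) (u m') := by
      intro m' h1 h2 h3
      refine chain_dyadic hδ h o u (a * n) _ n m' h1 ?_ ?_
      · have := Nat.lt_pow_succ_log_self (b := 2) (by norm_num) n
        simp only [Nat.succ_eq_add_one] at this
        omega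
      · intro k hk hk'
        refine le_trans ?_ (hA k (by omega) (by omega))
        have : (n : ℝ) ≤ k := by exact_mod_cast hk
        nlinarith
    by_cases hs : m ≤ 2 * n
    · have := key m hnm hs hmM
      push_cast at this
      nlinarith
    · have h1 := key (2 * n) (by omega) le_rfl (by omega)
      have h2 := ih (2 * n) m (by omega) (by omega) (by push_cast; nlinarith) (by omega) (by omega) hmM
      have h3 := h (u n) (u m) (u (2 * n)) o
      have hl : Nat.log 2 (2 * n) = Nat.log 2 n + 1 := by
        rw [mul_comm]; exact Nat.log_mul_base (by norm_num) (by omega)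
      rw [hl] at h2
      push_cast at h1 h2
      have h4 : a * n - δ * (Nat.log 2 n + 1) ≤ min (gp o (u n) (u (2 * n))) (gp o (u (2 * n)) (u m)) := by
        refine le_min (by nlinarith) ?_
        nlinarith
      nlinarith

lemma log_small (δ ε : ℝ) (hδ : 0 ≤ δ) (hε : 0 < ε) :
    ∀ᶠ n : ℕ in atTop, δ * (Nat.log 2 n + 2) ≤ ε * n := by
  have h1 : Tendsto (fun n : ℕ => Real.log n / n) atTop (𝓝 0) := by
    have := (Real.isLittleO_log_id_atTop.tendsto_div_nhds_zero).comp tendsto_natCast_atTop_atTop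
    exact this
  have h2 : Tendsto (fun n : ℕ => (2 : ℝ) / n) atTop (𝓝 0) := tendsto_const_div_atTop_nhds_zero_nat 2
  have h3 : Tendsto (fun n : ℕ => δ * ((Real.log n / n) / Real.log 2 + 2 / n)) atTop (𝓝 0) := by
    have := ((h1.div_const (Real.log 2)).add h2).const_mul δ
    simpa using this
  filter_upwards [h3.eventually (ge_mem_nhds hε), eventually_ge_atTop 1] with n hn hn1
  have hn0 : (0 : ℝ) < n := by exact_mod_cast hn1
  have hlog : (Nat.log 2 n : ℝ) ≤ Real.log n / Real.log 2 := by
    have := Real.natLog_le_logb n 2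
    simpa [Real.logb] using this
  have h4 : δ * ((Real.log n / n) / Real.log 2 + 2 / n) * n = δ * (Real.log n / Real.log 2 + 2) := by
    field_simp
  have h5 : δ * ((Real.log n / n) / Real.log 2 + 2 / n) * n ≤ ε * n :=
    mul_le_mul_of_nonneg_right hn hn0.le
  rw [h4] at h5
  nlinarith

lemma chain_eps {δ : ℝ} (hδ : 0 ≤ δ) (h : IsHyperbolicWith X δ)
    {a ε : ℝ} (ha : 0 < a) (hε : 0 < ε) (N0 : ℕ) :
    ∃ N1 : ℕ, N0 ≤ N1 ∧ ∀ (o : X) (u : ℕ → X) (M : ℕ),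
      (∀ k, N0 ≤ k → k < M → a * k ≤ gp o (u k) (u (k + 1))) →
      ∀ n m, N1 ≤ n → n < m → m ≤ M → (a - ε) * n ≤ gp o (u n) (u m) := by
  obtain ⟨N2, hN2⟩ := eventually_atTop.1 (log_small δ ε hδ hε)
  obtain ⟨N3, hN3⟩ := exists_nat_gt (2 * δ / a)
  refine ⟨max N0 (max N2 (max N3 1)), le_max_left _ _, ?_⟩
  intro o u M hA n m hn hnm hmM
  have e0 : N0 ≤ n := le_trans (le_max_left _ _) hn
  have e1 : N2 ≤ n := by simp at hn; omega
  have e2 : N3 ≤ n := by simp at hn; omega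
  have e3 : 1 ≤ n := by simp at hn; omega
  have h1 := hN2 n e1
  have h2 : 2 * δ ≤ a * n := by
    have : (N3 : ℝ) ≤ n := by exact_mod_cast e2
    rw [div_lt_iff₀ ha] at hN3
    nlinarith
  have := chain_lin hδ h o u ha N0 M hA _ n m le_rfl e0 h2 e3 hnm hmM
  linarith

/-! boundary -/

lemma tend_iff {f : ℕ × ℕ → ℝ} : Tendsto f atTop atTop ↔
    ∀ T : ℝ, ∃ N : ℕ, ∀ n ≥ N, ∀ m ≥ N, T ≤ f (n, m) := by
  rw [Filter.tendsto_atTop]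
  refine forall_congr' fun T => ?_
  rw [eventually_atTop]
  constructor
  · rintro ⟨⟨a, b⟩, h⟩
    exact ⟨max a b, fun n hn m hm => h (n, m) ⟨le_trans (le_max_left _ _) hn, le_trans (le_max_right _ _) hm⟩⟩
  · rintro ⟨N, h⟩
    exact ⟨(N, N), fun ⟨n, m⟩ hnm => h n hnm.1 m hnm.2⟩

variable {δ : ℝ} {o : X}

lemma bndRel_equiv (hδ : 0 ≤ δ) (h : IsHyperbolicWith X δ) (o : X) :
    Equivalence (bndRel o (X := X)) := by
  refine ⟨fun u => u.2, ?_, ?_⟩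
  · intro u v huv
    rw [bndRel, tend_iff] at *
    intro T
    obtain ⟨N, hN⟩ := huv T
    exact ⟨N, fun n hn m hm => by rw [gp_comm]; exact hN m hm n hn⟩
  · intro u v w huv hvw
    rw [bndRel, tend_iff] at *
    intro T
    obtain ⟨N, hN⟩ := huv (T + δ)
    obtain ⟨N', hN'⟩ := hvw (T + δ)
    refine ⟨max N N', fun n hn m hm => ?_⟩
    have a1 := hN n (le_trans (le_max_left _ _) hn) (max N N') (le_max_left _ _)
    have a2 := hN' (max N N') (le_max_right _ _) m (le_trans (le_max_right _ _) hm)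
    have := h (u.1 n) (w.1 m) (v.1 (max N N')) o
    have := le_min a1 a2
    simp only at *
    linarith

lemma mkB_eq_iff (hδ : 0 ≤ δ) (h : IsHyperbolicWith X δ) (u v : DivSeq X o) :
    mkB o u = mkB o v ↔ bndRel o u v := by
  constructor
  · intro e
    have := Quot.eqvGen_exact e
    rwa [(bndRel_equiv hδ h o).eqvGen_iff] at this
  · exact fun e => Quot.sound e

lemma gp_compare (hδ : 0 ≤ δ) (h : IsHyperbolicWith X δ) (u v u' v' : DivSeq X o)
    (hne : mkB o u ≠ mkB o v) (hu : mkB o u = mkB o u') (hv : mkB o v = mkB o v') :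
    ∃ N : ℕ, ∀ n ≥ N, ∀ m ≥ N, ∀ n' ≥ N, ∀ m' ≥ N,
      gp o (u'.1 n') (v'.1 m') ≤ gp o (u.1 n) (v.1 m) + 2 * δ := by
  have hnr : ¬ bndRel o u v := fun hr => hne ((mkB_eq_iff hδ h u v).2 hr)
  rw [bndRel, tend_iff] at hnr
  push Not at hnr
  obtain ⟨T, hT⟩ := hnr
  rw [mkB_eq_iff hδ h, bndRel, tend_iff] at hu hv
  obtain ⟨N1, hN1⟩ := hu (T + 2 * δ + 1)
  obtain ⟨N2, hN2⟩ := hv (T + 2 * δ + 1)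
  simp only at hN1 hN2 hT
  have hb : ∀ n' ≥ max N1 N2, ∀ m' ≥ max N1 N2, gp o (u'.1 n') (v'.1 m') ≤ T + 2 * δ := by
    intro n' hn' m' hm'
    obtain ⟨n, hn, m, hm, hlt⟩ := hT (max N1 N2)
    have a1 := hN1 n (le_trans (le_max_left _ _) hn) n' (le_trans (le_max_left _ _) hn')
    have a2 := hN2 m (le_trans (le_max_right _ _) hm) m' (le_trans (le_max_right _ _) hm')
    rw [gp_comm] at a2
    have := hyp3 h hδ o (u.1 n) (u'.1 n') (v'.1 m') (v.1 m)
    by_contra hc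
    push Not at hc
    have : T + 2 * δ ≤ min (gp o (u.1 n) (u'.1 n')) (min (gp o (u'.1 n') (v'.1 m')) (gp o (v'.1 m') (v.1 m))) :=
      le_min (by linarith) (le_min (by linarith) (by linarith))
    linarith
  refine ⟨max N1 N2, fun n hn m hm n' hn' m' hm' => ?_⟩
  have a1 := hN1 n (le_trans (le_max_left _ _) hn) n' (le_trans (le_max_left _ _) hn')
  have a2 := hN2 m (le_trans (le_max_right _ _) hm) m' (le_trans (le_max_right _ _) hm')
  have a3 := hb n' hn' m' hm'
  rw [gp_comm] at a2
  have := hyp3 h hδ o (u.1 n) (u'.1 n') (v'.1 m') (v.1 m)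
  have : gp o (u'.1 n') (v'.1 m') ≤ min (gp o (u.1 n) (u'.1 n')) (min (gp o (u'.1 n') (v'.1 m')) (gp o (v'.1 m') (v.1 m))) :=
      le_min (by linarith) (le_min (by linarith) (by linarith))
  linarith

lemma liminf_bd {f : ℕ × ℕ → ℝ} {a b : ℝ} {N : ℕ}
    (hf : ∀ n ≥ N, ∀ m ≥ N, a ≤ f (n, m) ∧ f (n, m) ≤ b) :
    a ≤ liminf f atTop ∧ liminf f atTop ≤ b := by
  have h1 : ∀ᶠ p in atTop, a ≤ f p := by
    filter_upwards [eventually_ge_atTop ((N, N) : ℕ × ℕ)] with p hp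
    exact (hf p.1 hp.1 p.2 hp.2).1
  have h2 : ∀ᶠ p in atTop, f p ≤ b := by
    filter_upwards [eventually_ge_atTop ((N, N) : ℕ × ℕ)] with p hp
    exact (hf p.1 hp.1 p.2 hp.2).2
  constructor
  · exact le_liminf_of_le (IsBoundedUnder.isCoboundedUnder_ge ⟨b, by simpa using h2⟩) h1
  · exact liminf_le_of_frequently_le h2.frequently ⟨a, by simpa using h1⟩

lemma gpB_approx (hδ : 0 ≤ δ) (h : IsHyperbolicWith X δ) (u v : DivSeq X o)
    (hne : mkB o u ≠ mkB o v) :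
    ∃ N : ℕ, ∀ n ≥ N, ∀ m ≥ N, |gp o (u.1 n) (v.1 m) - gpB o (mkB o u) (mkB o v)| ≤ 4 * δ := by
  obtain ⟨N, hN⟩ := gp_compare hδ h u v u v hne rfl rfl
  refine ⟨N, fun n hn m hm => ?_⟩
  have hL : gp o (u.1 n) (v.1 m) - 2 * δ ≤ liminf (fun pr : ℕ × ℕ => gp o (u.1 pr.1) (v.1 pr.2)) atTop ∧
      liminf (fun pr : ℕ × ℕ => gp o (u.1 pr.1) (v.1 pr.2)) atTop ≤ gp o (u.1 n) (v.1 m) + 2 * δ := by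
    refine liminf_bd (N := N) fun n' hn' m' hm' => ⟨?_, ?_⟩
    · have := hN n' hn' m' hm' n hn m hm
      simp only; linarith
    · exact hN n hn m hm n' hn' m' hm'
  have hlow : ∀ t ∈ {t : ℝ | ∃ u' v' : DivSeq X o, mkB o u' = mkB o u ∧ mkB o v' = mkB o v ∧
      t = Filter.liminf (fun pr : ℕ × ℕ => gp o (u'.1 pr.1) (v'.1 pr.2)) atTop},
      gp o (u.1 n) (v.1 m) - 4 * δ ≤ t := by
    rintro t ⟨u', v', hu', hv', rfl⟩
    obtain ⟨N1, hN1⟩ := gp_compare hδ h u v u' v' hne hu'.symm hv'.symm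
    obtain ⟨N2, hN2⟩ := gp_compare hδ h u' v' u v (by rwa [hu', hv']) hu' hv'
    set K := max N (max N1 N2)
    have k0 : N ≤ K := le_max_left _ _
    have k1 : N1 ≤ K := le_trans (le_max_left _ _) (le_max_right _ _)
    have k2 : N2 ≤ K := le_trans (le_max_right _ _) (le_max_right _ _)
    have := (liminf_bd (N := K) (f := fun pr : ℕ × ℕ => gp o (u'.1 pr.1) (v'.1 pr.2))
      (a := gp o (u.1 K) (v.1 K) - 2 * δ) (b := gp o (u.1 K) (v.1 K) + 2 * δ)
      (fun n' hn' m' hm' => ⟨?_, ?_⟩)).1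
    · have h3 := hN K k0 K k0 n hn m hm
      linarith
    · have := hN2 n' (by omega) m' (by omega) K k2 K k2
      simp only; linarith
    · exact hN1 K k1 K k1 n' (by omega) m' (by omega)
  have h1 : gpB o (mkB o u) (mkB o v) ≤ gp o (u.1 n) (v.1 m) + 2 * δ := by
    refine le_trans (csInf_le ⟨_, hlow⟩ ⟨u, v, rfl, rfl, rfl⟩) hL.2
  have h2 : gp o (u.1 n) (v.1 m) - 4 * δ ≤ gpB o (mkB o u) (mkB o v) :=
    le_csInf ⟨_, u, v, rfl, rfl, rfl⟩ hlow
  rw [abs_le]; constructor <;> linarith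

lemma exists_rep (ξ : Boundary X o) : ∃ u : DivSeq X o, mkB o u = ξ := Quot.exists_rep ξ

lemma qB_nonneg (ξ η : Boundary X o) : 0 ≤ qB o ξ η := by
  unfold qB; split_ifs; exact le_rfl; positivity

lemma qB_le_of (hδ : 0 ≤ δ) (h : IsHyperbolicWith X δ) (u v : DivSeq X o) (t : ℝ) (N : ℕ)
    (ht : ∀ n ≥ N, ∀ m ≥ N, t ≤ gp o (u.1 n) (v.1 m)) :
    qB o (mkB o u) (mkB o v) ≤ Real.exp (-(t - 4 * δ)) := by
  unfold qB
  split_ifs with he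
  · positivity
  · obtain ⟨N', hN'⟩ := gpB_approx hδ h u v he
    have h1 := hN' (max N N') (le_max_right _ _) (max N N') (le_max_right _ _)
    have h2 := ht (max N N') (le_max_left _ _) (max N N') (le_max_left _ _)
    rw [abs_le] at h1
    apply Real.exp_le_exp.2
    linarith [h1.1, h1.2]

lemma gp_of_qB_le (hδ : 0 ≤ δ) (h : IsHyperbolicWith X δ) (u v : DivSeq X o) (s : ℝ)
    (hs : qB o (mkB o u) (mkB o v) ≤ Real.exp (-s)) :
    ∃ N : ℕ, ∀ n ≥ N, ∀ m ≥ N, s - 4 * δ ≤ gp o (u.1 n) (v.1 m) := by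
  unfold qB at hs
  split_ifs at hs with he
  · rw [mkB_eq_iff hδ h, bndRel, tend_iff] at he
    exact he _
  · obtain ⟨N', hN'⟩ := gpB_approx hδ h u v he
    refine ⟨N', fun n hn m hm => ?_⟩
    have h1 := hN' n hn m hm
    rw [abs_le] at h1
    have h2 := Real.exp_le_exp.1 hs
    linarith [h1.1, h1.2]

lemma qB_symm_le (hδ : 0 ≤ δ) (h : IsHyperbolicWith X δ) (ξ η : Boundary X o) :
    qB o ξ η ≤ Real.exp (9 * δ) * qB o η ξ := by
  by_cases he : ξ = η
  · subst he; simp [qB]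
  obtain ⟨u, rfl⟩ := exists_rep ξ
  obtain ⟨v, rfl⟩ := exists_rep η
  have : qB o (mkB o v) (mkB o u) = Real.exp (- gpB o (mkB o v) (mkB o u)) := by
    rw [qB, if_neg (Ne.symm he)]
  obtain ⟨N, hN⟩ := gp_of_qB_le hδ h v u _ this.le
  refine le_trans (qB_le_of hδ h u v _ N (fun n hn m hm => by rw [gp_comm]; exact hN m hm n hn)) ?_
  rw [this, ← Real.exp_add]
  apply Real.exp_le_exp.2
  linarith

lemma qB_tri (hδ : 0 ≤ δ) (h : IsHyperbolicWith X δ) (ξ η ζ : Boundary X o) :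
    qB o ξ ζ ≤ Real.exp (9 * δ) * max (qB o ξ η) (qB o η ζ) := by
  have one : 1 ≤ Real.exp (9 * δ) := Real.one_le_exp (by positivity)
  by_cases h1 : ξ = η
  · subst h1
    have := le_max_right (qB o ξ ξ) (qB o ξ ζ)
    have h0 := qB_nonneg ξ ζ
    nlinarith
  by_cases h2 : η = ζ
  · subst h2
    have := le_max_left (qB o ξ η) (qB o η η)
    have h0 := qB_nonneg ξ η
    nlinarith
  obtain ⟨u, rfl⟩ := exists_rep ξ
  obtain ⟨v, rfl⟩ := exists_rep η
  obtain ⟨w, rfl⟩ := exists_rep ζ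
  have e1 : qB o (mkB o u) (mkB o v) = Real.exp (- gpB o (mkB o u) (mkB o v)) := by
    rw [qB, if_neg h1]
  have e2 : qB o (mkB o v) (mkB o w) = Real.exp (- gpB o (mkB o v) (mkB o w)) := by
    rw [qB, if_neg h2]
  obtain ⟨N, hN⟩ := gp_of_qB_le hδ h u v _ e1.le
  obtain ⟨N', hN'⟩ := gp_of_qB_le hδ h v w _ e2.le
  set a := gpB o (mkB o u) (mkB o v)
  set b := gpB o (mkB o v) (mkB o w)
  refine le_trans (qB_le_of hδ h u w (min a b - 5 * δ) (max N N') (fun n hn m hm => ?_)) ?_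
  · have a1 := hN n (le_trans (le_max_left _ _) hn) (max N N') (le_max_left _ _)
    have a2 := hN' (max N N') (le_max_right _ _) m (le_trans (le_max_right _ _) hm)
    have := h (u.1 n) (w.1 m) (v.1 (max N N')) o
    have h3 : min a b - 4 * δ ≤ min (gp o (u.1 n) (v.1 (max N N'))) (gp o (v.1 (max N N')) (w.1 m)) :=
      le_min (by linarith [min_le_left a b]) (by linarith [min_le_right a b])
    linarith
  · rw [e1, e2]
    rcases le_total a b with hab | hab
    · rw [min_eq_left hab]
      refine le_trans ?_ (mul_le_mul_of_nonneg_left (le_max_left _ _) (by positivity))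
      rw [← Real.exp_add]
      apply Real.exp_le_exp.2; linarith
    · rw [min_eq_right hab]
      refine le_trans ?_ (mul_le_mul_of_nonneg_left (le_max_right _ _) (by positivity))
      rw [← Real.exp_add]
      apply Real.exp_le_exp.2; linarith

lemma qB_eq_zero {ξ η : Boundary X o} (h : qB o ξ η = 0) : ξ = η := by
  by_contra hne
  rw [qB, if_neg hne] at h
  exact absurd h (Real.exp_pos _).ne'

end Geo

section Word
variable {G : Type*} [Group G]

lemma wordLength_le_of_list (S : Set G) (L : List G) (hL : ∀ x ∈ L, x ∈ S ∨ x⁻¹ ∈ S) :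
    wordLength S L.prod ≤ L.length := by
  apply Nat.sInf_le
  refine ⟨fun i => L.get i, fun i => hL _ (L.get_mem i), ?_⟩
  rw [List.ofFn_get]

lemma exists_word (S : Set G) (hS : Subgroup.closure S = ⊤) (g : G) :
    ∃ L : List G, (∀ x ∈ L, x ∈ S ∨ x⁻¹ ∈ S) ∧ g = L.prod ∧ L.length = wordLength S g := by
  have hne : {n : ℕ | ∃ f : Fin n → G, (∀ i, f i ∈ S ∨ (f i)⁻¹ ∈ S) ∧ g = (List.ofFn f).prod}.Nonempty := by
    have hg : g ∈ Subgroup.closure S := by rw [hS]; trivial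
    rw [← Subgroup.mem_toSubmonoid, Subgroup.closure_toSubmonoid] at hg
    obtain ⟨L, hL, rfl⟩ := Submonoid.exists_list_of_mem_closure hg
    refine ⟨L.length, fun i => L.get i, fun i => hL _ (L.get_mem i), ?_⟩
    rw [List.ofFn_get]
  obtain ⟨f, hf, hg⟩ := Nat.sInf_mem hne
  refine ⟨List.ofFn f, ?_, hg, ?_⟩
  · intro x hx
    rw [List.mem_ofFn] at hx
    obtain ⟨i, rfl⟩ := hx
    exact hf i
  · rw [List.length_ofFn]; rfl

lemma wordLength_mul_le (S : Set G) (hS : Subgroup.closure S = ⊤) (g h : G) :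
    wordLength S (g * h) ≤ wordLength S g + wordLength S h := by
  obtain ⟨L, hL, hg, hl⟩ := exists_word S hS g
  obtain ⟨L', hL', hg', hl'⟩ := exists_word S hS h
  have := wordLength_le_of_list S (L ++ L') (by
    intro x hx
    rcases List.mem_append.1 hx with hx | hx
    · exact hL x hx
    · exact hL' x hx)
  rw [List.prod_append, ← hg, ← hg', List.length_append, hl, hl'] at this
  exact this

variable [MetricSpace G]

open scoped Pointwise in
lemma growth (hG : IsHypGroupMetric G) : ∃ A B : ℝ, 0 < A ∧ 0 < B ∧ ∀ s : ℝ, 0 ≤ s →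
    {x : G | dist 1 x ≤ s}.Finite ∧ ({x : G | dist 1 x ≤ s}.ncard : ℝ) ≤ A * Real.exp (B * s) := by
  obtain ⟨-, -, S, hS, Λ, c, hΛ, hc, hq⟩ := hG
  let T : Finset G := insert 1 (S ∪ S.image (fun x => x⁻¹))
  have hT1 : (1 : G) ∈ T := Finset.mem_insert_self _ _
  have hTcard : 1 ≤ T.card := Finset.card_pos.2 ⟨1, hT1⟩
  have hTr : (1 : ℝ) ≤ T.card := by exact_mod_cast hTcard
  have hmem : ∀ L : List G, (∀ x ∈ L, x ∈ (S : Set G) ∨ x⁻¹ ∈ (S : Set G)) → L.prod ∈ T ^ L.length := by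
    intro L
    induction L with
    | nil => intro _; simp
    | cons a L ih =>
      intro h
      rw [List.prod_cons, List.length_cons, pow_succ']
      refine Finset.mul_mem_mul ?_ (ih fun x hx => h x (List.mem_cons_of_mem _ hx))
      rcases h a List.mem_cons_self with h | h
      · simp only [T, Finset.mem_insert, Finset.mem_union]; right; left; simpa using h
      · simp only [T, Finset.mem_insert, Finset.mem_union, Finset.mem_image]; right; right
        exact ⟨a⁻¹, by simpa using h, inv_inv a⟩
  set K : ℝ := Real.log T.card + 1
  have hK : 0 < K := by have := Real.log_nonneg hTr; positivity
  refine ⟨Real.exp (K * (Λ * c + 1)), K * Λ, by positivity, by positivity, fun s hs => ?_⟩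
  set n := ⌈Λ * (s + c)⌉₊
  have hsub : {x : G | dist 1 x ≤ s} ⊆ (T ^ n : Finset G) := by
    intro x hx
    simp only [Set.mem_setOf_eq] at hx
    obtain ⟨L, hL, hg, hl⟩ := exists_word (S : Set G) hS x
    have h1 := (hq x).1
    have h2 : (L.length : ℝ) ≤ n := by
      rw [hl]
      refine le_trans ?_ (Nat.le_ceil _)
      have : (wordLength (S : Set G) x : ℝ) / Λ ≤ s + c := by linarith
      rw [div_le_iff₀ (by linarith)] at this
      linarith
    have h3 := hmem L hL
    rw [← hg] at h3
    exact Finset.pow_subset_pow_right hT1 (by exact_mod_cast h2) h3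
  refine ⟨(Finset.finite_toSet _).subset hsub, ?_⟩
  have h1 : ({x : G | dist 1 x ≤ s}.ncard : ℝ) ≤ (T.card : ℝ) ^ n := by
    have := Set.ncard_le_ncard hsub (Finset.finite_toSet _)
    rw [Set.ncard_coe_finset] at this
    exact_mod_cast this.trans (Finset.card_pow_le)
  refine h1.trans ?_
  have h2 : (T.card : ℝ) ^ n = Real.exp (Real.log T.card * n) := by
    rw [mul_comm, Real.exp_nat_mul, Real.exp_log (by linarith)]
  rw [h2, ← Real.exp_add]
  apply Real.exp_le_exp.2
  have h3 : (n : ℝ) ≤ Λ * (s + c) + 1 := (Nat.ceil_lt_add_one (by positivity)).le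
  have h4 : Real.log T.card * n ≤ K * n := by
    apply mul_le_mul_of_nonneg_right _ (by positivity)
    simp only [K]; linarith
  nlinarith

lemma shadow (hG : IsHypGroupMetric G) : ∃ c : ℝ, 0 < c ∧ ∀ (u : DivSeq G (1 : G)) (t : ℝ), 0 ≤ t →
    ∃ x : G, dist 1 x ≤ c * (t + 1) ∧ ∃ N : ℕ, ∀ m ≥ N, t ≤ gp 1 x (u.1 m) := by
  obtain ⟨hinv, ⟨δ, hδ, hyp⟩, S, hS, Λ, c, hΛ, hc, hq⟩ := hG
  set K := Λ + c
  have hK : 0 < K := by positivity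
  have hΛ0 : 0 < Λ := by linarith
  obtain ⟨N0, hN0⟩ := exists_nat_gt (2 * Λ * (c + K))
  obtain ⟨N1, hN01, hN1⟩ := chain_eps hδ hyp (a := 1 / (2 * Λ)) (ε := 1 / (4 * Λ)) (by positivity)
    (by positivity) N0
  refine ⟨Λ * (N1 + 4 * Λ * (1 + δ) + 1) + c + 1, by positivity, fun u t ht => ?_⟩
  set n := max N1 ⌈4 * Λ * (t + δ)⌉₊
  have hn1 : (n : ℝ) ≤ N1 + 4 * Λ * (t + δ) + 1 := by
    have h1 : (n : ℝ) ≤ N1 + (⌈4 * Λ * (t + δ)⌉₊ : ℝ) := by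
      exact_mod_cast max_le_add_of_nonneg (Nat.zero_le _) (Nat.zero_le _)
    have h2 := (Nat.ceil_lt_add_one (a := 4 * Λ * (t + δ)) (by positivity)).le
    linarith
  have hn2 : t + δ ≤ (1 / (2 * Λ) - 1 / (4 * Λ)) * n := by
    have h1 : 4 * Λ * (t + δ) ≤ n := by
      refine le_trans (Nat.le_ceil _) ?_
      exact_mod_cast le_max_right _ _
    have h2 : (1 / (2 * Λ) - 1 / (4 * Λ)) = 1 / (4 * Λ) := by field_simp; norm_num
    rw [h2, div_mul_eq_mul_div, le_div_iff₀ (by positivity)]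
    linarith
  obtain ⟨M, hM⟩ := tend_iff.1 u.2 (max (t + δ) (Λ * n + Λ + c + 1))
  simp only at hM
  obtain ⟨L, hL, hg, hl⟩ := exists_word (S : Set G) hS (u.1 M)
  let γ : ℕ → G := fun i => (L.take i).prod
  have hγL : γ L.length = u.1 M := by simp only [γ, List.take_length]; exact hg.symm
  have hlen : n < L.length := by
    have h1 := le_trans (le_max_right _ _) (hM M le_rfl M le_rfl)
    rw [gp_self] at h1
    have h2 := (hq (u.1 M)).2
    rw [← hl] at h2
    have h3 : Λ * n < Λ * L.length := by linarith
    have := lt_of_mul_lt_mul_left h3 hΛ0.le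
    exact_mod_cast this
  have hwl : ∀ i, i ≤ L.length → wordLength (S : Set G) (γ i) = i := by
    intro i hi
    apply le_antisymm
    · refine (wordLength_le_of_list _ _ fun x hx => hL x (List.mem_of_mem_take hx)).trans ?_
      simp
    · have h1 : u.1 M = γ i * (L.drop i).prod := by
        simp only [γ]; rw [List.prod_take_mul_prod_drop]; exact hg
      have h2 := wordLength_mul_le (S : Set G) hS (γ i) (L.drop i).prod
      rw [← h1, ← hl] at h2
      have h3 := wordLength_le_of_list (S : Set G) (L.drop i) fun x hx => hL x (List.mem_of_mem_drop hx)
      rw [List.length_drop] at h3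
      omega
  have hstep : ∀ i, i < L.length → dist (γ i) (γ (i + 1)) ≤ K := by
    intro i hi
    have h1 : γ (i + 1) = γ i * L[i] := by simp only [γ]; rw [List.prod_take_succ]
    have h2 : dist (γ i) (γ (i + 1)) = dist 1 L[i] := by
      have := hinv (γ i) 1 L[i]
      rw [mul_one] at this
      rw [h1, this]
    rw [h2]
    refine (hq _).2.trans ?_
    have h3 := wordLength_le_of_list (S : Set G) [L[i]] (by
      intro x hx; rw [List.mem_singleton] at hx; subst hx; exact hL _ (List.getElem_mem hi))
    simp at h3
    have h4 : (wordLength (S : Set G) L[i] : ℝ) ≤ 1 := by exact_mod_cast h3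
    simp only [K]
    nlinarith
  have hgp : ∀ k, N0 ≤ k → k < L.length → 1 / (2 * Λ) * k ≤ gp 1 (γ k) (γ (k + 1)) := by
    intro k hk hkl
    have h1 := (hq (γ k)).1
    rw [hwl k hkl.le] at h1
    have h2 := hstep k hkl
    have h3 : dist 1 (γ k) - dist (γ k) (γ (k+1)) ≤ gp 1 (γ k) (γ (k + 1)) := by
      unfold gp
      linarith [dist_triangle 1 (γ (k+1)) (γ k), dist_comm (γ k) 1, dist_comm (γ k) (γ (k + 1))]
    have h4 : (N0 : ℝ) ≤ k := by exact_mod_cast hk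
    have h5 : 1 / (2 * Λ) * k ≤ k / Λ - c - K := by
      have h6 : c + K ≤ k / (2 * Λ) := by
        rw [le_div_iff₀ (by positivity)]; linarith
      have h7 : (k : ℝ) / Λ = 1 / (2 * Λ) * k + k / (2 * Λ) := by field_simp; norm_num
      linarith
    linarith
  have hmain := hN1 1 γ L.length hgp n L.length (le_max_left _ _) hlen le_rfl
  rw [hγL] at hmain
  refine ⟨γ n, ?_, M, fun m hm => ?_⟩
  · have h1 := (hq (γ n)).2
    rw [hwl n hlen.le] at h1
    refine h1.trans ?_
    have h2 : Λ * n ≤ Λ * (N1 + 4 * Λ * (t + δ) + 1) := mul_le_mul_of_nonneg_left hn1 hΛ0.le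
    have h3 : Λ * (N1 + 4 * Λ * (t + δ) + 1) ≤ Λ * (N1 + 4 * Λ * (1 + δ) + 1) * (t + 1) := by
      rw [mul_assoc Λ _ (t + 1)]
      apply mul_le_mul_of_nonneg_left _ hΛ0.le
      have : 0 ≤ (N1 : ℝ) * t := by positivity
      have : 0 ≤ Λ * δ * t := by positivity
      have : 0 ≤ Λ * t := by positivity
      nlinarith
    nlinarith
  · have h1 := le_trans (le_max_left _ _) (hM M le_rfl m hm)
    have h2 := hyp (γ n) (u.1 m) (u.1 M) 1
    have := le_min (hn2.trans hmain) h1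
    linarith

lemma exists_net (hG : IsHypGroupMetric G) : ∃ A B : ℝ, 0 < A ∧ 0 < B ∧ ∀ t : ℝ, 0 ≤ t →
    ∃ F : Finset (Boundary G (1 : G)), (F.card : ℝ) ≤ A * Real.exp (B * t) ∧
      ∀ ξ, ∃ ζ ∈ F, qB 1 ζ ξ ≤ Real.exp (-t) := by
  obtain ⟨A, B, hA, hB, hgr⟩ := growth hG
  obtain ⟨c, hc, hsh⟩ := shadow hG
  obtain ⟨δ, hδ, hyp⟩ := hG.2.1
  refine ⟨A * Real.exp (B * (c * (5 * δ + 1))), B * c, by positivity, by positivity, fun t ht => ?_⟩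
  set s := c * (t + 5 * δ + 1)
  have hs : 0 ≤ s := by positivity
  obtain ⟨hfin, hcard⟩ := hgr s hs
  choose f hf using fun ξ : Boundary G (1 : G) => exists_rep ξ
  choose x hx1 hx2 using fun ξ : Boundary G (1 : G) => hsh (f ξ) (t + 5 * δ) (by positivity)
  rcases isEmpty_or_nonempty (Boundary G (1 : G)) with he | hne
  · exact ⟨∅, by simp; positivity, fun ξ => he.elim ξ⟩
  refine ⟨hfin.toFinset.image (Function.invFun x), ?_, fun ξ => ?_⟩
  · have h1 : ((hfin.toFinset.image (Function.invFun x)).card : ℝ) ≤ hfin.toFinset.card := by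
      exact_mod_cast Finset.card_image_le
    rw [← Set.ncard_eq_toFinset_card _ hfin] at h1
    refine (h1.trans hcard).trans (le_of_eq ?_)
    rw [mul_assoc, ← Real.exp_add]
    simp only [s]
    ring_nf
  · refine ⟨Function.invFun x (x ξ), Finset.mem_image_of_mem _ ?_, ?_⟩
    · simp only [Set.Finite.mem_toFinset, Set.mem_setOf_eq]
      exact hx1 ξ
    · have hz : x (Function.invFun x (x ξ)) = x ξ := Function.invFun_eq ⟨ξ, rfl⟩
      set ζ := Function.invFun x (x ξ)
      obtain ⟨N, hN⟩ := hx2 ξ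
      obtain ⟨N', hN'⟩ := hx2 ζ
      rw [hz] at hN'
      have := qB_le_of hδ hyp (f ζ) (f ξ) (t + 4 * δ) (max N N') (by
        intro n hn m hm
        have h1 := hN m (le_trans (le_max_left _ _) hm)
        have h2 := hN' n (le_trans (le_max_right _ _) hn)
        have h3 := hyp (f ζ |>.1 n) (f ξ |>.1 m) (x ξ) 1
        rw [gp_comm] at h2
        have := le_min h2 h1
        linarith)
      rw [hf, hf] at this
      refine this.trans (le_of_eq ?_)
      congr 1; ring

end Word

section Dimension
variable {A : Type*} [MeasurableSpace A]

/-- Quasi-metric data with finite-dimensional nets. -/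
structure QM (q : A → A → ℝ) (C : ℝ) : Prop where
  one_le : 1 ≤ C
  nonneg : ∀ x y, 0 ≤ q x y
  refl : ∀ x, q x x = 0
  symm : ∀ x y, q x y ≤ C * q y x
  tri : ∀ x y z, q x z ≤ C * max (q x y) (q y z)
  meas : ∀ x r, MeasurableSet (qball q x r)
  net : ∃ A0 B0 : ℝ, 0 < A0 ∧ 0 < B0 ∧ ∀ t : ℝ, 0 ≤ t →
    ∃ F : Finset A, (F.card : ℝ) ≤ A0 * Real.exp (B0 * t) ∧ ∀ ξ, ∃ ζ ∈ F, q ζ ξ ≤ Real.exp (-t)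

/-- Regularity of a measure. -/
def Reg (q : A → A → ℝ) (ν : Measure A) (D : ℝ) : Prop :=
  ∀ᵐ ξ ∂ν, ∀ ε > 0, ∃ r0 > 0, ∀ r, 0 < r → r < r0 →
    r ^ (D + ε) ≤ (ν (qball q ξ r)).toReal ∧ (ν (qball q ξ r)).toReal ≤ r ^ (D - ε)

variable {q : A → A → ℝ} {C : ℝ} {ν : Measure A} {D : ℝ}

lemma content_eq (α Δ : ℝ) (hα : 0 < α) : ∃ μ : OuterMeasure A,
    (∀ E, qHContent q α Δ E = μ E) ∧ ∀ E, qdiam q E ≤ ENNReal.ofReal Δ → μ E ≤ qdiam q E ^ α := by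
  let m : Set A → ℝ≥0∞ := fun s => if qdiam q s ≤ ENNReal.ofReal Δ then qdiam q s ^ α else ∞
  have hd : qdiam q (∅ : Set A) = 0 := by simp [qdiam]
  have m0 : m ∅ = 0 := by simp [m, hd, hα]
  refine ⟨OuterMeasure.ofFunction m m0, fun E => ?_, fun E hE => ?_⟩
  · rw [OuterMeasure.ofFunction_apply]
    unfold qHContent
    refine iInf_congr fun c => iInf_congr fun hc => ?_
    by_cases h : ∀ i, qdiam q (c i) ≤ ENNReal.ofReal Δ
    · rw [iInf_pos h]
      exact tsum_congr fun i => by simp [m, h i]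
    · rw [iInf_neg h]
      push Not at h
      obtain ⟨i, hi⟩ := h
      symm
      apply ENNReal.tsum_eq_top_of_eq_top
      exact ⟨i, by simp [m, not_le.2 hi]⟩
  · refine (OuterMeasure.ofFunction_le E).trans ?_
    simp [m, hE]

lemma qdiam_le (hq : QM q C) (ζ : A) (s : ℝ) : qdiam q {η | q ζ η ≤ s} ≤ ENNReal.ofReal (C * C * s) := by
  have hC := hq.one_le
  refine iSup₂_le fun x hx => iSup₂_le fun y hy => ENNReal.ofReal_le_ofReal ?_
  simp only [Set.mem_ofPred_eq] at hx hy
  refine (hq.tri x ζ y).trans ?_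
  rw [mul_assoc]
  apply mul_le_mul_of_nonneg_left _ (by linarith)
  have h0 := hq.nonneg ζ x
  apply max_le
  · refine (hq.symm x ζ).trans ?_
    exact mul_le_mul_of_nonneg_left hx (by linarith)
  · nlinarith

lemma content_le (hq : QM q C) {α Δ s : ℝ} (hα : 0 < α) (F : Finset A) (E : Set A)
    (hE : ∀ ξ ∈ E, ∃ ζ ∈ F, q ζ ξ ≤ s) (hs : 0 ≤ s) (hΔ : C * C * s ≤ Δ) :
    qHContent q α Δ E ≤ ENNReal.ofReal (F.card * (C * C * s) ^ α) := by
  have hC := hq.one_le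
  obtain ⟨μ, h1, h2⟩ := content_eq (q := q) α Δ hα
  rw [h1]
  have hsub : E ⊆ ⋃ ζ ∈ F, {η | q ζ η ≤ s} := by
    intro ξ hξ
    obtain ⟨ζ, hζ, h⟩ := hE ξ hξ
    simp only [Set.mem_iUnion]
    exact ⟨ζ, hζ, h⟩
  calc μ E ≤ μ (⋃ ζ ∈ F, {η | q ζ η ≤ s}) := μ.mono hsub
    _ ≤ ∑ ζ ∈ F, μ {η | q ζ η ≤ s} := measure_biUnion_finset_le F _
    _ ≤ ∑ ζ ∈ F, ENNReal.ofReal ((C * C * s) ^ α) := by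
        refine Finset.sum_le_sum fun ζ _ => ?_
        have h3 := qdiam_le hq ζ s
        refine (h2 _ (h3.trans (ENNReal.ofReal_le_ofReal hΔ))).trans ?_
        rw [← ENNReal.ofReal_rpow_of_nonneg (by positivity) hα.le]
        exact ENNReal.rpow_le_rpow h3 hα.le
    _ = _ := by
        rw [Finset.sum_const, nsmul_eq_mul, ENNReal.ofReal_mul (by positivity), ENNReal.ofReal_natCast]

lemma bdd_dim (hq : QM q C) (E : Set A) : BddAbove {α : ℝ | 0 ≤ α ∧ 0 < qHMeasure q α E} := by
  have hC := hq.one_le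
  obtain ⟨A0, B0, hA0, hB0, hnet⟩ := hq.net
  refine ⟨B0, fun α hα => ?_⟩
  obtain ⟨h0, hpos⟩ := hα
  by_contra hlt
  push Not at hlt
  refine hpos.ne' ?_
  unfold qHMeasure
  simp only [ENNReal.iSup_eq_zero]
  intro Δ hΔ
  have hα : 0 < α := by linarith
  have key : ∀ t : ℝ, 0 ≤ t → C * C * Real.exp (-t) ≤ Δ →
      qHContent q α Δ E ≤ ENNReal.ofReal (A0 * (C * C) ^ α * Real.exp (-(α - B0) * t)) := by
    intro t ht htΔ
    obtain ⟨F, hF, hF2⟩ := hnet t ht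
    refine (content_le hq hα F E (fun ξ _ => hF2 ξ) (by positivity) htΔ).trans ?_
    apply ENNReal.ofReal_le_ofReal
    rw [Real.mul_rpow (by positivity) (by positivity), ← Real.exp_mul]
    calc (F.card : ℝ) * ((C * C) ^ α * Real.exp (-t * α))
        ≤ (A0 * Real.exp (B0 * t)) * ((C * C) ^ α * Real.exp (-t * α)) := by gcongr
      _ = A0 * (C * C) ^ α * (Real.exp (B0 * t) * Real.exp (-t * α)) := by ring
      _ = _ := by rw [← Real.exp_add]; ring_nf
  have hten : Tendsto (fun t : ℝ => ENNReal.ofReal (A0 * (C * C) ^ α * Real.exp (-(α - B0) * t))) atTop (𝓝 0) := by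
    rw [← ENNReal.ofReal_zero]
    apply ENNReal.tendsto_ofReal
    rw [← mul_zero (A0 * (C * C) ^ α)]
    apply Tendsto.const_mul
    apply Real.tendsto_exp_atBot.comp
    exact tendsto_id.const_mul_atTop_of_neg (by linarith)
  have hev : ∀ᶠ t : ℝ in atTop, C * C * Real.exp (-t) ≤ Δ := by
    have : Tendsto (fun t : ℝ => C * C * Real.exp (-t)) atTop (𝓝 (C * C * 0)) :=
      (Real.tendsto_exp_neg_atTop_nhds_zero).const_mul _
    rw [mul_zero] at this
    exact this.eventually_le_const hΔ
  refine le_antisymm (ge_of_tendsto hten ?_) bot_le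
  filter_upwards [hev, eventually_ge_atTop 0] with t h1 h2 using key t h2 h1

/-- maximal separated sets give covers -/
lemma sep_cover (hq : QM q C) [IsProbabilityMeasure ν] {r m : ℝ} (hr : 0 < r) (hm : 0 < m) (E : Set A)
    (hE : ∀ ξ ∈ E, m ≤ (ν (qball q ξ r)).toReal) :
    ∃ F : Finset A, (F.card : ℝ) * m ≤ 1 ∧ ∀ ξ ∈ E, ∃ ζ ∈ F, q ζ ξ ≤ C * C * r := by
  have hC := hq.one_le
  let S : Set (Finset A) := {F | (∀ ξ ∈ F, ξ ∈ E) ∧ (F : Set A).PairwiseDisjoint fun ξ => qball q ξ r}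
  have hb : ∀ F ∈ S, (F.card : ℝ) * m ≤ 1 := by
    intro F hF
    have h1 : ν (⋃ ξ ∈ F, qball q ξ r) = ∑ ξ ∈ F, ν (qball q ξ r) :=
      measure_biUnion_finset hF.2 fun ξ _ => hq.meas ξ r
    have h2 : (∑ ξ ∈ F, ν (qball q ξ r)).toReal ≤ 1 := by
      rw [← h1]
      exact measureReal_le_one
    rw [ENNReal.toReal_sum (fun _ _ => measure_ne_top _ _)] at h2
    refine le_trans ?_ h2
    rw [← nsmul_eq_mul]
    exact Finset.card_nsmul_le_sum _ _ _ fun ξ hξ => hE ξ (hF.1 ξ hξ)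
  have hfin : (Finset.card '' S).Finite := by
    refine (Set.finite_Iic ⌊1 / m⌋₊).subset ?_
    rintro _ ⟨F, hF, rfl⟩
    simp only [Set.mem_Iic]
    apply Nat.le_floor
    rw [le_div_iff₀ hm]
    exact hb F hF
  have hne : (Finset.card '' S).Nonempty := ⟨0, ∅, by simp [S], rfl⟩
  obtain ⟨n, hn⟩ := hfin.exists_maximal hne
  obtain ⟨⟨F, hF, rfl⟩, hmax⟩ := hn
  refine ⟨F, hb F hF, fun ξ hξ => ?_⟩
  by_cases hξF : ξ ∈ F
  · exact ⟨ξ, hξF, by rw [hq.refl]; positivity⟩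
  by_contra hcon
  push Not at hcon
  have hS : insert ξ F ∈ S := by
    refine ⟨?_, ?_⟩
    · intro x hx
      rcases Finset.mem_insert.1 hx with rfl | hx
      · exact hξ
      · exact hF.1 x hx
    · rw [Finset.coe_insert]
      refine hF.2.insert_of_notMem (by simpa using hξF) ?_
      intro ζ hζ
      rw [Set.disjoint_left]
      intro x hx hx'
      simp only [qball, Set.mem_ofPred_eq] at hx hx'
      have h1 := hcon ζ hζ
      have h2 := hq.tri ζ x ξ
      have h3 := hq.symm x ξ
      have h4 : max (q ζ x) (q x ξ) ≤ C * r := by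
        apply max_le
        · nlinarith
        · nlinarith
      nlinarith
  have h := hmax ⟨_, hS, rfl⟩
  rw [Finset.card_insert_of_notMem hξF] at h
  have := h (by simp)
  simp at this

lemma dim_upper (hq : QM q C) [IsProbabilityMeasure ν] {α β : ℝ} (hα : 0 < α) (hβ : β < α)
    (E : Set A)
    (hE : ∀ ξ ∈ E, ∃ r0 > 0, ∀ r, 0 < r → r < r0 → r ^ β ≤ (ν (qball q ξ r)).toReal) :
    qHMeasure q α E = 0 := by
  have hC := hq.one_le
  unfold qHMeasure
  simp only [ENNReal.iSup_eq_zero]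
  intro Δ hΔ
  let Ek : ℕ → Set A := fun k => {ξ ∈ E | ∀ r, 0 < r → r < 1 / ((k : ℝ) + 1) →
    r ^ β ≤ (ν (qball q ξ r)).toReal}
  have hun : E ⊆ ⋃ k, Ek k := by
    intro ξ hξ
    obtain ⟨r0, hr0, h⟩ := hE ξ hξ
    obtain ⟨k, hk⟩ := exists_nat_one_div_lt hr0
    exact Set.mem_iUnion.2 ⟨k, hξ, fun r h1 h2 => h r h1 (h2.trans hk)⟩
  obtain ⟨μ, h1, h2⟩ := content_eq (q := q) α Δ hα
  have hk : ∀ k, qHContent q α Δ (Ek k) = 0 := by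
    intro k
    have hten : Tendsto (fun r : ℝ => ENNReal.ofReal ((C * C * (C * C)) ^ α * r ^ (α - β))) (𝓝[>] 0) (𝓝 0) := by
      rw [← ENNReal.ofReal_zero]
      apply ENNReal.tendsto_ofReal
      have h3 : Tendsto (fun r : ℝ => r ^ (α - β)) (𝓝[>] 0) (𝓝 0) := by
        have := (Real.continuousAt_rpow_const 0 (α - β) (Or.inr (by linarith))).tendsto
        rw [Real.zero_rpow (by linarith)] at this
        exact this.mono_left nhdsWithin_le_nhds
      have := h3.const_mul ((C * C * (C * C)) ^ α)
      rwa [mul_zero] at this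
    refine le_antisymm (ge_of_tendsto hten ?_) bot_le
    have e1 : ∀ᶠ r : ℝ in 𝓝[>] 0, r < 1 / ((k : ℝ) + 1) :=
      mem_nhdsWithin_of_mem_nhds (Iio_mem_nhds (by positivity))
    have e2 : ∀ᶠ r : ℝ in 𝓝[>] 0, r < Δ / (C * C * (C * C)) :=
      mem_nhdsWithin_of_mem_nhds (Iio_mem_nhds (by positivity))
    filter_upwards [e1, e2, self_mem_nhdsWithin] with r hr1 hr2 hr
    have hr : 0 < r := hr
    rw [lt_div_iff₀ (by positivity)] at hr2
    obtain ⟨F, hF, hF2⟩ := sep_cover (ν := ν) hq hr (Real.rpow_pos_of_pos hr β) (Ek k) (fun ξ hξ => hξ.2 r hr hr1)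
    refine (content_le hq hα F (Ek k) hF2 (by positivity) (by nlinarith)).trans ?_
    apply ENNReal.ofReal_le_ofReal
    have e3 : C * C * (C * C * r) = (C * C * (C * C)) * r := by ring
    rw [e3, Real.mul_rpow (by positivity) hr.le]
    have e4 : r ^ α = r ^ β * r ^ (α - β) := by rw [← Real.rpow_add hr]; ring_nf
    rw [e4]
    calc (F.card : ℝ) * ((C * C * (C * C)) ^ α * (r ^ β * r ^ (α - β)))
        = (F.card * r ^ β) * ((C * C * (C * C)) ^ α * r ^ (α - β)) := by ring
      _ ≤ 1 * ((C * C * (C * C)) ^ α * r ^ (α - β)) := by gcongr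
      _ = _ := one_mul _
  rw [h1]
  refine le_antisymm ((μ.mono hun).trans ?_) bot_le
  refine (measure_iUnion_le (μ := μ) Ek).trans ?_
  simp [← h1, hk]

lemma dim_lower [IsProbabilityMeasure ν] {α : ℝ} (hα : 0 < α)
    (E : Set A) (hpos : 0 < ν E)
    (hE : ∀ᵐ ξ ∂ν, ∃ r0 > 0, ∀ r, 0 < r → r < r0 → (ν (qball q ξ r)).toReal ≤ r ^ α) :
    0 < qHMeasure q α E := by
  let Ek : ℕ → Set A := fun k => {ξ ∈ E | ∀ r, 0 < r → r < 1 / ((k : ℝ) + 1) →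
    (ν (qball q ξ r)).toReal ≤ r ^ α}
  have hex : ∃ k, 0 < ν (Ek k) := by
    by_contra hcon
    push Not at hcon
    have h1 : ν (⋃ k, Ek k) = 0 := measure_iUnion_null fun k => le_antisymm (hcon k) bot_le
    have h2 : ν (E ∩ {ξ | ∃ r0 > 0, ∀ r, 0 < r → r < r0 → (ν (qball q ξ r)).toReal ≤ r ^ α}) = ν E :=
      measure_inter_conull hE
    rw [← h2] at hpos
    refine hpos.ne' (measure_mono_null ?_ h1)
    rintro ξ ⟨hξ, r0, hr0, h⟩
    obtain ⟨k, hk⟩ := exists_nat_one_div_lt hr0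
    exact Set.mem_iUnion.2 ⟨k, hξ, fun r h1 h2 => h r h1 (h2.trans hk)⟩
  obtain ⟨k, hk⟩ := hex
  set r1 : ℝ := 1 / ((k : ℝ) + 1)
  have hr1 : 0 < r1 := by positivity
  have key : ν (Ek k) ≤ (2 : ℝ≥0∞) ^ α * qHContent q α (r1 / 4) E := by
    unfold qHContent
    rw [ENNReal.mul_iInf_of_ne (by simp) (by simp)]
    refine le_iInf fun c => ?_
    rw [ENNReal.mul_iInf_of_ne (by simp) (by simp)]
    refine le_iInf fun hc => ?_
    rw [ENNReal.mul_iInf_of_ne (by simp) (by simp)]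
    refine le_iInf fun hd => ?_
    have hsub : Ek k ⊆ ⋃ i, (c i ∩ Ek k) := by
      intro ξ hξ
      obtain ⟨i, hi⟩ := Set.mem_iUnion.1 (hc hξ.1)
      exact Set.mem_iUnion.2 ⟨i, hi, hξ⟩
    refine (measure_mono hsub).trans ((measure_iUnion_le _).trans ?_)
    rw [← ENNReal.tsum_mul_left]
    refine ENNReal.tsum_le_tsum fun i => ?_
    rcases Set.eq_empty_or_nonempty (c i ∩ Ek k) with h0 | ⟨ξ, hξ1, hξ2⟩
    · rw [h0]; simp
    have hdf : qdiam q (c i) ≠ ∞ := ne_top_of_le_ne_top ENNReal.ofReal_ne_top (hd i)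
    set s := (qdiam q (c i)).toReal
    have hs0 : 0 ≤ s := ENNReal.toReal_nonneg
    have hs : s ≤ r1 / 4 := by
      have := ENNReal.toReal_mono ENNReal.ofReal_ne_top (hd i)
      rwa [ENNReal.toReal_ofReal (by positivity)] at this
    have hball : ∀ r, s < r → c i ⊆ qball q ξ r := by
      intro r hr η hη
      simp only [qball, Set.mem_ofPred_eq]
      refine lt_of_le_of_lt ?_ hr
      have h1 : ENNReal.ofReal (q ξ η) ≤ qdiam q (c i) :=
        le_iSup₂_of_le ξ hξ1 (le_iSup₂_of_le η hη le_rfl)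
      rwa [ENNReal.ofReal_le_iff_le_toReal hdf] at h1
    have hbound : ∀ r, s < r → r < r1 → ν (c i ∩ Ek k) ≤ ENNReal.ofReal (r ^ α) := by
      intro r h1 h2
      refine (measure_mono (Set.inter_subset_left.trans (hball r h1))).trans ?_
      rw [← ENNReal.ofReal_toReal (measure_ne_top ν (qball q ξ r))]
      exact ENNReal.ofReal_le_ofReal (hξ2.2 r (by linarith) h2)
    rw [← ENNReal.mul_rpow_of_nonneg _ _ hα.le, ← ENNReal.ofReal_toReal hdf]
    have e2 : (2 : ℝ≥0∞) = ENNReal.ofReal 2 := by simp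
    rw [e2, ← ENNReal.ofReal_mul (by norm_num), ENNReal.ofReal_rpow_of_nonneg (by positivity) hα.le]
    have hcont : Tendsto (fun r : ℝ => ENNReal.ofReal (r ^ α)) (𝓝[>] (2 * s)) (𝓝 (ENNReal.ofReal ((2 * s) ^ α))) := by
      apply ENNReal.tendsto_ofReal
      exact ((Real.continuousAt_rpow_const (2 * s) α (Or.inr hα.le)).tendsto).mono_left nhdsWithin_le_nhds
    refine ge_of_tendsto hcont ?_
    have e1 : ∀ᶠ r : ℝ in 𝓝[>] (2 * s), r < r1 :=
      mem_nhdsWithin_of_mem_nhds (Iio_mem_nhds (by linarith))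
    filter_upwards [e1, self_mem_nhdsWithin] with r h1 h2
    have h2 : 2 * s < r := h2
    exact hbound r (by linarith) h1
  have h1 : 0 < qHContent q α (r1 / 4) E := by
    rw [pos_iff_ne_zero]
    intro h0
    rw [h0, mul_zero] at key
    exact absurd key (not_le.2 hk)
  refine lt_of_lt_of_le h1 ?_
  unfold qHMeasure
  exact le_iSup₂_of_le (r1 / 4) (by positivity) le_rfl

lemma reg_D_nonneg [IsProbabilityMeasure ν] (h : Reg q ν D) : 0 ≤ D := by
  obtain ⟨ξ, hξ⟩ := h.exists
  by_contra hD
  push Not at hD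
  obtain ⟨r0, hr0, h⟩ := hξ (-D / 2) (by linarith)
  have h1 := (h (min (r0 / 2) (1 / 2)) (by positivity) (lt_of_le_of_lt (min_le_left _ _) (by linarith))).1
  have h2 : (ν (qball q ξ (min (r0 / 2) (1 / 2)))).toReal ≤ 1 := measureReal_le_one
  have h3 : 1 < (min (r0 / 2) (1 / 2)) ^ (D + -D / 2) := by
    apply Real.one_lt_rpow_of_pos_of_lt_one_of_neg (by positivity) _ (by linarith)
    exact lt_of_le_of_lt (min_le_right _ _) (by norm_num)
  linarith

lemma reg_hasDim (hq : QM q C) [IsProbabilityMeasure ν] (h : Reg q ν D) : HasDim q ν D := by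
  have hD := reg_D_nonneg h
  have hlow : ∀ E : Set A, 0 < ν E → D ≤ qdimSet q E := by
    intro E hE
    apply le_of_forall_lt
    intro c hc
    by_cases hc0 : c < 0
    · refine lt_of_lt_of_le hc0 (Real.sSup_nonneg fun α hα => hα.1)
    push Not at hc0
    set α := (c + D) / 2
    have hα : 0 < α := by simp only [α]; linarith
    refine lt_of_lt_of_le (show c < α by simp only [α]; linarith) ?_
    refine le_csSup (bdd_dim hq E) ⟨hα.le, dim_lower hα E hE ?_⟩
    filter_upwards [h] with ξ hξ
    obtain ⟨r0, hr0, h1⟩ := hξ (D - α) (by simp only [α]; linarith)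
    refine ⟨r0, hr0, fun r h2 h3 => ?_⟩
    have := (h1 r h2 h3).2
    rwa [sub_sub_cancel] at this
  obtain ⟨N, hN1, hN2, hN3⟩ := exists_measurable_superset_of_null (show ν {ξ | ¬ _} = 0 from h)
  have hup : qdimSet q Nᶜ ≤ D := by
    refine Real.sSup_le (fun α hα => ?_) hD
    by_contra hlt
    push Not at hlt
    refine hα.2.ne' (dim_upper (ν := ν) hq (β := (D + α) / 2) (by linarith) (by linarith) _ ?_)
    intro ξ hξ
    have : ξ ∉ {ξ | ¬ _} := fun hh => hξ (hN1 hh)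
    simp only [Set.mem_ofPred_eq, not_not] at this
    obtain ⟨r0, hr0, h1⟩ := this ((α - D) / 2) (by linarith)
    refine ⟨r0, hr0, fun r h2 h3 => ?_⟩
    have := (h1 r h2 h3).1
    rwa [show D + (α - D) / 2 = (D + α) / 2 by ring] at this
  have hfull : ∀ E : Set A, ν Eᶜ = 0 → 0 < ν E := by
    intro E hE
    rw [pos_iff_ne_zero]
    intro h0
    have h1 : ν (Set.univ) ≤ ν E + ν Eᶜ := by
      rw [← Set.union_compl_self E]; exact measure_union_le _ _
    rw [h0, hE, measure_univ] at h1
    simp at h1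
  have hNc : ν Nᶜᶜ = 0 := by rw [compl_compl]; exact hN3
  have heq : qdimSet q Nᶜ = D := le_antisymm hup (hlow _ (hfull _ hNc))
  constructor
  · unfold qdimUpper
    apply le_antisymm
    · refine csInf_le ⟨D, ?_⟩ ⟨Nᶜ, hN2.compl, hNc, heq.symm⟩
      rintro _ ⟨E, -, hE, rfl⟩
      exact hlow _ (hfull _ hE)
    · refine le_csInf ⟨D, Nᶜ, hN2.compl, hNc, heq.symm⟩ ?_
      rintro _ ⟨E, -, hE, rfl⟩
      exact hlow _ (hfull _ hE)
  · unfold qdimLower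
    apply le_antisymm
    · refine csInf_le ⟨D, ?_⟩ ⟨Nᶜ, hN2.compl, hfull _ hNc, heq.symm⟩
      rintro _ ⟨E, -, hE, rfl⟩
      exact hlow _ hE
    · refine le_csInf ⟨D, Nᶜ, hN2.compl, hfull _ hNc, heq.symm⟩ ?_
      rintro _ ⟨E, -, hE, rfl⟩
      exact hlow _ hE

lemma reg_exactDim (h : Reg q ν D) : ExactDim q ν D := by
  unfold ExactDim
  filter_upwards [h] with ξ hξ
  rw [Metric.tendsto_nhds]
  intro ε hε
  obtain ⟨r0, hr0, h1⟩ := hξ (ε / 2) (by linarith)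
  have e1 : ∀ᶠ r : ℝ in 𝓝[>] 0, r < r0 := mem_nhdsWithin_of_mem_nhds (Iio_mem_nhds hr0)
  have e2 : ∀ᶠ r : ℝ in 𝓝[>] 0, r < 1 := mem_nhdsWithin_of_mem_nhds (Iio_mem_nhds one_pos)
  filter_upwards [e1, e2, self_mem_nhdsWithin] with r h2 h3 h4
  have h4 : 0 < r := h4
  obtain ⟨h5, h6⟩ := h1 r h4 h2
  have hp : 0 < (ν (qball q ξ r)).toReal := lt_of_lt_of_le (Real.rpow_pos_of_pos h4 _) h5
  have hl : Real.log r < 0 := Real.log_neg h4 h3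
  have h7 := Real.log_le_log (Real.rpow_pos_of_pos h4 _) h5
  have h8 := Real.log_le_log hp h6
  rw [Real.log_rpow h4] at h7 h8
  rw [Real.dist_eq, abs_lt]
  constructor
  · have : D - ε / 2 ≤ Real.log (ν (qball q ξ r)).toReal / Real.log r := by
      rw [le_div_iff_of_neg hl]; exact h8
    linarith
  · have : Real.log (ν (qball q ξ r)).toReal / Real.log r ≤ D + ε / 2 := by
      rw [div_le_iff_of_neg hl]; exact h7
    linarith

end Dimension

section Abstract
variable {A : Type*} [MeasurableSpace A] {q : A → A → ℝ} {C : ℝ} {D : ℝ}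
variable {Ω : Type*} [MeasurableSpace Ω] {P : Measure Ω} {b : Ω → A} {T : Type*}

/-- The data needed at precision `ε`. -/
def EData (T : Type*) (q : A → A → ℝ) (C D : ℝ) (P : Measure Ω) (b : Ω → A) (K ε : ℝ) : Prop :=
  ∃ (τ : ℕ → Ω → T) (Gd : ℕ → Set Ω), (∀ R t, MeasurableSet {ω | τ R ω = t}) ∧
    (∀ᵐ ω ∂P, ∀ᶠ R in atTop, ω ∈ Gd R) ∧
    ∀ᶠ R : ℕ in atTop, ∀ ω ∈ Gd R,
      (Real.exp (-((D + ε) * R)) ≤ (P {ω' | τ R ω' = τ R ω}).toReal ∧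
        (P {ω' | τ R ω' = τ R ω}).toReal ≤ Real.exp (-((D - ε) * R))) ∧
      (∀ ω' ∈ Gd R, τ R ω' = τ R ω → q (b ω) (b ω') ≤ Real.exp (-((1 - K * ε) * R))) ∧
      ∃ S : Finset T, (S.card : ℝ) ≤ Real.exp (K * ε * R) ∧
        ∀ ω' ∈ Gd R, q (b ω) (b ω') ≤ C * C * Real.exp (-R) → τ R ω' ∈ S

lemma summable_exp_nat {a : ℝ} (ha : 0 < a) : ∑' R : ℕ, ENNReal.ofReal (Real.exp (-(a * R))) ≠ ∞ := by
  have h : Summable fun R : ℕ => Real.exp (-(a * R)) := by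
    have := Real.summable_exp_nat_mul_iff.2 (show -a < 0 by linarith)
    refine this.congr fun n => ?_
    ring_nf
  rw [← ENNReal.ofReal_tsum_of_nonneg (fun _ => by positivity) h]
  exact ENNReal.ofReal_ne_top

lemma bc_lemma {s : ℕ → Set Ω} {a : ℝ} (ha : 0 < a)
    (h : ∀ᶠ R : ℕ in atTop, P (s R) ≤ ENNReal.ofReal (Real.exp (-(a * R)))) :
    ∀ᵐ ω ∂P, ∀ᶠ R in atTop, ω ∉ s R := by
  obtain ⟨N, hN⟩ := eventually_atTop.1 h
  have : ∀ᵐ ω ∂P, ∀ᶠ R in atTop, ω ∉ (fun R => if N ≤ R then s R else ∅) R := by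
    apply ae_eventually_notMem
    refine ne_top_of_le_ne_top (summable_exp_nat ha) (ENNReal.tsum_le_tsum fun R => ?_)
    by_cases hR : N ≤ R
    · simpa [hR] using hN R hR
    · simp [hR]
  filter_upwards [this] with ω hω
  filter_upwards [hω, eventually_ge_atTop N] with R h1 h2
  simpa [h2] using h1

lemma edata_lower (hq : QM q C) [Countable T] [IsProbabilityMeasure P] (hb : Measurable b) {K ε : ℝ} (hε : 0 < ε)
    (h : EData T q C D P b K ε) : ∀ᵐ ω ∂P, ∀ᶠ R : ℕ in atTop,
      Real.exp (-((D + 2 * ε) * R)) ≤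
        ((P.map b) (qball q (b ω) (Real.exp (-((1 - (K + 1) * ε) * R))))).toReal := by
  obtain ⟨τ, Gd, hm, hG, hev⟩ := h
  let Bd : ℕ → Set Ω := fun R => {ω ∈ Gd R | P (Gd R ∩ {ω' | τ R ω' = τ R ω}) ≤
    ENNReal.ofReal (Real.exp (-(ε * R))) * P {ω' | τ R ω' = τ R ω}}
  have hB : ∀ R : ℕ, P (Bd R) ≤ ENNReal.ofReal (Real.exp (-(ε * R))) := by
    intro R
    let J : Set T := {t | P (Gd R ∩ {ω' | τ R ω' = t}) ≤
      ENNReal.ofReal (Real.exp (-(ε * R))) * P {ω' | τ R ω' = t}}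
    have hsub : Bd R ⊆ ⋃ t : J, (Gd R ∩ {ω' | τ R ω' = t}) := by
      intro ω hω
      exact Set.mem_iUnion.2 ⟨⟨τ R ω, hω.2⟩, hω.1, rfl⟩
    calc P (Bd R) ≤ ∑' t : J, P (Gd R ∩ {ω' | τ R ω' = t}) :=
          (measure_mono hsub).trans (measure_iUnion_le _)
      _ ≤ ∑' t : J, ENNReal.ofReal (Real.exp (-(ε * R))) * P {ω' | τ R ω' = t} :=
          ENNReal.tsum_le_tsum fun t => t.2
      _ = ENNReal.ofReal (Real.exp (-(ε * R))) * ∑' t : J, P {ω' | τ R ω' = t} := ENNReal.tsum_mul_left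
      _ ≤ ENNReal.ofReal (Real.exp (-(ε * R))) * 1 := by
          gcongr
          rw [← measure_iUnion (f := fun t : J => {ω' | τ R ω' = t}) (fun s t hst => ?_) (fun t => hm R t)]
          · exact prob_le_one
          · rw [Function.onFun, Set.disjoint_left]
            intro ω h1 h2
            exact hst (Subtype.ext (h1.symm.trans h2))
      _ = _ := mul_one _
  have hbc := bc_lemma (P := P) hε (Eventually.of_forall hB)
  filter_upwards [hG, hbc] with ω h1 h2
  filter_upwards [h1, h2, hev, eventually_gt_atTop 0] with R h1 h2 h3 hR0
  have hR : (0 : ℝ) < R := by exact_mod_cast hR0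
  obtain ⟨⟨h4, -⟩, h5, -⟩ := h3 ω h1
  have h6 : ENNReal.ofReal (Real.exp (-(ε * R))) * P {ω' | τ R ω' = τ R ω} <
      P (Gd R ∩ {ω' | τ R ω' = τ R ω}) := by
    by_contra hcon
    exact h2 ⟨h1, not_lt.1 hcon⟩
  rw [Measure.map_apply hb (hq.meas _ _)]
  have h7 : P (Gd R ∩ {ω' | τ R ω' = τ R ω}) ≤
      P (b ⁻¹' qball q (b ω) (Real.exp (-((1 - (K + 1) * ε) * R)))) := by
    apply measure_mono
    rintro ω' ⟨h8, h9⟩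
    refine lt_of_le_of_lt (h5 ω' h8 h9) (Real.exp_lt_exp.2 ?_)
    nlinarith
  have h8 := ENNReal.toReal_mono (measure_ne_top _ _) (h6.le.trans h7)
  rw [ENNReal.toReal_mul, ENNReal.toReal_ofReal (by positivity)] at h8
  refine le_trans ?_ h8
  calc Real.exp (-((D + 2 * ε) * R)) = Real.exp (-(ε * R)) * Real.exp (-((D + ε) * R)) := by
        rw [← Real.exp_add]; ring_nf
    _ ≤ _ := by gcongr

lemma edata_upper (hq : QM q C) [Countable T] [IsProbabilityMeasure P] (hb : Measurable b) {K ε : ℝ} (hε : 0 < ε)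
    (h : EData T q C D P b K ε) : ∀ᵐ ω ∂P, ∀ᶠ R : ℕ in atTop,
      ((P.map b) (qball q (b ω) (Real.exp (-R)))).toReal ≤ Real.exp (-((D - (K + 2) * ε) * R)) := by
  obtain ⟨τ, Gd, hm, hG, hev⟩ := h
  have hC := hq.one_le
  have : IsProbabilityMeasure (P.map b) := Measure.isProbabilityMeasure_map hb.aemeasurable
  set ν := P.map b
  let Bd : ℕ → Set Ω := fun R => {ω ∈ Gd R |
    Real.exp (-((D - (K + 2) * ε) * R)) < (ν (qball q (b ω) (Real.exp (-R)))).toReal}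
  have hB : ∀ᶠ R : ℕ in atTop, P (Bd R) ≤ ENNReal.ofReal (Real.exp (-(ε * R))) := by
    filter_upwards [hev] with R hR
    let J : Set T := τ R '' Bd R
    choose f hf1 hf2 using fun t : J => t.2
    have hJ : ∀ F : Finset J, (F.card : ℝ) ≤ Real.exp ((D - 2 * ε) * R) := by
      intro F
      have hmult : ∀ x : A, ∑ t ∈ F, (qball q (b (f t)) (Real.exp (-R))).indicator (fun _ => (1 : ℝ≥0∞)) x ≤
          ENNReal.ofReal (Real.exp (K * ε * R)) := by
        intro x
        rw [Finset.sum_indicator_eq_sum_filter, Finset.sum_const, nsmul_eq_mul, mul_one]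
        rcases Finset.eq_empty_or_nonempty (F.filter fun t => x ∈ qball q (b (f t)) (Real.exp (-R))) with h0 | ⟨t0, ht0⟩
        · rw [h0]; simp
        obtain ⟨-, -, S, hS1, hS2⟩ := hR (f t0) (hf1 t0).1
        have hc : (F.filter fun t => x ∈ qball q (b (f t)) (Real.exp (-R))).card ≤ S.card := by
          apply Finset.card_le_card_of_injOn (fun t : J => (t : T))
          · intro t ht
            have ht := (Finset.mem_filter.1 ht).2
            have ht0 := (Finset.mem_filter.1 ht0).2
            have := hS2 (f t) (hf1 t).1 (by
              simp only [qball, Set.mem_ofPred_eq] at ht ht0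
              refine (hq.tri _ x _).trans ?_
              rw [mul_assoc]
              apply mul_le_mul_of_nonneg_left _ (by linarith)
              have := Real.exp_pos (-(R : ℝ))
              apply max_le
              · nlinarith
              · exact (hq.symm _ _).trans (mul_le_mul_of_nonneg_left ht.le (by linarith)))
            rw [hf2] at this
            exact this
          · intro s _ t _ hst
            exact Subtype.ext hst
        rw [← ENNReal.ofReal_natCast]
        apply ENNReal.ofReal_le_ofReal
        refine le_trans ?_ hS1
        exact_mod_cast hc
      have h1 : ∑ t ∈ F, ν (qball q (b (f t)) (Real.exp (-R))) ≤ ENNReal.ofReal (Real.exp (K * ε * R)) := by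
        calc ∑ t ∈ F, ν (qball q (b (f t)) (Real.exp (-R)))
            = ∑ t ∈ F, ∫⁻ x, (qball q (b (f t)) (Real.exp (-R))).indicator (fun _ => (1 : ℝ≥0∞)) x ∂ν := by
              refine Finset.sum_congr rfl fun t _ => ?_
              rw [lintegral_indicator (hq.meas _ _)]; simp
          _ = ∫⁻ x, ∑ t ∈ F, (qball q (b (f t)) (Real.exp (-R))).indicator (fun _ => (1 : ℝ≥0∞)) x ∂ν := by
              rw [lintegral_finsetSum]
              intro t _
              exact measurable_const.indicator (hq.meas _ _)
          _ ≤ ∫⁻ x, ENNReal.ofReal (Real.exp (K * ε * R)) ∂ν := lintegral_mono hmult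
          _ = _ := by simp
      have h2 := ENNReal.toReal_mono ENNReal.ofReal_ne_top h1
      rw [ENNReal.toReal_ofReal (by positivity), ENNReal.toReal_sum (fun _ _ => measure_ne_top _ _)] at h2
      have h3 : (F.card : ℝ) * Real.exp (-((D - (K + 2) * ε) * R)) ≤ Real.exp (K * ε * R) := by
        refine le_trans ?_ h2
        rw [← nsmul_eq_mul]
        exact Finset.card_nsmul_le_sum _ _ _ fun t _ => (hf1 t).2.le
      rw [Real.exp_neg, ← div_eq_mul_inv, div_le_iff₀ (by positivity), ← Real.exp_add] at h3
      refine h3.trans (le_of_eq ?_)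
      ring_nf
    have hsub : Bd R ⊆ ⋃ t : J, {ω' | τ R ω' = t} := by
      intro ω hω
      exact Set.mem_iUnion.2 ⟨⟨τ R ω, ω, hω, rfl⟩, rfl⟩
    refine (measure_mono hsub).trans ((measure_iUnion_le _).trans ?_)
    rw [ENNReal.tsum_eq_iSup_sum]
    refine iSup_le fun F => ?_
    have h1 : ∀ t : J, P {ω' | τ R ω' = t} ≤ ENNReal.ofReal (Real.exp (-((D - ε) * R))) := by
      intro t
      have := (hR (f t) (hf1 t).1).1.2
      rw [hf2] at this
      rw [← ENNReal.ofReal_toReal (measure_ne_top P {ω' | τ R ω' = t})]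
      exact ENNReal.ofReal_le_ofReal this
    refine (Finset.sum_le_card_nsmul _ _ _ fun t _ => h1 t).trans ?_
    rw [nsmul_eq_mul, ← ENNReal.ofReal_natCast, ← ENNReal.ofReal_mul (by positivity)]
    apply ENNReal.ofReal_le_ofReal
    calc (F.card : ℝ) * Real.exp (-((D - ε) * R)) ≤ Real.exp ((D - 2 * ε) * R) * Real.exp (-((D - ε) * R)) := by
          gcongr; exact hJ F
      _ = _ := by rw [← Real.exp_add]; ring_nf
  have hbc := bc_lemma (P := P) hε hB
  filter_upwards [hG, hbc] with ω h1 h2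
  filter_upwards [h1, h2] with R h1 h2
  by_contra hcon
  exact h2 ⟨h1, not_le.1 hcon⟩

lemma exists_dense (hq : QM q C) : ∃ I : Set A, I.Countable ∧ ∀ ξ, ∀ r > 0, ∃ ζ ∈ I, q ζ ξ < r := by
  obtain ⟨A0, B0, -, -, hnet⟩ := hq.net
  choose F hF1 hF2 using fun n : ℕ => hnet n (by positivity)
  refine ⟨⋃ n, (F n : Set A), Set.countable_iUnion fun n => (F n).countable_toSet, fun ξ r hr => ?_⟩
  have : Tendsto (fun n : ℕ => Real.exp (-(n : ℝ))) atTop (𝓝 0) :=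
    Real.tendsto_exp_neg_atTop_nhds_zero.comp tendsto_natCast_atTop_atTop
  obtain ⟨n, hn⟩ := (this.eventually_lt_const hr).exists
  obtain ⟨ζ, h1, h2⟩ := hF2 n ξ
  exact ⟨ζ, Set.mem_iUnion.2 ⟨n, h1⟩, lt_of_le_of_lt h2 hn⟩

lemma transfer_lower (hq : QM q C) [IsProbabilityMeasure P] (hb : Measurable b) (s c : ℕ → ℝ) (hs : ∀ R, 0 < s R)
    (h : ∀ᵐ ω ∂P, ∀ᶠ R : ℕ in atTop, c R ≤ ((P.map b) (qball q (b ω) (s R))).toReal) :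
    ∀ᵐ ξ ∂(P.map b), ∀ᶠ R : ℕ in atTop, c R ≤ ((P.map b) (qball q ξ (C * C * C * s R))).toReal := by
  have hC := hq.one_le
  have : IsProbabilityMeasure (P.map b) := Measure.isProbabilityMeasure_map hb.aemeasurable
  set ν := P.map b with hν
  obtain ⟨I, hI, hd⟩ := exists_dense hq
  let Z : ℕ → Set A := fun R => ⋃ ζ ∈ I, {ξ | ξ ∈ qball q ζ (C * s R) ∧ c R ≤ (ν (qball q ζ (C * s R))).toReal}
  have hZm : ∀ R, MeasurableSet (Z R) := fun R => MeasurableSet.biUnion hI fun ζ _ =>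
    (hq.meas _ _).inter (MeasurableSet.const _)
  have hm : MeasurableSet {ξ | ∀ᶠ R in atTop, ξ ∈ Z R} := by
    have : {ξ | ∀ᶠ R in atTop, ξ ∈ Z R} = liminf Z atTop := by
      ext ξ; rw [Filter.mem_liminf_iff_eventually_mem]; rfl
    rw [this]
    exact MeasurableSet.measurableSet_liminf hZm
  have h1 : ∀ᵐ ξ ∂ν, ∀ᶠ R in atTop, ξ ∈ Z R := by
    rw [hν, ae_map_iff hb.aemeasurable hm]
    filter_upwards [h] with ω hω
    filter_upwards [hω] with R hR
    obtain ⟨ζ, hζ, h2⟩ := hd (b ω) (s R) (hs R)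
    refine Set.mem_biUnion hζ ⟨?_, hR.trans ?_⟩
    · simp only [qball, Set.mem_ofPred_eq]; have := hs R; nlinarith
    · apply ENNReal.toReal_mono (measure_ne_top _ _) (measure_mono _)
      intro η hη
      simp only [qball, Set.mem_ofPred_eq] at hη ⊢
      refine lt_of_le_of_lt (hq.tri _ (b ω) _) ?_
      have := max_lt h2 hη
      nlinarith
  filter_upwards [h1] with ξ hξ
  filter_upwards [hξ] with R hR
  simp only [Z, Set.mem_iUnion] at hR
  obtain ⟨ζ, hζ, h2, h3⟩ := hR
  refine h3.trans (ENNReal.toReal_mono (measure_ne_top _ _) (measure_mono ?_))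
  intro η hη
  simp only [qball, Set.mem_ofPred_eq] at hη h2 ⊢
  refine lt_of_le_of_lt (hq.tri _ ζ _) ?_
  have h4 := hq.symm ξ ζ
  have h5 : max (q ξ ζ) (q ζ η) < C * C * s R := by
    apply max_lt
    · nlinarith
    · have := hs R; nlinarith [mul_pos (show 0 < C by linarith) this]
  nlinarith

lemma transfer_upper (hq : QM q C) [IsProbabilityMeasure P] (hb : Measurable b) (s c : ℕ → ℝ) (hs : ∀ R, 0 < s R)
    (h : ∀ᵐ ω ∂P, ∀ᶠ R : ℕ in atTop, ((P.map b) (qball q (b ω) (s R))).toReal ≤ c R) :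
    ∀ᵐ ξ ∂(P.map b), ∀ᶠ R : ℕ in atTop, ((P.map b) (qball q ξ (s R / (C * C * C)))).toReal ≤ c R := by
  have hC := hq.one_le
  have : IsProbabilityMeasure (P.map b) := Measure.isProbabilityMeasure_map hb.aemeasurable
  set ν := P.map b with hν
  obtain ⟨I, hI, hd⟩ := exists_dense hq
  let r : ℕ → ℝ := fun R => s R / (C * C)
  have hr : ∀ R, 0 < r R := fun R => by have := hs R; positivity
  have hrs : ∀ R, s R = C * C * r R := fun R => by simp only [r]; field_simp
  let Z : ℕ → Set A := fun R => ⋂ ζ ∈ I, {ξ | ξ ∈ qball q ζ (r R) → (ν (qball q ζ (r R))).toReal ≤ c R}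
  have hZm : ∀ R, MeasurableSet (Z R) := fun R => MeasurableSet.biInter hI fun ζ _ =>
    ((hq.meas _ _).imp (MeasurableSet.const _))
  have hm : MeasurableSet {ξ | ∀ᶠ R in atTop, ξ ∈ Z R} := by
    have : {ξ | ∀ᶠ R in atTop, ξ ∈ Z R} = liminf Z atTop := by
      ext ξ; rw [Filter.mem_liminf_iff_eventually_mem]; rfl
    rw [this]
    exact MeasurableSet.measurableSet_liminf hZm
  have h1 : ∀ᵐ ξ ∂ν, ∀ᶠ R in atTop, ξ ∈ Z R := by
    rw [hν, ae_map_iff hb.aemeasurable hm]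
    filter_upwards [h] with ω hω
    filter_upwards [hω] with R hR
    simp only [Z, Set.mem_iInter, Set.mem_ofPred_eq]
    intro ζ hζ h2
    refine le_trans (ENNReal.toReal_mono (measure_ne_top _ _) (measure_mono ?_)) hR
    intro η hη
    simp only [qball, Set.mem_ofPred_eq] at hη h2 ⊢
    refine lt_of_le_of_lt (hq.tri _ ζ _) ?_
    have h4 := hq.symm (b ω) ζ
    have h5 : max (q (b ω) ζ) (q ζ η) < C * r R := by
      apply max_lt
      · nlinarith
      · have := hr R; nlinarith
    rw [hrs]
    nlinarith
  filter_upwards [h1] with ξ hξ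
  filter_upwards [hξ] with R hR
  simp only [Z, Set.mem_iInter, Set.mem_ofPred_eq] at hR
  have hrC : 0 < r R / C := by have := hr R; positivity
  have e1 : s R / (C * C * C) = r R / C := by simp only [r]; field_simp
  have e2 : C * (r R / C) = r R := by field_simp
  obtain ⟨ζ, hζ, h2⟩ := hd ξ (r R / C) hrC
  refine le_trans (ENNReal.toReal_mono (measure_ne_top _ _) (measure_mono ?_)) (hR ζ hζ ?_)
  · intro η hη
    rw [e1] at hη
    simp only [qball, Set.mem_ofPred_eq] at hη ⊢
    refine lt_of_le_of_lt (hq.tri _ ξ _) ?_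
    have := max_lt h2 hη
    nlinarith
  · simp only [qball, Set.mem_ofPred_eq]
    nlinarith

set_option maxHeartbeats 800000 in
lemma edata_reg (hq : QM q C) [Countable T] [IsProbabilityMeasure P] (hb : Measurable b) {K ε0 : ℝ}
    (hK : 0 ≤ K) (hε0 : 0 < ε0) (hD : 0 ≤ D)
    (h : ∀ ε, 0 < ε → ε < ε0 → EData T q C D P b K ε) : Reg q (P.map b) D := by
  have hC := hq.one_le
  have : IsProbabilityMeasure (P.map b) := Measure.isProbabilityMeasure_map hb.aemeasurable
  set ν := P.map b with hν
  set Q := C * C * C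
  have hQ : 1 ≤ Q := by
    have : 1 ≤ C * C := by nlinarith
    simp only [Q]; nlinarith
  have hlQ : 0 ≤ Real.log Q := Real.log_nonneg hQ
  have key : ∀ ε' > 0, ∀ᵐ ξ ∂ν, ∃ r0 > 0, ∀ r, 0 < r → r < r0 →
      r ^ (D + ε') ≤ (ν (qball q ξ r)).toReal ∧ (ν (qball q ξ r)).toReal ≤ r ^ (D - ε') := by
    intro ε' hε'
    set W := 3 + (K + 2) * (D + ε') + (K + 2)
    have hW : 0 < W := by positivity
    set ε := min (ε' / (4 * W)) (min (1 / (4 * W)) (ε0 / 2))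
    have hε : 0 < ε := by positivity
    have hεW : ε * W ≤ ε' / 4 := by
      have : ε ≤ ε' / (4 * W) := min_le_left _ _
      rw [le_div_iff₀ (by positivity)] at this
      linarith
    have hεW' : ε * W ≤ 1 / 4 := by
      have : ε ≤ 1 / (4 * W) := (min_le_right _ _).trans (min_le_left _ _)
      rw [le_div_iff₀ (by positivity)] at this
      linarith
    have hεlt : ε < ε0 := lt_of_le_of_lt ((min_le_right _ _).trans (min_le_right _ _)) (by linarith)
    have hKε : (K + 1) * ε ≤ 1 / 4 := by
      have : (K + 1) * ε ≤ ε * W := by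
        rw [mul_comm]
        apply mul_le_mul_of_nonneg_left _ hε.le
        simp only [W]; nlinarith [mul_nonneg hK hD, mul_nonneg hK hε'.le]
      linarith
    have hKε2 : (K + 2) * ε ≤ ε' / 4 := by
      have : (K + 2) * ε ≤ ε * W := by
        rw [mul_comm]
        apply mul_le_mul_of_nonneg_left _ hε.le
        simp only [W]; nlinarith [mul_nonneg hK hD, mul_nonneg hK hε'.le]
      linarith
    set κ := 1 - (K + 1) * ε
    have hκ : 0 < κ := by simp only [κ]; linarith
    have hκ2 : D + 2 * ε ≤ κ * (D + ε' / 2) := by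
      have : 2 * ε + (K + 1) * ε * (D + ε' / 2) ≤ ε * W := by
        have : 2 + (K + 1) * (D + ε' / 2) ≤ W := by
          simp only [W]; nlinarith [mul_nonneg hK hD, mul_nonneg hK hε'.le]
        nlinarith [mul_le_mul_of_nonneg_left this hε.le]
      simp only [κ]; nlinarith
    have hdat := h ε hε hεlt
    have hlo := transfer_lower hq hb _ _ (fun R => Real.exp_pos _) (edata_lower hq hb hε hdat)
    have hup := transfer_upper hq hb _ _ (fun R => Real.exp_pos _) (edata_upper hq hb hε hdat)
    filter_upwards [hlo, hup] with ξ h1 h2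
    obtain ⟨N, hN⟩ := eventually_atTop.1 (h1.and h2)
    set L0 := max (max (N + Real.log Q + 1) 1)
      (max (((Real.log Q / κ + 1) * (D + 2 * ε)) / (ε' / 2)) ((Real.log Q + 1) * D / (ε' / 2)))
    refine ⟨Real.exp (-L0), Real.exp_pos _, fun r hr hr0 => ?_⟩
    set L := -Real.log r
    have hrL : r = Real.exp (-L) := by simp only [L]; rw [neg_neg, Real.exp_log hr]
    have hL : L0 < L := by
      rw [hrL] at hr0
      have := Real.exp_lt_exp.1 hr0
      linarith
    have hL1 : N + Real.log Q + 1 < L := lt_of_le_of_lt ((le_max_left _ _).trans (le_max_left _ _)) hL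
    have hL2 : 1 < L := lt_of_le_of_lt ((le_max_right _ _).trans (le_max_left _ _)) hL
    have hL3 : (Real.log Q / κ + 1) * (D + 2 * ε) ≤ ε' / 2 * L := by
      have := (lt_of_le_of_lt ((le_max_left _ _).trans (le_max_right _ _)) hL).le
      rw [div_le_iff₀ (by positivity)] at this
      linarith
    have hL4 : (Real.log Q + 1) * D ≤ ε' / 2 * L := by
      have := (lt_of_le_of_lt ((le_max_right _ _).trans (le_max_right _ _)) hL).le
      rw [div_le_iff₀ (by positivity)] at this
      linarith
    have hQe : Q = Real.exp (Real.log Q) := (Real.exp_log (by linarith)).symm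
    constructor
    · set R := ⌈(L + Real.log Q) / κ⌉₊
      have hR1 : (L + Real.log Q) / κ ≤ R := Nat.le_ceil _
      have hR2 : (R : ℝ) ≤ (L + Real.log Q) / κ + 1 := (Nat.ceil_lt_add_one (by positivity)).le
      have hRκ : L + Real.log Q ≤ R * κ := by rwa [div_le_iff₀ hκ] at hR1
      have hRN : N ≤ R := by
        have : (N : ℝ) ≤ R := by
          have : (R : ℝ) * κ ≤ R := by
            have : 0 ≤ (R : ℝ) := by positivity
            have : κ ≤ 1 := by simp only [κ]; nlinarith
            nlinarith
          linarith
        exact_mod_cast this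
      have h3 := (hN R hRN).1
      have h4 : ν (qball q ξ (Q * Real.exp (-(κ * R)))) ≤ ν (qball q ξ r) := by
        apply measure_mono
        intro η hη
        simp only [qball, Set.mem_ofPred_eq] at hη ⊢
        refine lt_of_lt_of_le hη ?_
        rw [hQe, ← Real.exp_add, hrL]
        apply Real.exp_le_exp.2
        linarith
      refine le_trans ?_ (h3.trans (ENNReal.toReal_mono (measure_ne_top _ _) h4))
      rw [hrL, ← Real.exp_mul]
      apply Real.exp_le_exp.2
      have h5 : (D + 2 * ε) * R ≤ (D + 2 * ε) * ((L + Real.log Q) / κ + 1) := by gcongr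
      have h6 : (D + 2 * ε) * ((L + Real.log Q) / κ + 1) = (D + 2 * ε) / κ * L + (Real.log Q / κ + 1) * (D + 2 * ε) := by
        field_simp; ring
      have h7 : (D + 2 * ε) / κ ≤ D + ε' / 2 := by
        rw [div_le_iff₀ hκ]; linarith
      have h8 : (D + 2 * ε) / κ * L ≤ (D + ε' / 2) * L := by gcongr
      nlinarith
    · set R := ⌊L - Real.log Q⌋₊
      have hR1 : (R : ℝ) ≤ L - Real.log Q := Nat.floor_le (by linarith [show (0:ℝ) ≤ N by positivity])
      have hR2 : L - Real.log Q < R + 1 := Nat.lt_floor_add_one _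
      have hRN : N ≤ R := by
        apply Nat.le_floor; linarith
      have h3 := (hN R hRN).2
      have h4 : ν (qball q ξ r) ≤ ν (qball q ξ (Real.exp (-R) / Q)) := by
        apply measure_mono
        intro η hη
        simp only [qball, Set.mem_ofPred_eq] at hη ⊢
        refine lt_of_lt_of_le hη ?_
        rw [hQe, ← Real.exp_sub, hrL]
        apply Real.exp_le_exp.2
        linarith
      refine le_trans (ENNReal.toReal_mono (measure_ne_top _ _) h4) (h3.trans ?_)
      rw [hrL, ← Real.exp_mul]
      apply Real.exp_le_exp.2
      have h5 : D * (L - (Real.log Q + 1)) ≤ D * R := by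
        apply mul_le_mul_of_nonneg_left _ hD; linarith
      have h6 : (K + 2) * ε * R ≤ ε' / 4 * L := by
        have : (R : ℝ) ≤ L := by linarith
        have : (0 : ℝ) ≤ R := by positivity
        have h0 : 0 ≤ (K + 2) * ε := by positivity
        have h1 := mul_le_mul hKε2 ‹(R : ℝ) ≤ L› this (by linarith)
        exact h1
      have e1 : -((D - (K + 2) * ε) * R) = (K + 2) * ε * R - D * R := by ring
      have e2 : -L * (D - ε') = ε' * L - D * L := by ring
      have e3 : D * (L - (Real.log Q + 1)) = D * L - (Real.log Q + 1) * D := by ring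
      have e4 : 0 ≤ ε' * L := by positivity
      rw [e1, e2]
      rw [e3] at h5
      linarith
  have hall : ∀ᵐ ξ ∂ν, ∀ j : ℕ, ∃ r0 > 0, ∀ r, 0 < r → r < r0 →
      r ^ (D + 1 / ((j : ℝ) + 1)) ≤ (ν (qball q ξ r)).toReal ∧
      (ν (qball q ξ r)).toReal ≤ r ^ (D - 1 / ((j : ℝ) + 1)) := by
    rw [ae_all_iff]
    exact fun j => key _ (by positivity)
  unfold Reg
  filter_upwards [hall] with ξ hξ ε hε
  obtain ⟨j, hj⟩ := exists_nat_one_div_lt hε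
  obtain ⟨r0, hr0, h1⟩ := hξ j
  refine ⟨min r0 1, by positivity, fun r h2 h3 => ?_⟩
  obtain ⟨h4, h5⟩ := h1 r h2 (lt_of_lt_of_le h3 (min_le_left _ _))
  have h6 : r ≤ 1 := (lt_of_lt_of_le h3 (min_le_right _ _)).le
  exact ⟨le_trans (Real.rpow_le_rpow_of_exponent_ge h2 h6 (by linarith)) h4,
    h5.trans (Real.rpow_le_rpow_of_exponent_ge h2 h6 (by linarith))⟩

end Abstract

open ProbabilityTheory

/-- shift -/
def sh {G : Type*} (ω : ℕ → G) : ℕ → G := fun i => ω (i + 1)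

lemma sh_iter {G : Type*} (n : ℕ) (ω : ℕ → G) : sh^[n] ω = fun i => ω (i + n) := by
  induction n generalizing ω with
  | zero => rfl
  | succ n ih =>
    rw [Function.iterate_succ_apply, ih]
    funext i
    simp only [sh]
    congr 1

lemma measurable_sh {G : Type*} [MeasurableSpace G] : Measurable (sh (G := G)) := by
  unfold sh
  fun_prop

lemma block_factor {H : Type*} [Group H] {β : Type*} (U : Finset ℕ) (f : (ℕ → H) → β)
    (hf : ∀ ω ω', (∀ i ∈ U, ω i = ω' i) → f ω = f ω') :
    f = (fun v : U → H => f (fun i => if h : i ∈ U then v ⟨i, h⟩ else 1)) ∘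
      (fun (ω : ℕ → H) (i : U) => ω i) := by
  funext ω
  apply hf
  intro i hi
  simp [hi]

section rw
variable {G : Type*} [Group G] [Countable G] [MeasurableSpace G] [DiscreteMeasurableSpace G]
  {p : G → ℝ≥0∞} {P : Measure (ℕ → G)}

lemma rw_eq_infinitePi (hp : IsProb p) (hP : IsRWMeasure p P) :
    ∃ pm : Measure G, IsProbabilityMeasure pm ∧ (∀ g, pm {g} = p g) ∧
      P = Measure.infinitePi (fun _ : ℕ => pm) := by
  have hpr := hP.1
  let μ : PMF G := ⟨p, by
    have h := ENNReal.summable.hasSum (f := p)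
    rw [hp] at h
    exact h⟩
  have hsing : ∀ g, μ.toMeasure {g} = p g := fun g => by
    rw [PMF.toMeasure_apply_singleton _ _ (measurableSet_singleton g)]
    rfl
  refine ⟨μ.toMeasure, inferInstance, hsing, ?_⟩
  set Q := Measure.infinitePi (fun _ : ℕ => μ.toMeasure) with hQ
  have hmap : ∀ n : ℕ, P.map (fun ω (i : Fin n) => ω i) = Q.map (fun ω (i : Fin n) => ω i) := by
    intro n
    have hm : Measurable (fun (ω : ℕ → G) (i : Fin n) => ω i) := by fun_prop
    apply Measure.ext_of_singleton
    intro v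
    rw [Measure.map_apply hm (measurableSet_singleton v),
      Measure.map_apply hm (measurableSet_singleton v)]
    have e : (fun (ω : ℕ → G) (i : Fin n) => ω i) ⁻¹' {v} =
        {ω | ∀ i < n, ω i = (fun i => if h : i < n then v ⟨i, h⟩ else 1) i} := by
      ext ω
      simp only [Set.mem_preimage, Set.mem_singleton_iff, Set.mem_ofPred_eq, funext_iff]
      constructor
      · intro h i hi
        simp [hi, ← h ⟨i, hi⟩]
      · intro h i
        have := h i i.2
        simpa using this
    rw [e, hP.2]
    have e2 : {ω : ℕ → G | ∀ i < n, ω i = (fun i => if h : i < n then v ⟨i, h⟩ else 1) i} =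
        Set.pi (Finset.range n : Set ℕ) (fun i => {if h : i < n then v ⟨i, h⟩ else 1}) := by
      ext ω
      simp [Set.mem_pi]
    rw [e2, hQ, Measure.infinitePi_pi _ (fun i _ => measurableSet_singleton _)]
    simp only [hsing]
  apply Measure.eq_infinitePi
  intro s t ht
  obtain ⟨n, hn⟩ : ∃ n, ∀ i ∈ s, i < n := ⟨s.sup id + 1, fun i hi =>
    Nat.lt_succ_of_le (Finset.le_sup (f := id) hi)⟩
  have hm : Measurable (fun (ω : ℕ → G) (i : Fin n) => ω i) := by fun_prop
  have e : Set.pi (s : Set ℕ) t = (fun (ω : ℕ → G) (i : Fin n) => ω i) ⁻¹'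
      {v | ∀ i : Fin n, (i : ℕ) ∈ s → v i ∈ t i} := by
    ext ω
    simp only [Set.mem_pi, Finset.mem_coe, Set.mem_preimage, Set.mem_ofPred_eq]
    exact ⟨fun h i hi => h i hi, fun h i hi => h ⟨i, hn i hi⟩ hi⟩
  have hms : MeasurableSet {v : Fin n → G | ∀ i : Fin n, (i : ℕ) ∈ s → v i ∈ t i} :=
    Set.Countable.measurableSet (Set.to_countable _)
  rw [← Measure.infinitePi_pi (μ := fun _ : ℕ => μ.toMeasure) (fun i _ => ht i), e,
    ← Measure.map_apply hm hms, hmap n, Measure.map_apply hm hms]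

lemma rw_indep (hp : IsProb p) (hP : IsRWMeasure p P) :
    iIndepFun (fun (i : ℕ) (ω : ℕ → G) => ω i) P := by
  obtain ⟨pm, _, _, rfl⟩ := rw_eq_infinitePi hp hP
  exact iIndepFun_infinitePi (X := fun _ x => x) (fun _ => measurable_id)

lemma rw_marg (hp : IsProb p) (hP : IsRWMeasure p P) (i : ℕ) (s : Set G) :
    P {ω | ω i ∈ s} = ∑' g, s.indicator p g := by
  obtain ⟨pm, hpm, hs, rfl⟩ := rw_eq_infinitePi hp hP
  have h := Measure.infinitePi_map_eval (fun _ : ℕ => pm) i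
  have h2 : pm s = ∑' g, s.indicator p g := by
    rw [← MeasureTheory.Measure.tsum_indicator_apply_singleton _ _ (MeasurableSet.of_discrete)]
    simp only [hs]
  rw [← h2]
  conv_rhs => rw [← h]
  rw [Measure.map_apply (by fun_prop) MeasurableSet.of_discrete]
  rfl

lemma rw_sh (hp : IsProb p) (hP : IsRWMeasure p P) : MeasurePreserving sh P P := by
  obtain ⟨pm, _, _, rfl⟩ := rw_eq_infinitePi hp hP
  refine ⟨measurable_sh, ?_⟩
  exact Measure.map_infinitePi_infinitePi_of_inj (P := fun _ : ℕ => pm) (f := fun i : ℕ => i + 1)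
    (fun a b h => by simpa using h)

/-- independence of functions of disjoint blocks -/
lemma block_indep (hi : iIndepFun (fun (i : ℕ) (ω : ℕ → G) => ω i) P) {β γ : Type*}
    [MeasurableSpace β] [MeasurableSpace γ] (S T : Finset ℕ) (hST : Disjoint S T)
    (f : (ℕ → G) → β) (g : (ℕ → G) → γ)
    (hf : ∀ ω ω', (∀ i ∈ S, ω i = ω' i) → f ω = f ω')
    (hg : ∀ ω ω', (∀ i ∈ T, ω i = ω' i) → g ω = g ω') : IndepFun f g P := by
  have h := hi.indepFun_finset S T hST (fun i => by fun_prop)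
  rw [block_factor S f hf, block_factor T g hg]
  exact h.comp (Measurable.of_discrete) (Measurable.of_discrete)

lemma measurable_of_block {β : Type*} [MeasurableSpace β] (S : Finset ℕ)
    (f : (ℕ → G) → β) (hf : ∀ ω ω', (∀ i ∈ S, ω i = ω' i) → f ω = f ω') : Measurable f := by
  rw [block_factor S f hf]
  exact Measurable.comp (Measurable.of_discrete) (by fun_prop)

lemma walk_congr {H : Type*} [Group H] {ω ω' : ℕ → H} {n : ℕ} (h : ∀ i < n, ω i = ω' i) :
    walk ω n = walk ω' n := by
  unfold walk
  congr 1
  apply List.map_congr_left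
  intro a ha
  exact h a (List.mem_range.1 ha)

lemma walk_succ {H : Type*} [Group H] (ω : ℕ → H) (n : ℕ) :
    walk ω (n+1) = walk ω n * ω n := by
  unfold walk
  rw [List.range_succ]
  simp

lemma walk_zero {H : Type*} [Group H] (ω : ℕ → H) : walk ω 0 = 1 := rfl

lemma walk_add {H : Type*} [Group H] (ω : ℕ → H) (n m : ℕ) :
    walk ω (n+m) = walk ω n * walk (sh^[n] ω) m := by
  induction m with
  | zero => simp [walk_zero]
  | succ m ih =>
    rw [← add_assoc, walk_succ, ih, walk_succ, mul_assoc, sh_iter]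
    simp [add_comm]

lemma walk_hom {H K : Type*} [Group H] [Group K] (φ : H →* K) (ω : ℕ → H) (n : ℕ) :
    φ (walk ω n) = walk (fun i => φ (ω i)) n := by
  induction n with
  | zero => simp [walk_zero]
  | succ n ih => rw [walk_succ, walk_succ, map_mul, ih]

lemma measurable_walk (n : ℕ) : Measurable (fun ω : ℕ → G => walk ω n) :=
  measurable_of_block (Finset.range n) _ fun ω ω' h => walk_congr fun i hi =>
    h i (Finset.mem_range.2 hi)

/-- law of the image of the walk under a homomorphism -/
lemma law_walk (hp : IsProb p) (hP : IsRWMeasure p P) {H : Type*} [Group H] [Countable H]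
    [MeasurableSpace H] [DiscreteMeasurableSpace H] (φ : G →* H) (μ : H → ℝ≥0∞)
    (hμ : ∀ h, μ h = ∑' g, (φ ⁻¹' {h}).indicator p g) (n : ℕ) (h : H) :
    P {ω | φ (walk ω n) = h} = piN μ n h := by
  have hpr := hP.1
  induction n generalizing h with
  | zero =>
    simp only [walk_zero, map_one, piN]
    by_cases hh : h = 1
    · simp [hh]
    · have : ¬ (1 = h) := fun h' => hh h'.symm
      simp [hh, this]
  | succ n ih =>
    have hi := rw_indep hp hP
    have e : {ω : ℕ → G | φ (walk ω (n+1)) = h} =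
        ⋃ y : H, ({ω | φ (walk ω n) = y} ∩ {ω | φ (ω n) = y⁻¹ * h}) := by
      ext ω
      simp only [Set.mem_ofPred_eq, Set.mem_iUnion, Set.mem_inter_iff, walk_succ, map_mul]
      constructor
      · intro hh
        exact ⟨_, rfl, by rw [← hh]; group⟩
      · rintro ⟨y, h1, h2⟩
        rw [h1, h2]; group
    have hmφ : Measurable φ := Measurable.of_discrete
    have hm1 : ∀ y, MeasurableSet {ω : ℕ → G | φ (walk ω n) = y} := fun y =>
      (hmφ.comp (measurable_walk n)) (measurableSet_singleton y)
    have hm2 : ∀ y, MeasurableSet {ω : ℕ → G | φ (ω n) = y} := fun y =>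
      (hmφ.comp (by fun_prop : Measurable fun ω : ℕ → G => ω n)) (measurableSet_singleton y)
    rw [e, measure_iUnion]
    · simp only [piN, conv]
      congr 1
      funext y
      have hind : IndepFun (fun ω : ℕ → G => φ (walk ω n)) (fun ω => φ (ω n)) P :=
        block_indep hi (Finset.range n) {n} (by simp) _ _
          (fun ω ω' h => by rw [walk_congr fun i hi => h i (Finset.mem_range.2 hi)])
          (fun ω ω' h => by rw [h n (by simp)])
      have := hind.measure_inter_preimage_eq_mul {y} {y⁻¹ * h} (measurableSet_singleton _)
        (measurableSet_singleton _)
      have h3 : P {ω | φ (ω n) = y⁻¹ * h} = μ (y⁻¹ * h) := by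
        rw [hμ]
        exact rw_marg hp hP n (φ ⁻¹' {y⁻¹ * h})
      rw [← ih y, ← h3]
      exact this
    · intro y z hyz
      refine Set.disjoint_left.2 ?_
      rintro ω ⟨h1, _⟩ ⟨h2, _⟩
      exact hyz (h1.symm.trans h2)
    · intro y
      exact (hm1 y).inter (hm2 _)

lemma mp_iter (hp : IsProb p) (hP : IsRWMeasure p P) (n : ℕ) : MeasurePreserving sh^[n] P P :=
  (rw_sh hp hP).iterate n

lemma walk_sh_congr {ω ω' : ℕ → G} {n m : ℕ} (h : ∀ i, n ≤ i → i < n + m → ω i = ω' i) :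
    walk (sh^[n] ω) m = walk (sh^[n] ω') m := by
  apply walk_congr
  intro i hi
  rw [sh_iter, sh_iter]
  exact h _ (by omega) (by omega)

lemma law_pair2 (hp : IsProb p) (hP : IsRWMeasure p P) {H K : Type*} [Group H] [Countable H]
    [MeasurableSpace H] [DiscreteMeasurableSpace H] (φ : G →* H) (μ : H → ℝ≥0∞)
    (hμ : ∀ h, μ h = ∑' g, (φ ⁻¹' {h}).indicator p g) [Group K] [Countable K]
    [MeasurableSpace K] [DiscreteMeasurableSpace K] (ψ : G →* K) (κ : K → ℝ≥0∞)
    (hκ : ∀ h, κ h = ∑' g, (ψ ⁻¹' {h}).indicator p g) (n m : ℕ) (g : K) (h : H) :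
    P {ω | ψ (walk ω n) = g ∧ φ (walk (sh^[n] ω) m) = h} = piN κ n g * piN μ m h := by
  have hi := rw_indep hp hP
  have hind : IndepFun (fun ω : ℕ → G => ψ (walk ω n)) (fun ω => φ (walk (sh^[n] ω) m)) P :=
    block_indep hi (Finset.range n) (Finset.Ico n (n+m)) (by
      rw [Finset.disjoint_left]
      intro a ha hb
      simp at ha hb
      omega) _ _
      (fun ω ω' h => by rw [walk_congr fun i hi => h i (Finset.mem_range.2 hi)])
      (fun ω ω' h => by
        rw [walk_sh_congr fun i h1 h2 => h i (Finset.mem_Ico.2 ⟨h1, h2⟩)])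
  have := hind.measure_inter_preimage_eq_mul {g} {h} (measurableSet_singleton _)
    (measurableSet_singleton _)
  have h1 : P {ω | ψ (walk ω n) = g} = piN κ n g := law_walk hp hP ψ κ hκ n g
  have h2 : P {ω | φ (walk (sh^[n] ω) m) = h} = piN μ m h := by
    rw [← law_walk hp hP φ μ hμ m h]
    exact (mp_iter hp hP n).measure_preimage
      (((Measurable.of_discrete (f := φ)).comp
        (measurable_walk m)) (measurableSet_singleton h)).nullMeasurableSet
  rw [← h1, ← h2]
  exact this

lemma marg_id {H : Type*} [Group H] (q : H → ℝ≥0∞) (h : H) :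
    q h = ∑' g, ((MonoidHom.id H) ⁻¹' {h}).indicator q g := by
  rw [tsum_eq_single h]
  · simp
  · intro b hb
    simp [hb]

lemma law_pair (hp : IsProb p) (hP : IsRWMeasure p P) {H : Type*} [Group H] [Countable H]
    [MeasurableSpace H] [DiscreteMeasurableSpace H] (φ : G →* H) (μ : H → ℝ≥0∞)
    (hμ : ∀ h, μ h = ∑' g, (φ ⁻¹' {h}).indicator p g) (n m : ℕ) (g : G) (h : H) :
    P {ω | walk ω n = g ∧ φ (walk (sh^[n] ω) m) = h} = piN p n g * piN μ m h :=
  law_pair2 hp hP φ μ hμ (MonoidHom.id G) p (marg_id p) n m g h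

/-- zero-one law -/
lemma rw_zero_one (hp : IsProb p) (hP : IsRWMeasure p P) (A : Set (ℕ → G))
    (hA : MeasurableSet A) (hsub : sh ⁻¹' A ⊆ A) : P A = 0 ∨ P A = 1 := by
  have hpr := hP.1
  have hi := rw_indep hp hP
  set B : Set (ℕ → G) := ⋂ n, sh^[n] ⁻¹' A with hB
  have hanti : Antitone (fun n => sh^[n] ⁻¹' A) := by
    apply antitone_nat_of_succ_le
    intro n ω hω
    rw [Set.mem_preimage, Function.iterate_succ_apply'] at hω
    exact hsub hω
  have hPB : P B = P A := by
    have h1 := tendsto_measure_iInter_atTop (μ := P) (s := fun n => sh^[n] ⁻¹' A)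
      (fun n => ((mp_iter hp hP n).measurable hA).nullMeasurableSet) hanti
      ⟨0, measure_ne_top _ _⟩
    have h2 : (P ∘ fun n => sh^[n] ⁻¹' A) = fun _ => P A := by
      funext n
      exact (mp_iter hp hP n).measure_preimage hA.nullMeasurableSet
    rw [h2] at h1
    exact tendsto_nhds_unique h1 tendsto_const_nhds
  have hBN : ∀ N, sh^[N] ⁻¹' B = B := by
    intro N
    ext ω
    simp only [hB, Set.mem_preimage, Set.mem_iInter]
    constructor
    · intro h n
      have := h n
      rw [← Function.iterate_add_apply] at this
      exact hanti (Nat.le_add_right n N) this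
    · intro h n
      rw [← Function.iterate_add_apply]
      exact h _
  have hBm : MeasurableSet B := MeasurableSet.iInter fun n => (mp_iter hp hP n).measurable hA
  have htail : MeasurableSet[limsup (fun i : ℕ => MeasurableSpace.comap
      (fun ω : ℕ → G => ω i) inferInstance) atTop] B := by
    rw [limsup_eq_iInf_iSup_of_nat]
    rw [MeasurableSpace.measurableSet_iInf]
    intro N
    have hmeas : Measurable[⨆ i, ⨆ (_ : i ≥ N), MeasurableSpace.comap
      (fun ω : ℕ → G => ω i) inferInstance] (sh^[N] : (ℕ → G) → (ℕ → G)) := by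
      have e : (sh^[N] : (ℕ → G) → (ℕ → G)) = fun ω i => ω (i + N) := by
        funext ω
        exact sh_iter N ω
      rw [e]
      apply @measurable_pi_lambda _ _ _ (_) _
      intro i
      apply Measurable.mono (comap_measurable (fun ω : ℕ → G => ω (i+N))) _ le_rfl
      exact le_iSup₂_of_le (i + N) (Nat.le_add_left N i) le_rfl
    have := hmeas hBm
    rwa [hBN N] at this
  rw [← hPB]
  exact measure_zero_or_one_of_measurableSet_limsup_atTop
    (fun n => (by fun_prop : Measurable fun ω : ℕ → G => ω n).comap_le) hi.iIndep htail

end rw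


section kingman
variable {Ω : Type*} [MeasurableSpace Ω] {P : Measure Ω} [IsProbabilityMeasure P] {T : Ω → Ω}

lemma ae_orbit (hT : MeasurePreserving T P P) {Q : Ω → Prop} (hQ : ∀ᵐ ω ∂P, Q ω) :
    ∀ᵐ ω ∂P, ∀ n : ℕ, Q (T^[n] ω) := by
  rw [ae_all_iff]
  intro n
  exact (hT.iterate n).quasiMeasurePreserving.ae hQ

lemma sub_sum {f : ℕ → Ω → ℝ} (hf0 : ∀ ω, f 0 ω = 0) {k : ℕ} {ω : Ω}
    (hsub : ∀ l n m, f (n+m) (T^[l] ω) ≤ f n (T^[l] ω) + f m (T^[n] (T^[l] ω)))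
    (l M : ℕ) : f (k*M) (T^[l] ω) ≤ ∑ i ∈ Finset.range M, f k (T^[k*i] (T^[l] ω)) := by
  induction M with
  | zero => simp [hf0]
  | succ M ih =>
    rw [Finset.sum_range_succ, Nat.mul_succ]
    linarith [hsub l (k*M) k]

lemma kingman_claim {f : ℕ → Ω → ℝ} (h0 : ∀ n ω, 0 ≤ f n ω) (hf0 : ∀ ω, f 0 ω = 0)
    {c : ℝ} (hc : 0 ≤ c) (L : ℕ) (hL : 1 ≤ L) {ω : Ω}
    (hsub : ∀ l n m, f (n+m) (T^[l] ω) ≤ f n (T^[l] ω) + f m (T^[n] (T^[l] ω)))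
    (D : Set Ω) (hD : ∀ ω, ω ∈ D ↔ ∃ n, 1 ≤ n ∧ n ≤ L ∧ f n ω < c * n) (M : ℕ) :
    ∀ l : ℕ, f M (T^[l] ω) ≤ c * M + ∑ i ∈ Finset.range M, ((Dᶜ.indicator (f 1)) (T^[i] (T^[l] ω))
      + if M ≤ i + L then f 1 (T^[i] (T^[l] ω)) else 0) := by
  have hφ0 : ∀ ω, 0 ≤ Dᶜ.indicator (f 1) ω := fun ω =>
    Set.indicator_nonneg (fun x _ => h0 1 x) ω
  induction M using Nat.strong_induction_on with
  | _ M ih =>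
  intro l
  by_cases hML : M ≤ L
  · have h1 := sub_sum (k := 1) hf0 hsub l M
    simp only [one_mul] at h1
    have h2 : ∑ i ∈ Finset.range M, f 1 (T^[i] (T^[l] ω)) ≤ ∑ i ∈ Finset.range M,
      ((Dᶜ.indicator (f 1)) (T^[i] (T^[l] ω))
      + if M ≤ i + L then f 1 (T^[i] (T^[l] ω)) else 0) := by
      apply Finset.sum_le_sum
      intro i _
      rw [if_pos (by omega)]
      linarith [hφ0 (T^[i] (T^[l] ω))]
    have h3 : 0 ≤ c * M := by positivity
    linarith
  · push Not at hML
    have step : ∀ n, 1 ≤ n → n ≤ L → f n (T^[l] ω) ≤ c * n +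
        ∑ i ∈ Finset.range n, (Dᶜ.indicator (f 1)) (T^[i] (T^[l] ω)) →
        f M (T^[l] ω) ≤ c * M + ∑ i ∈ Finset.range M,
          ((Dᶜ.indicator (f 1)) (T^[i] (T^[l] ω))
          + if M ≤ i + L then f 1 (T^[i] (T^[l] ω)) else 0) := by
      intro n hn hnL hfn
      obtain ⟨m, rfl⟩ : ∃ m, M = n + m := ⟨M - n, by omega⟩
      have h1 := hsub l n m
      have h2 := ih m (by omega) (n + l)
      rw [Function.iterate_add_apply] at h2
      rw [Finset.sum_range_add]
      have h3 : ∑ i ∈ Finset.range m, ((Dᶜ.indicator (f 1)) (T^[i] (T^[n] (T^[l] ω)))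
          + if m ≤ i + L then f 1 (T^[i] (T^[n] (T^[l] ω))) else 0) =
          ∑ i ∈ Finset.range m, ((Dᶜ.indicator (f 1)) (T^[n+i] (T^[l] ω))
          + if n + m ≤ n + i + L then f 1 (T^[n+i] (T^[l] ω)) else 0) := by
        apply Finset.sum_congr rfl
        intro i _
        rw [← Function.iterate_add_apply, add_comm i n]
        congr 1
        simp only [add_assoc, add_le_add_iff_left]
      have h4 : ∑ i ∈ Finset.range n, (Dᶜ.indicator (f 1)) (T^[i] (T^[l] ω)) ≤
          ∑ i ∈ Finset.range n, ((Dᶜ.indicator (f 1)) (T^[i] (T^[l] ω))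
          + if n + m ≤ i + L then f 1 (T^[i] (T^[l] ω)) else 0) := by
        apply Finset.sum_le_sum
        intro i _
        have : 0 ≤ if n + m ≤ i + L then f 1 (T^[i] (T^[l] ω)) else 0 := by
          split_ifs
          · exact h0 _ _
          · exact le_rfl
        linarith
      push_cast
      linarith
    by_cases hω : T^[l] ω ∈ D
    · obtain ⟨n, hn1, hn2, hn3⟩ := (hD _).1 hω
      refine step n hn1 hn2 ?_
      have : 0 ≤ ∑ i ∈ Finset.range n, (Dᶜ.indicator (f 1)) (T^[i] (T^[l] ω)) :=
        Finset.sum_nonneg fun i _ => hφ0 _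
      linarith
    · refine step 1 le_rfl hL ?_
      have : Dᶜ.indicator (f 1) (T^[l] ω) = f 1 (T^[l] ω) := Set.indicator_of_mem hω _
      simp [this]
      exact hc

lemma kingman_aux (hT : MeasurePreserving T P P) {f : ℕ → Ω → ℝ} (hm : ∀ n, Measurable (f n))
    (h0 : ∀ n ω, 0 ≤ f n ω) (hf0 : ∀ ω, f 0 ω = 0) (hInt : ∀ n, Integrable (f n) P)
    (hsub : ∀ᵐ ω ∂P, ∀ n m, f (n+m) ω ≤ f n ω + f m (T^[n] ω)) {h c : ℝ}
    (hlim : Tendsto (fun n : ℕ => (∫ ω, f n ω ∂P) / n) atTop (𝓝 h)) (hc : 0 ≤ c) (hch : c < h)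
    (hfr : ∀ᵐ ω ∂P, ∃ n : ℕ, 1 ≤ n ∧ f n ω < c * n) : False := by
  set D : ℕ → Set Ω := fun L => {ω | ∃ n, 1 ≤ n ∧ n ≤ L ∧ f n ω < c * n} with hD
  have hDm : ∀ L, MeasurableSet (D L) := by
    intro L
    have : D L = ⋃ n, ⋃ (_ : 1 ≤ n), ⋃ (_ : n ≤ L), {ω | f n ω < c * n} := by
      ext ω
      simp only [hD, Set.mem_ofPred_eq, Set.mem_iUnion, exists_prop]
    rw [this]
    refine MeasurableSet.iUnion fun n => MeasurableSet.iUnion fun _ => MeasurableSet.iUnion fun _ => ?_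
    exact measurableSet_lt (hm n) measurable_const
  have hlimφ : Tendsto (fun L => ∫ ω, (D L)ᶜ.indicator (f 1) ω ∂P) atTop (𝓝 (∫ _, (0:ℝ) ∂P)) := by
    apply tendsto_integral_of_dominated_convergence (f 1)
    · intro L
      exact ((hm 1).indicator (hDm L).compl).aestronglyMeasurable
    · exact hInt 1
    · intro L
      refine Eventually.of_forall fun ω => ?_
      rw [Real.norm_of_nonneg (Set.indicator_nonneg (fun x _ => h0 1 x) ω)]
      exact Set.indicator_le_self' (fun x _ => h0 1 x) ω
    · filter_upwards [hfr] with ω hω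
      obtain ⟨n, hn1, hn2⟩ := hω
      apply tendsto_const_nhds.congr'
      filter_upwards [eventually_ge_atTop n] with L hL
      rw [Set.indicator_of_notMem]
      simp only [Set.mem_compl_iff, not_not]
      exact ⟨n, hn1, hL, hn2⟩
  simp only [integral_zero] at hlimφ
  obtain ⟨L, hLs, hL1⟩ := ((hlimφ.eventually (gt_mem_nhds (show 0 < h - c by linarith))).and
    (eventually_ge_atTop 1)).exists
  set φ := (D L)ᶜ.indicator (f 1) with hφ
  have hφint : Integrable φ P := (hInt 1).indicator (hDm L).compl
  have horb := ae_orbit hT hsub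
  have hbound : ∀ M : ℕ, ∫ ω, f M ω ∂P ≤ c * M + M * ∫ ω, φ ω ∂P + L * ∫ ω, f 1 ω ∂P := by
    intro M
    have hci : ∀ i, Integrable (fun ω => φ (T^[i] ω)) P := fun i =>
      (hT.iterate i).integrable_comp_of_integrable hφint
    have hfi : ∀ i, Integrable (fun ω => f 1 (T^[i] ω)) P := fun i =>
      (hT.iterate i).integrable_comp_of_integrable (hInt 1)
    have hgi : ∀ i, Integrable (fun ω => if M ≤ i + L then f 1 (T^[i] ω) else 0) P := by
      intro i
      split_ifs
      · exact hfi i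
      · exact integrable_zero _ _ _
    have hcomp : ∀ (g : Ω → ℝ), Integrable g P → ∀ i, ∫ ω, g (T^[i] ω) ∂P = ∫ ω, g ω ∂P := by
      intro g hg i
      have hmap := (hT.iterate i).map_eq
      conv_rhs => rw [← hmap]
      rw [integral_map (hT.iterate i).measurable.aemeasurable (by rw [hmap]; exact hg.1)]
    have hsi : ∀ i, Integrable (fun ω => φ (T^[i] ω)
        + if M ≤ i + L then f 1 (T^[i] ω) else 0) P := fun i => (hci i).add (hgi i)
    have h1 : ∫ ω, f M ω ∂P ≤ ∫ ω, (c * M + ∑ i ∈ Finset.range M, (φ (T^[i] ω)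
      + if M ≤ i + L then f 1 (T^[i] ω) else 0)) ∂P := by
      apply integral_mono_ae (hInt M)
      · exact (integrable_const _).add (integrable_finsetSum _ fun i _ => hsi i)
      · filter_upwards [horb] with ω hω
        have := kingman_claim h0 hf0 hc L hL1 (ω := ω) hω (D L) (fun _ => Iff.rfl) M 0
        exact this
    rw [integral_add (integrable_const _) (integrable_finsetSum _ fun i _ => hsi i),
      integral_finsetSum _ (fun i _ => hsi i)] at h1
    have h2 : ∀ i ∈ Finset.range M, ∫ ω, (φ (T^[i] ω)
      + if M ≤ i + L then f 1 (T^[i] ω) else 0) ∂P =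
        (∫ ω, φ ω ∂P) + if M ≤ i + L then ∫ ω, f 1 ω ∂P else 0 := by
      intro i _
      rw [integral_add (hci i) (hgi i), hcomp φ hφint]
      congr 1
      split_ifs
      · exact hcomp _ (hInt 1) i
      · simp
    rw [Finset.sum_congr rfl h2, Finset.sum_add_distrib, ← Finset.sum_filter] at h1
    simp only [integral_const, Finset.sum_const, Finset.card_range, nsmul_eq_mul] at h1
    have hcard : ((Finset.range M).filter (fun i => M ≤ i + L)).card ≤ L := by
      have : (Finset.range M).filter (fun i => M ≤ i + L) ⊆ Finset.Ico (M - L) M := by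
        intro i hi
        simp only [Finset.mem_filter, Finset.mem_range, Finset.mem_Ico] at hi ⊢
        omega
      refine (Finset.card_le_card this).trans ?_
      rw [Nat.card_Ico]
      omega
    have hf1 : 0 ≤ ∫ ω, f 1 ω ∂P := integral_nonneg (h0 1)
    have : (((Finset.range M).filter (fun i => M ≤ i + L)).card : ℝ) * ∫ ω, f 1 ω ∂P ≤
      L * ∫ ω, f 1 ω ∂P := mul_le_mul_of_nonneg_right (by exact_mod_cast hcard) hf1
    simp at h1
    linarith
  have hle : h ≤ c + ∫ ω, φ ω ∂P := by
    have hl2 : Tendsto (fun M : ℕ => c + ∫ ω, φ ω ∂P + (L * ∫ ω, f 1 ω ∂P) / M) atTop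
        (𝓝 (c + ∫ ω, φ ω ∂P + 0)) :=
      tendsto_const_nhds.add (tendsto_const_nhds.div_atTop tendsto_natCast_atTop_atTop)
    rw [add_zero] at hl2
    refine le_of_tendsto_of_tendsto hlim hl2 ?_
    filter_upwards [eventually_gt_atTop 0] with M hM
    have hM' : (0:ℝ) < M := by exact_mod_cast hM
    rw [div_le_iff₀ hM']
    have := hbound M
    have e : (c + ∫ ω, φ ω ∂P + (L * ∫ ω, f 1 ω ∂P) / M) * M =
      c * M + M * ∫ ω, φ ω ∂P + L * ∫ ω, f 1 ω ∂P := by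
      field_simp
    linarith
  linarith

lemma kingman_lower (hT : MeasurePreserving T P P)
    (h01 : ∀ A, MeasurableSet A → T ⁻¹' A ⊆ A → P A = 0 ∨ P A = 1)
    {f : ℕ → Ω → ℝ} (hm : ∀ n, Measurable (f n))
    (h0 : ∀ n ω, 0 ≤ f n ω) (hf0 : ∀ ω, f 0 ω = 0) (hInt : ∀ n, Integrable (f n) P)
    (hsub : ∀ᵐ ω ∂P, ∀ n m, f (n+m) ω ≤ f n ω + f m (T^[n] ω)) {h ε : ℝ}
    (hlim : Tendsto (fun n : ℕ => (∫ ω, f n ω ∂P) / n) atTop (𝓝 h)) (hε : 0 < ε) :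
    ∀ᵐ ω ∂P, ∀ᶠ n : ℕ in atTop, (h - ε) * n ≤ f n ω := by
  by_cases hc0 : h - ε < 0
  · refine Eventually.of_forall fun ω => Eventually.of_forall fun n => ?_
    exact le_trans (mul_nonpos_of_nonpos_of_nonneg hc0.le (Nat.cast_nonneg n)) (h0 n ω)
  push Not at hc0
  set c := h - ε / 2 with hc
  set A : Set Ω := {ω | ∃ j : ℕ, ∃ᶠ n : ℕ in atTop, f n ω < (c - 1/(j+1)) * n} with hA
  set S : Set Ω := {ω | ∀ k n m, f (n+m) (T^[k] ω) ≤ f n (T^[k] ω) + f m (T^[n] (T^[k] ω))} with hS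
  have hTm : ∀ k, Measurable T^[k] := fun k => (hT.iterate k).measurable
  have hAm : MeasurableSet A := by
    have : A = ⋃ j : ℕ, limsup (fun n : ℕ => {ω | f n ω < (c - 1/((j:ℝ)+1)) * n}) atTop := by
      ext ω
      simp only [hA, Set.mem_ofPred_eq, Set.mem_iUnion, mem_limsup_iff_frequently_mem]
    rw [this]
    refine MeasurableSet.iUnion fun j => MeasurableSet.measurableSet_limsup fun n => ?_
    exact measurableSet_lt (hm n) measurable_const
  have hSm : MeasurableSet S := by
    have : S = ⋂ k, ⋂ n, ⋂ m, {ω | f (n+m) (T^[k] ω) ≤ f n (T^[k] ω) + f m (T^[n] (T^[k] ω))} := by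
      ext ω
      simp [hS]
    rw [this]
    refine MeasurableSet.iInter fun k => MeasurableSet.iInter fun n => MeasurableSet.iInter fun m => ?_
    exact measurableSet_le ((hm _).comp (hTm k))
      (((hm _).comp (hTm k)).add ((hm _).comp ((hTm n).comp (hTm k))))
  have hSae : ∀ᵐ ω ∂P, ω ∈ S := ae_orbit hT hsub
  have hinv : T ⁻¹' (A ∪ Sᶜ) ⊆ A ∪ Sᶜ := by
    intro ω hω
    by_cases hωS : ω ∈ S
    · left
      rcases hω with hω | hω
      · obtain ⟨j, hj⟩ := hω
        refine ⟨j + 1, ?_⟩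
        obtain ⟨N, hN⟩ := exists_nat_gt ((f 1 ω - (c - 1/((j:ℝ)+1+1))) * ((j+1)*(j+2)))
        have hfreq := hj.and_eventually (eventually_ge_atTop N)
        have : ∃ᶠ n : ℕ in atTop, f (n+1) ω < (c - 1/(((j+1 : ℕ):ℝ)+1)) * ((n+1 : ℕ) : ℝ) := by
          refine hfreq.mono ?_
          rintro n ⟨h1, h2⟩
          have h3 := hωS 0 1 n
          simp only [Function.iterate_zero, id, Function.iterate_one] at h3
          rw [add_comm 1 n] at h3
          push_cast
          have hn : (N : ℝ) ≤ n := by exact_mod_cast h2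
          have hpos : (0:ℝ) < (j+1)*(j+2) := by positivity
          have e : 1/((j:ℝ)+1) = 1/((j:ℝ)+1+1) + 1/(((j:ℝ)+1)*(j+2)) := by
            field_simp
            ring
          have h4 : f 1 ω - (c - 1/((j:ℝ)+1+1)) < n / (((j:ℝ)+1)*(j+2)) := by
            rw [lt_div_iff₀ hpos]
            linarith
          rw [e] at h1
          have h5 : (n:ℝ) / (((j:ℝ)+1)*(j+2)) = 1/(((j:ℝ)+1)*(j+2)) * n := by ring
          nlinarith
        rw [Filter.frequently_atTop] at this ⊢
        intro a
        obtain ⟨b, hb, hb2⟩ := this a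
        exact ⟨b + 1, by omega, hb2⟩
      · exfalso
        apply hω
        intro k n m
        have := hωS (k+1) n m
        rwa [Function.iterate_succ_apply] at this
    · right
      exact hωS
  rcases h01 _ (hAm.union hSm.compl) hinv with h1 | h1
  · have h2 : ∀ᵐ ω ∂P, ω ∉ A ∪ Sᶜ := measure_eq_zero_iff_ae_notMem.1 h1
    obtain ⟨j, hj⟩ := exists_nat_one_div_lt (half_pos hε)
    filter_upwards [h2] with ω hω
    have h3 : ω ∉ A := fun h => hω (Or.inl h)
    simp only [hA, Set.mem_ofPred_eq, not_exists, Filter.not_frequently, not_lt] at h3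
    filter_upwards [h3 j] with n hn
    refine le_trans ?_ hn
    apply mul_le_mul_of_nonneg_right _ (Nat.cast_nonneg n)
    rw [hc]
    linarith
  · exfalso
    have h2 : ∀ᵐ ω ∂P, ω ∈ A ∪ Sᶜ := by
      rw [← prob_compl_eq_zero_iff (hAm.union hSm.compl)] at h1
      exact h1
    refine kingman_aux hT hm h0 hf0 hInt hsub hlim (c := c) (by rw [hc]; linarith)
      (by rw [hc]; linarith) ?_
    filter_upwards [h2, hSae] with ω hω hωS
    rcases hω with ⟨j, hj⟩ | hω
    · obtain ⟨n, hn, hn1⟩ := (hj.and_eventually (eventually_ge_atTop 1)).exists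
      refine ⟨n, hn1, hn.trans_le ?_⟩
      apply mul_le_mul_of_nonneg_right _ (Nat.cast_nonneg n)
      have : (0:ℝ) < 1/((j:ℝ)+1) := by positivity
      linarith
    · exact absurd hωS hω

end kingman

open ProbabilityTheory

/-- if `u n / n → e` then uniformly `|u n - n e| ≤ η j` for `n ≤ j`, `j` large. -/
lemma unif_of_tendsto {u : ℕ → ℝ} {e η : ℝ} (hη : 0 < η)
    (h : Tendsto (fun n : ℕ => u n / n) atTop (𝓝 e)) (h0 : u 0 = 0) :
    ∀ᶠ j : ℕ in atTop, ∀ n ≤ j, |u n - n * e| ≤ η * j := by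
  obtain ⟨N, hN⟩ := Metric.tendsto_atTop.1 h η hη
  have h2 : ∀ᶠ j : ℕ in atTop, ∀ n ∈ Finset.range (N+1), |u n - n * e| ≤ η * j := by
    rw [Filter.eventually_all_finset]
    intro n _
    have : Tendsto (fun j : ℕ => η * (j:ℝ)) atTop atTop :=
      tendsto_natCast_atTop_atTop.const_mul_atTop hη
    exact this.eventually_ge_atTop _
  filter_upwards [h2] with j hj n hn
  by_cases hnN : n ≤ N
  · exact hj n (Finset.mem_range.2 (by omega))
  · push Not at hnN
    have h3 := hN n hnN.le
    rw [Real.dist_eq] at h3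
    have hn0 : (0:ℝ) < n := by exact_mod_cast (by omega : 0 < n)
    have e1 : u n - n * e = n * (u n / n - e) := by field_simp
    rw [e1, abs_mul, abs_of_pos hn0]
    have : (n:ℝ) ≤ j := by exact_mod_cast hn
    nlinarith [abs_nonneg (u n / n - e)]

section sub
variable {G : Type*} [Group G] [Countable G] [MeasurableSpace G] [DiscreteMeasurableSpace G]
  {p : G → ℝ≥0∞} {P : Measure (ℕ → G)}

/-- a subadditive cocycle along the walk -/
structure SubC (P : Measure (ℕ → G)) (φ : ℕ → G → ℝ) (h : ℝ) : Prop where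
  nonneg : ∀ n g, 0 ≤ φ n g
  zero : φ 0 1 = 0
  int : ∀ n, Integrable (fun ω => φ n (walk ω n)) P
  sub : ∀ᵐ ω ∂P, ∀ n m, φ (n+m) (walk ω (n+m)) ≤ φ n (walk ω n) + φ m (walk (sh^[n] ω) m)
  lim : Tendsto (fun n : ℕ => (∫ ω, φ n (walk ω n) ∂P) / n) atTop (𝓝 h)

lemma SubC.h_nonneg {φ : ℕ → G → ℝ} {h : ℝ} (S : SubC P φ h) : 0 ≤ h :=
  ge_of_tendsto S.lim (Eventually.of_forall fun n =>
    div_nonneg (integral_nonneg fun ω => S.nonneg _ _) (Nat.cast_nonneg n))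

lemma SubC.upper (hp : IsProb p) (hP : IsRWMeasure p P) {φ : ℕ → G → ℝ} {h : ℝ}
    (S : SubC P φ h) {ε : ℝ} (hε : 0 < ε) : ∃ k0 : ℕ, ∀ k, k0 ≤ k → 1 ≤ k →
      ∀ᵐ ω ∂P, ∀ᶠ j : ℕ in atTop, ∀ i1 n, i1 + n ≤ j →
        φ (k*n) (walk (sh^[k*i1] ω) (k*n)) ≤ h * (k * n) + ε * (k * j) := by
  have hpr := hP.1
  obtain ⟨k0, hk0⟩ := Metric.tendsto_atTop.1 S.lim (ε/2) (half_pos hε)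
  refine ⟨k0, fun k hk hk1 => ?_⟩
  have hk1' : (1:ℝ) ≤ k := by exact_mod_cast hk1
  set F : (ℕ → G) → ℝ := fun ω => φ k (walk ω k) with hF
  set X : ℕ → (ℕ → G) → ℝ := fun i ω => F (sh^[k*i] ω) with hX
  have hFm : Measurable F :=
    (Measurable.of_discrete (f := φ k)).comp (measurable_walk k)
  have hF0 : (fun ω => F (sh^[k*0] ω)) = F := by
    funext ω
    simp
  have hslln := strong_law_ae_real X (μ := P) (by
      simp only [hX]
      rw [hF0]
      exact S.int k) (by
      intro a b hab
      change IndepFun (X a) (X b) P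
      refine block_indep (rw_indep hp hP) (Finset.Ico (k*a) (k*a+k)) (Finset.Ico (k*b) (k*b+k)) ?_
        _ _ ?_ ?_
      · rw [Finset.disjoint_left]
        intro i hi hi2
        rw [Finset.mem_Ico] at hi hi2
        rcases lt_or_gt_of_ne hab with h | h
        · have : k * (a+1) ≤ k * b := Nat.mul_le_mul_left k h
          rw [Nat.mul_succ] at this
          omega
        · have : k * (b+1) ≤ k * a := Nat.mul_le_mul_left k h
          rw [Nat.mul_succ] at this
          omega
      all_goals
        intro ω ω' h
        simp only [hX, hF]
        rw [walk_sh_congr fun i h1 h2 => h i (Finset.mem_Ico.2 ⟨h1, h2⟩)]) (by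
      intro i
      have hid : IdentDistrib (X i) F P P := by
        refine ⟨(hFm.comp (mp_iter hp hP _).measurable).aemeasurable, hFm.aemeasurable, ?_⟩
        have := (mp_iter hp hP (k*i)).map_eq
        conv_rhs => rw [← this]
        rw [Measure.map_map hFm (mp_iter hp hP _).measurable]
        rfl
      have h0 : X 0 = F := hF0
      rw [h0]
      exact hid)
  have hX0 : P[X 0] = ∫ ω, F ω ∂P := by
    have h0 : X 0 = F := hF0
    rw [h0]
  rw [hX0] at hslln
  set e := ∫ ω, F ω ∂P with he
  have hek : e ≤ k * (h + ε/2) := by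
    have := hk0 k hk
    rw [Real.dist_eq] at this
    have h2 := (abs_lt.1 this).2
    have : e / k ≤ h + ε/2 := by linarith
    rw [div_le_iff₀ (by linarith)] at this
    linarith
  have hf0 : ∀ ω : ℕ → G, φ 0 (walk ω 0) = 0 := fun ω => by rw [walk_zero]; exact S.zero
  have horb := ae_orbit (rw_sh hp hP) S.sub
  filter_upwards [hslln, horb] with ω h1 h2
  have hη : 0 < ε / 4 := by linarith
  filter_upwards [unif_of_tendsto hη h1 (by simp)] with j hj i1 n hin
  have h3 := sub_sum (f := fun n ω => φ n (walk ω n)) (k := k) hf0 h2 (k*i1) n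
  have h4 := Finset.sum_range_add (fun i => X i ω) i1 n
  have h5 : ∑ i ∈ Finset.range n, φ k (walk (sh^[k*i] (sh^[k*i1] ω)) k) =
      ∑ i ∈ Finset.range n, X (i1 + i) ω := by
    apply Finset.sum_congr rfl
    intro i _
    simp only [hX, hF]
    rw [← Function.iterate_add_apply, Nat.mul_add, add_comm]
  have h6 := (abs_le.1 (hj (i1+n) hin)).2
  have h7 := (abs_le.1 (hj i1 (by omega))).1
  beta_reduce at h3
  rw [h5] at h3
  have hj0 : (0:ℝ) ≤ j := Nat.cast_nonneg j
  have hn0 : (0:ℝ) ≤ n := Nat.cast_nonneg n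
  have hnj : (n:ℝ) ≤ j := by exact_mod_cast (by omega : n ≤ j)
  have h8 : n * e ≤ n * (k * (h + ε/2)) := mul_le_mul_of_nonneg_left hek hn0
  push_cast at h6
  have h9 : ε / 4 * j ≤ ε/4 * (k * j) := by
    apply mul_le_mul_of_nonneg_left _ hη.le
    nlinarith
  have h10 : n * (k * (ε/2)) ≤ j * (k * (ε / 2)) := by
    apply mul_le_mul_of_nonneg_right hnj
    positivity
  nlinarith

lemma SubC.main (hp : IsProb p) (hP : IsRWMeasure p P) {φ : ℕ → G → ℝ} {h : ℝ}
    (S : SubC P φ h) {ε : ℝ} (hε : 0 < ε) : ∃ k0 : ℕ, ∀ k, k0 ≤ k → 1 ≤ k →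
      ∀ᵐ ω ∂P, ∀ᶠ j : ℕ in atTop, ∀ i1 n, i1 + n ≤ j →
        |φ (k*n) (walk (sh^[k*i1] ω) (k*n)) - h * (k * n)| ≤ ε * (k * j) := by
  have hpr := hP.1
  obtain ⟨k0, hk0⟩ := S.upper hp hP (half_pos hε)
  refine ⟨k0, fun k hk hk1 => ?_⟩
  have hkr : (0:ℝ) < k := by exact_mod_cast hk1
  have hlow := kingman_lower (rw_sh hp hP) (fun A => rw_zero_one hp hP A)
    (f := fun n ω => φ n (walk ω n))
    (fun n => (Measurable.of_discrete (f := φ n)).comp (measurable_walk n))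
    (fun n ω => S.nonneg _ _) (fun ω => by rw [walk_zero]; exact S.zero) S.int S.sub S.lim
    (half_pos hε)
  filter_upwards [hk0 k hk hk1, hlow, S.sub] with ω h1 h2 h3
  obtain ⟨J, hJ⟩ := Filter.eventually_atTop.1 h2
  have hbig : ∀ᶠ j : ℕ in atTop, h * J ≤ ε/2 * j :=
    (tendsto_natCast_atTop_atTop.const_mul_atTop (half_pos hε)).eventually_ge_atTop _
  have hh := S.h_nonneg
  filter_upwards [h1, hbig] with j hj hjb i1 n hin
  have hkj : 0 ≤ ε / 2 * (k * j) := by positivity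
  rw [abs_le]
  refine ⟨?_, by linarith [hj i1 n hin]⟩
  have h4 := h3 (k*i1) (k*n)
  have h5 := hj 0 i1 (by omega)
  simp only [mul_zero, Function.iterate_zero, id] at h5
  have h6 : h * (k * (i1 + n)) - ε/2 * (k*j) ≤ φ (k*i1 + k*n) (walk ω (k*i1+k*n)) := by
    by_cases hc : J ≤ k*i1 + k*n
    · have := hJ _ hc
      push_cast at this
      have h7 : (i1:ℝ) + n ≤ j := by exact_mod_cast hin
      have h8 : ε/2 * (k * (i1 + n)) ≤ ε/2 * (k * j) := by gcongr
      linarith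
    · push Not at hc
      have h7 : (k:ℝ)*i1 + k*n ≤ J := by exact_mod_cast hc.le
      have h8 : h * (k * (i1 + n)) ≤ h * J := by
        apply mul_le_mul_of_nonneg_left _ hh
        linarith
      have h9 : ε/2 * j ≤ ε/2 * (k*j) := by
        apply mul_le_mul_of_nonneg_left _ (by linarith)
        have : (1:ℝ) ≤ k := by exact_mod_cast hk1
        nlinarith [Nat.cast_nonneg (α := ℝ) j]
      linarith [S.nonneg (k*i1 + k*n) (walk ω (k*i1+k*n))]
  linarith
end sub

/-- exponential growth of a displacement function -/
def Grow {H : Type*} (d : H → ℝ) : Prop :=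
  ∃ A B : ℝ, 0 < A ∧ 0 < B ∧ ∀ s, 0 ≤ s →
    {x | d x ≤ s}.Finite ∧ ({x | d x ≤ s}.ncard : ℝ) ≤ A * Real.exp (B * s)

lemma Grow.summable {H : Type*} {d : H → ℝ} (hd : ∀ x, 0 ≤ d x) {A B : ℝ} (hA : 0 < A)
    (hB : ∀ s, 0 ≤ s →
    {x | d x ≤ s}.Finite ∧ ({x | d x ≤ s}.ncard : ℝ) ≤ A * Real.exp (B * s)) :
    Summable fun x => Real.exp (-((B+1) * d x)) := by
  have hgeo : Summable fun n : ℕ => Real.exp (-(n:ℝ)) := Real.summable_exp_neg_nat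
  by_cases hB1 : 0 ≤ B + 1
  swap
  · have h1 := (hB 0 le_rfl)
    have hfin : Finite H := by
      by_contra hinf
      rw [not_finite_iff_infinite] at hinf
      have hAs : ∀ s, 0 ≤ s → ({x | d x ≤ s}.ncard : ℝ) ≤ A := by
        intro s hs
        refine (hB s hs).2.trans ?_
        have : Real.exp (B * s) ≤ 1 := Real.exp_le_one_iff.2 (by nlinarith)
        nlinarith
      obtain ⟨n, hn⟩ := exists_nat_gt A
      obtain ⟨F, hF⟩ := Infinite.exists_subset_card_eq H n
      have hsub : (F : Set H) ⊆ {x | d x ≤ ∑ y ∈ F, d y} := fun x hx =>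
        Finset.single_le_sum (f := d) (fun y _ => hd y) hx
      have hs0 : 0 ≤ ∑ y ∈ F, d y := Finset.sum_nonneg fun y _ => hd y
      have := Set.ncard_le_ncard hsub (hB _ hs0).1
      rw [Set.ncard_coe_finset, hF] at this
      have h3 := hAs _ hs0
      have h4 : (n:ℝ) ≤ ({x | d x ≤ ∑ y ∈ F, d y}.ncard : ℝ) := by exact_mod_cast this
      linarith
    exact summable_of_finite_support (Set.toFinite _)
  refine summable_of_sum_le (c := ∑' n : ℕ, A * Real.exp |B| * Real.exp (-(n:ℝ)))
    (fun x => (Real.exp_pos _).le) ?_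
  intro F
  have hmaps : ∀ x ∈ F, ⌊d x⌋₊ ∈ F.image (fun x => ⌊d x⌋₊) := fun x hx =>
    Finset.mem_image_of_mem _ hx
  rw [← Finset.sum_fiberwise_of_maps_to hmaps]
  refine le_trans (Finset.sum_le_sum (g := fun n : ℕ => A * Real.exp |B| * Real.exp (-(n:ℝ))) ?_)
    ((hgeo.mul_left _).sum_le_tsum _ (fun n _ => by positivity))
  intro n _
  have h1 : ∀ x ∈ F.filter (fun x => ⌊d x⌋₊ = n), Real.exp (-((B+1) * d x)) ≤
      Real.exp (-((B+1) * n)) := by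
    intro x hx
    rw [Finset.mem_filter] at hx
    apply Real.exp_le_exp.2
    have : (n:ℝ) ≤ d x := by
      rw [← hx.2]
      exact Nat.floor_le (hd x)
    nlinarith
  refine (Finset.sum_le_sum h1).trans ?_
  rw [Finset.sum_const, nsmul_eq_mul]
  obtain ⟨hfin, hcard⟩ := hB ((n:ℝ)+1) (by positivity)
  have h2 : ((F.filter (fun x => ⌊d x⌋₊ = n)).card : ℝ) ≤ A * Real.exp (B * (n+1)) := by
    refine le_trans ?_ hcard
    rw [← Set.ncard_coe_finset]
    have : ((F.filter (fun x => ⌊d x⌋₊ = n) : Finset H) : Set H) ⊆ {x | d x ≤ (n:ℝ)+1} := by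
      intro x hx
      rw [Finset.mem_coe, Finset.mem_filter] at hx
      have := Nat.lt_floor_add_one (d x)
      rw [hx.2] at this
      exact this.le
    exact_mod_cast Set.ncard_le_ncard this hfin
  calc ((F.filter (fun x => ⌊d x⌋₊ = n)).card : ℝ) * Real.exp (-((B+1) * n))
      ≤ A * Real.exp (B * (n+1)) * Real.exp (-((B+1) * n)) := by gcongr
    _ = A * Real.exp B * Real.exp (-(n:ℝ)) := by
      rw [mul_assoc, mul_assoc, ← Real.exp_add, ← Real.exp_add]
      congr 2
      ring
    _ ≤ A * Real.exp |B| * Real.exp (-(n:ℝ)) := by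
      gcongr
      exact le_abs_self B

lemma neglog_bound {t a : ℝ} (ht : 0 ≤ t) (ht1 : t ≤ 1) (ha : 0 ≤ a) :
    -Real.log t * t ≤ a * t + 2 * Real.exp (-(a/2)) := by
  rcases ht.eq_or_lt with h0 | h0
  · rw [← h0]
    simp
    positivity
  by_cases h : Real.exp (-a) ≤ t
  · have : -a ≤ Real.log t := by
      rw [← Real.log_exp (-a)]
      exact Real.log_le_log (Real.exp_pos _) h
    have h2 : 0 < Real.exp (-(a/2)) := Real.exp_pos _
    nlinarith
  · push Not at h
    have hs : 0 < Real.sqrt t := Real.sqrt_pos.2 h0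
    have h1 : Real.log (1 / Real.sqrt t) ≤ 1 / Real.sqrt t := by
      have := Real.log_le_sub_one_of_pos (show 0 < 1 / Real.sqrt t by positivity)
      linarith
    have h2 : Real.log (1 / Real.sqrt t) = - Real.log t / 2 := by
      rw [Real.log_div one_ne_zero hs.ne', Real.log_one, Real.log_sqrt h0.le]
      ring
    have h3 : -Real.log t ≤ 2 / Real.sqrt t := by
      rw [h2] at h1
      have : 2 / Real.sqrt t = 2 * (1 / Real.sqrt t) := by ring
      linarith
    have h4 : 2 / Real.sqrt t * t = 2 * Real.sqrt t := by
      have := Real.mul_self_sqrt h0.le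
      field_simp
      nlinarith
    have h5 : Real.sqrt t ≤ Real.exp (-(a/2)) := by
      rw [Real.sqrt_le_left (Real.exp_pos _).le, ← Real.exp_nat_mul]
      refine h.le.trans (le_of_eq ?_)
      congr 1
      push_cast
      ring
    have h6 := mul_le_mul_of_nonneg_right h3 h0.le
    nlinarith [mul_nonneg ha ht]

section inst
variable {G : Type*} [Group G] [Countable G] [MeasurableSpace G] [DiscreteMeasurableSpace G]
  {p : G → ℝ≥0∞} {P : Measure (ℕ → G)}
  {H : Type*} [Group H] [Countable H] [MeasurableSpace H] [DiscreteMeasurableSpace H]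

lemma integral_walk (hp : IsProb p) (hP : IsRWMeasure p P) (φ : G →* H) (μ : H → ℝ≥0∞)
    (hμ : ∀ h, μ h = ∑' g, (φ ⁻¹' {h}).indicator p g) (n : ℕ) (ψ : H → ℝ)
    (hInt : Integrable (fun ω => ψ (φ (walk ω n))) P) :
    ∫ ω, ψ (φ (walk ω n)) ∂P = ∑' h, (piN μ n h).toReal * ψ h := by
  have hm : Measurable (fun ω : ℕ → G => φ (walk ω n)) :=
    (Measurable.of_discrete (f := φ)).comp (measurable_walk n)
  have hi2 : Integrable ψ (P.map (fun ω : ℕ → G => φ (walk ω n))) :=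
    (integrable_map_measure (Measurable.of_discrete).aestronglyMeasurable hm.aemeasurable).2 hInt
  have h1 := integral_map (μ := P) hm.aemeasurable (f := ψ)
    (Measurable.of_discrete).aestronglyMeasurable
  rw [← h1, integral_countable' hi2]
  congr 1
  funext h
  rw [smul_eq_mul, Measure.real, Measure.map_apply hm (measurableSet_singleton h)]
  congr 2
  exact law_walk hp hP φ μ hμ n h

lemma SubC.of_dist [MetricSpace H] (hp : IsProb p) (hP : IsRWMeasure p P) (φ : G →* H)
    (μ : H → ℝ≥0∞)
    (hμ : ∀ h, μ h = ∑' g, (φ ⁻¹' {h}).indicator p g) (hinv : LeftInvariantMetric H)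
    (hInt : Integrable (fun ω : ℕ → G => dist (1:H) (φ (ω 0))) P) {l : ℝ}
    (hl : HasDrift μ (fun x => dist (1:H) x) l) :
    SubC P (fun _ g => dist (1:H) (φ g)) l := by
  have hpr := hP.1
  have htri : ∀ a b : H, dist 1 (a * b) ≤ dist 1 a + dist 1 b := by
    intro a b
    have h1 := dist_triangle 1 a (a*b)
    have h2 := hinv a 1 b
    rw [mul_one] at h2
    linarith
  have hm : ∀ n, Measurable (fun ω : ℕ → G => dist (1:H) (φ (walk ω n))) := fun n =>
    (Measurable.of_discrete (f := fun g => dist (1:H) (φ g))).comp (measurable_walk n)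
  have hInt' : ∀ n, Integrable (fun ω : ℕ → G => dist (1:H) (φ (walk ω n))) P := by
    intro n
    induction n with
    | zero => simp [walk_zero]
    | succ n ih =>
      have h2 : Integrable (fun ω : ℕ → G => dist (1:H) (φ (ω n))) P := by
        have := (mp_iter hp hP n).integrable_comp_of_integrable hInt
        refine this.congr (Eventually.of_forall fun ω => ?_)
        simp [sh_iter]
      refine (ih.add h2).mono' (hm _).aestronglyMeasurable (Eventually.of_forall fun ω => ?_)
      rw [Real.norm_of_nonneg dist_nonneg, walk_succ, map_mul]
      exact htri _ _
  refine ⟨fun n g => dist_nonneg, by simp, hInt', ?_, ?_⟩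
  · refine Eventually.of_forall fun ω n m => ?_
    rw [walk_add, map_mul]
    exact htri _ _
  · refine hl.congr fun n => ?_
    rw [integral_walk hp hP φ μ hμ n (fun h => dist 1 h) (hInt' n)]
    rfl

lemma SubC.of_entropy (hp : IsProb p) (hP : IsRWMeasure p P) (φ : G →* H)
    (μ : H → ℝ≥0∞)
    (hμ : ∀ h, μ h = ∑' g, (φ ⁻¹' {h}).indicator p g) {d : H → ℝ} (hd : ∀ x, 0 ≤ d x)
    (hgrow : Grow d) (hInt : Integrable (fun ω : ℕ → G => d (φ (ω 0))) P) {h : ℝ}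
    (hh : HasEntropy μ h) :
    SubC P (fun n g => - Real.log (piN μ n (φ g)).toReal) h ∧
      ∀ᵐ ω ∂P, ∀ k n, 0 < (piN μ n (φ (walk (sh^[k] ω) n))).toReal := by
  have hpr := hP.1
  have hmφ : ∀ n, Measurable (fun ω : ℕ → G => φ (walk ω n)) := fun n =>
    (Measurable.of_discrete (f := φ)).comp (measurable_walk n)
  have hle1 : ∀ n x, piN μ n x ≤ 1 := by
    intro n x
    rw [← law_walk hp hP φ μ hμ n x]
    exact prob_le_one
  have hle1' : ∀ n x, (piN μ n x).toReal ≤ 1 := fun n x =>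
    ENNReal.toReal_le_of_le_ofReal zero_le_one (by simpa using hle1 n x)
  have hnt : ∀ n x, piN μ n x ≠ ∞ := fun n x => ne_top_of_le_ne_top ENNReal.one_ne_top (hle1 n x)
  have hnn : ∀ n (g : G), 0 ≤ - Real.log (piN μ n (φ g)).toReal := fun n g => by
    have := Real.log_nonpos ENNReal.toReal_nonneg (hle1' n (φ g))
    linarith
  have hpos0 : ∀ᵐ ω ∂P, ∀ n, 0 < (piN μ n (φ (walk ω n))).toReal := by
    rw [ae_all_iff]
    intro n
    have : ∀ᵐ ω ∂P, ∀ x, piN μ n x = 0 → φ (walk ω n) ≠ x := by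
      rw [ae_all_iff]
      intro x
      by_cases hx : piN μ n x = 0
      · rw [← law_walk hp hP φ μ hμ n x] at hx
        filter_upwards [measure_eq_zero_iff_ae_notMem.1 hx] with ω hω _
        exact hω
      · exact Eventually.of_forall fun ω h => absurd h hx
    filter_upwards [this] with ω hω
    rw [ENNReal.toReal_pos_iff]
    refine ⟨pos_iff_ne_zero.2 fun h0 => hω _ h0 rfl, (hnt _ _).lt_top⟩
  have hpos : ∀ᵐ ω ∂P, ∀ k n, 0 < (piN μ n (φ (walk (sh^[k] ω) n))).toReal :=
    ae_orbit (rw_sh hp hP) hpos0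
  have hmul : ∀ n m x y, piN μ n x * piN μ m y ≤ piN μ (n+m) (x*y) := by
    intro n m x y
    rw [← law_pair2 hp hP φ μ hμ φ μ hμ n m x y, ← law_walk hp hP φ μ hμ (n+m) (x*y)]
    apply measure_mono
    rintro ω ⟨h1, h2⟩
    simp only [Set.mem_ofPred_eq]
    rw [walk_add, map_mul, h1, h2]
  have hsub : ∀ᵐ ω ∂P, ∀ n m, - Real.log (piN μ (n+m) (φ (walk ω (n+m)))).toReal ≤
      - Real.log (piN μ n (φ (walk ω n))).toReal +
      - Real.log (piN μ m (φ (walk (sh^[n] ω) m))).toReal := by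
    filter_upwards [hpos] with ω hω n m
    have h1 := hω 0 n
    have h2 := hω n m
    simp only [Function.iterate_zero, id] at h1
    have h3 := ENNReal.toReal_mono (hnt _ _)
      (hmul n m (φ (walk ω n)) (φ (walk (sh^[n] ω) m)))
    rw [ENNReal.toReal_mul, ← map_mul, ← walk_add] at h3
    have h4 := Real.log_le_log (mul_pos h1 h2) h3
    rw [Real.log_mul h1.ne' h2.ne'] at h4
    linarith
  have hmf : ∀ n, Measurable (fun ω : ℕ → G => - Real.log (piN μ n (φ (walk ω n))).toReal) :=
    fun n => (Measurable.of_discrete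
      (f := fun g : G => - Real.log (piN μ n (φ g)).toReal)).comp (measurable_walk n)
  have hone : Integrable (fun ω : ℕ → G => - Real.log (piN μ 1 (φ (walk ω 1))).toReal) P := by
    obtain ⟨A, B, hA, hB, hAB⟩ := hgrow
    have hsum := Grow.summable hd hA hAB
    refine ⟨(hmf 1).aestronglyMeasurable, ?_⟩
    rw [hasFiniteIntegral_iff_ofReal (Eventually.of_forall fun ω => hnn 1 _)]
    have hint2 : Integrable (fun ω : ℕ → G => (2*(B+1)) * d (φ (walk ω 1))) P := by
      refine (hInt.const_mul (2*(B+1))).congr (Eventually.of_forall fun ω => ?_)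
      simp [walk_succ, walk_zero]
    have hf2 := hint2.2
    rw [hasFiniteIntegral_iff_ofReal (Eventually.of_forall fun ω =>
      mul_nonneg (by positivity) (hd _))] at hf2
    have hmap : ∀ f : H → ℝ, ∫⁻ ω, ENNReal.ofReal (f (φ (walk ω 1))) ∂P =
        ∑' x, ENNReal.ofReal (f x) * piN μ 1 x := by
      intro f
      have := lintegral_map (μ := P) (f := fun x : H => ENNReal.ofReal (f x))
        (Measurable.of_discrete) (hmφ 1)
      rw [← this, lintegral_countable']
      congr 1
      funext x
      rw [Measure.map_apply (hmφ 1) (measurableSet_singleton x)]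
      congr 1
      exact law_walk hp hP φ μ hμ 1 x
    rw [hmap (fun x => - Real.log (piN μ 1 x).toReal)]
    rw [hmap (fun x => (2*(B+1)) * d x)] at hf2
    have hterm : ∀ x, ENNReal.ofReal (- Real.log (piN μ 1 x).toReal) * piN μ 1 x ≤
        ENNReal.ofReal ((2*(B+1)) * d x) * piN μ 1 x +
        ENNReal.ofReal (2 * Real.exp (-((B+1) * d x))) := by
      intro x
      have ha : 0 ≤ (2*(B+1)) * d x := mul_nonneg (by positivity) (hd _)
      have hb := neglog_bound ENNReal.toReal_nonneg (hle1' 1 x) ha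
      have e1 : piN μ 1 x = ENNReal.ofReal (piN μ 1 x).toReal := (ENNReal.ofReal_toReal (hnt 1 x)).symm
      have e2 : 2 * (B+1) * d x / 2 = (B+1) * d x := by ring
      rw [e2] at hb
      set t := (piN μ 1 x).toReal with ht
      have ht0 : 0 ≤ t := ENNReal.toReal_nonneg
      rw [e1, ← ENNReal.ofReal_mul' ht0, ← ENNReal.ofReal_mul' ht0,
        ← ENNReal.ofReal_add (mul_nonneg ha ht0) (by positivity)]
      exact ENNReal.ofReal_le_ofReal hb
    refine (ENNReal.tsum_le_tsum hterm).trans_lt ?_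
    rw [ENNReal.tsum_add]
    refine ENNReal.add_lt_top.2 ⟨hf2, ?_⟩
    exact ((hsum.mul_left 2).tsum_ofReal_ne_top).lt_top
  have hInt' : ∀ n, Integrable (fun ω : ℕ → G => - Real.log (piN μ n (φ (walk ω n))).toReal) P := by
    intro n
    induction n with
    | zero =>
      simp [walk_zero, piN]
    | succ n ih =>
      have h2 := (mp_iter hp hP n).integrable_comp_of_integrable hone
      refine (ih.add h2).mono' (hmf _).aestronglyMeasurable ?_
      filter_upwards [hsub] with ω hω
      rw [Real.norm_of_nonneg (hnn _ _)]
      exact hω n 1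
  refine ⟨⟨hnn, by simp [piN], hInt', hsub, ?_⟩, hpos⟩
  refine hh.congr fun n => ?_
  rw [integral_walk hp hP φ μ hμ n (fun h => - Real.log (piN μ n h).toReal) (hInt' n)]
  unfold entropySeq
  congr 2
  funext x
  unfold Real.negMulLog
  ring

end inst

/-! ### Positivity of the drift -/

section Drift

variable {Γ : Type*} [Group Γ]

lemma l2_hasSum (v : lp (fun _ : Γ => ℝ) 2) : HasSum (fun x => (v x)^2) (‖v‖^2) := by
  have h := lp.hasSum_norm (p := 2) (by norm_num) v
  simpa using h

/-- Right translation on `ℓ²`. -/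
def Rt (g : Γ) : lp (fun _ : Γ => ℝ) 2 →ₗ[ℝ] lp (fun _ : Γ => ℝ) 2 where
  toFun v := ⟨fun x => v (x * g), by
    have h := (l2_hasSum v).summable
    refine memℓp_gen ?_
    have h2 := (Equiv.summable_iff (Equiv.mulRight g)).2 h
    simpa [Function.comp_def] using h2⟩
  map_add' u v := by ext x; rfl
  map_smul' c v := by ext x; simp

@[simp] lemma Rt_apply (g : Γ) (v : lp (fun _ : Γ => ℝ) 2) (x : Γ) : Rt g v x = v (x * g) := rfl

lemma Rt_norm (g : Γ) (v : lp (fun _ : Γ => ℝ) 2) : ‖Rt g v‖ = ‖v‖ := by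
  have h1 := l2_hasSum (Rt g v)
  have h2 := (Equiv.hasSum_iff (Equiv.mulRight g)).2 (l2_hasSum v)
  have h3 : ‖Rt g v‖^2 = ‖v‖^2 := h1.unique (by simpa [Function.comp_def] using h2)
  exact (sq_eq_sq₀ (norm_nonneg _) (norm_nonneg _)).1 h3

lemma Rt_mul (g h : Γ) (v : lp (fun _ : Γ => ℝ) 2) : Rt (g * h) v = Rt g (Rt h v) := by
  ext x; simp [mul_assoc]

lemma Rt_one (v : lp (fun _ : Γ => ℝ) 2) : Rt (1:Γ) v = v := by
  ext x; simp

lemma Rt_inv_sub (g : Γ) (v : lp (fun _ : Γ => ℝ) 2) : ‖Rt g⁻¹ v - v‖ = ‖Rt g v - v‖ := by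
  rw [← Rt_norm g (Rt g⁻¹ v - v), map_sub, ← Rt_mul, mul_inv_cancel, Rt_one, norm_sub_rev]

/-- equivariant map to the free group -/
lemma free_section (φ : FreeGroup (Fin 2) →* Γ) (hφ : Function.Injective φ) :
    ∃ f : Γ → FreeGroup (Fin 2), ∀ x g, f (x * φ g) = f x * g := by
  have h1 : ∀ x : Γ, ∃ w, φ w = (QuotientGroup.mk x : Γ ⧸ φ.range).out⁻¹ * x := by
    intro x
    have := QuotientGroup.eq (s := φ.range) (a := (QuotientGroup.mk x : Γ ⧸ φ.range).out) (b := x)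
    exact this.1 (Quotient.out_eq' _)
  choose f hf using h1
  refine ⟨f, fun x g => hφ ?_⟩
  rw [map_mul, hf, hf]
  have : (QuotientGroup.mk (x * φ g) : Γ ⧸ φ.range) = QuotientGroup.mk x := by
    rw [eq_comm, QuotientGroup.eq]; simp
  rw [this, mul_assoc]

lemma free_half (φ : FreeGroup (Fin 2) →* Γ) (f : Γ → FreeGroup (Fin 2))
    (hf : ∀ x g, f (x * φ g) = f x * g) (i : Fin 2) (v : lp (fun _ : Γ => ℝ) 2) :
    ‖v‖^2 ≤ (∑' x, {x | (f x)⁻¹ ∈ FreeGroup.startsWith (i, true)}.indicator (fun x => (v x)^2) x)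
      + 3/2 * (∑' x, {x | (f x)⁻¹ ∈ FreeGroup.startsWith (i, false)}.indicator (fun x => (v x)^2) x)
      + 3 * ‖Rt (φ (FreeGroup.of i)) v - v‖^2 := by
  set g := φ (FreeGroup.of i) with hg
  set E := {x | (f x)⁻¹ ∈ FreeGroup.startsWith (i, true)} with hE
  set E' := {x | (f x)⁻¹ ∈ FreeGroup.startsWith (i, false)} with hE'
  rw [← Rt_inv_sub]
  have hv := l2_hasSum v
  have hw := l2_hasSum (Rt g⁻¹ v - v)
  have s1 : Summable (E.indicator (fun x => (v x)^2)) := hv.summable.indicator E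
  have s2 : Summable (E'.indicator (fun x => (v x)^2)) := hv.summable.indicator E'
  have key : ∀ x, (v x)^2 ≤ E.indicator (fun x => (v x)^2) x +
      (3/2 * E'.indicator (fun x => (v x)^2) (x * g) + 3 * ((Rt g⁻¹ v - v : lp (fun _ : Γ => ℝ) 2) (x*g))^2) := by
    intro x
    by_cases hx : x ∈ E
    · rw [Set.indicator_of_mem hx]
      have : 0 ≤ E'.indicator (fun x => (v x)^2) (x * g) :=
        Set.indicator_nonneg (fun _ _ => sq_nonneg _) _
      nlinarith [sq_nonneg ((Rt g⁻¹ v - v : lp (fun _ : Γ => ℝ) 2) (x*g))]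
    · have hx' : x * g ∈ E' := by
        simp only [hE', Set.mem_ofPred_eq, hg, hf, mul_inv_rev]
        have := FreeGroup.startsWith_mk_mul (w := (i, false)) (f x)⁻¹ (by exact hx)
        simpa [FreeGroup.of, FreeGroup.inv_mk, FreeGroup.invRev] using this
      rw [Set.indicator_of_notMem hx, Set.indicator_of_mem hx']
      simp only [lp.coeFn_sub, Pi.sub_apply, Rt_apply, mul_inv_cancel_right]
      nlinarith [sq_nonneg (v x - 3/2 * v (x*g))]
  have t2 : HasSum (fun x => E'.indicator (fun x => (v x)^2) (x * g)) (∑' x, E'.indicator (fun x => (v x)^2) x) := by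
    have := (Equiv.hasSum_iff (Equiv.mulRight g)).2 s2.hasSum
    simpa [Function.comp_def] using this
  have t3 : HasSum (fun x => ((Rt g⁻¹ v - v : lp (fun _ : Γ => ℝ) 2) (x*g))^2) (‖Rt g⁻¹ v - v‖^2) := by
    have := (Equiv.hasSum_iff (Equiv.mulRight g)).2 hw
    simpa [Function.comp_def] using this
  have := hasSum_le key hv (s1.hasSum.add ((t2.mul_left (3/2)).add (t3.mul_left 3)))
  linarith

lemma free_gap (φ : FreeGroup (Fin 2) →* Γ) (hφ : Function.Injective φ) (v : lp (fun _ : Γ => ℝ) 2) :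
    ‖v‖^2 ≤ 6 * (‖Rt (φ (FreeGroup.of 0)) v - v‖^2 + ‖Rt (φ (FreeGroup.of 1)) v - v‖^2) := by
  obtain ⟨f, hf⟩ := free_section φ hφ
  have h0 := free_half φ f hf 0 v
  have h1 := free_half φ f hf 1 v
  have hv := l2_hasSum v
  set E : Fin 2 × Bool → Set Γ := fun w => {x | (f x)⁻¹ ∈ FreeGroup.startsWith w} with hE
  have s : ∀ w, Summable ((E w).indicator (fun x => (v x)^2)) := fun w => hv.summable.indicator _
  have key : ∀ x, (E (0,true)).indicator (fun x => (v x)^2) x + (E (0,false)).indicator (fun x => (v x)^2) x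
      + (E (1,true)).indicator (fun x => (v x)^2) x + (E (1,false)).indicator (fun x => (v x)^2) x ≤ (v x)^2 := by
    intro x
    have hd : ∀ w w', w ≠ w' → x ∈ E w → x ∉ E w' := by
      intro w w' hne h1 h2
      exact Set.disjoint_left.1 (FreeGroup.startsWith.disjoint_iff_ne.2 hne) h1 h2
    have hsq := sq_nonneg (v x)
    by_cases a : x ∈ E (0,true)
    · have b := hd _ (0,false) (by simp) a
      have c := hd _ (1,true) (by simp) a
      have d := hd _ (1,false) (by simp) a
      simp [a,b,c,d]
    · by_cases b : x ∈ E (0,false)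
      · have c := hd _ (1,true) (by simp) b
        have d := hd _ (1,false) (by simp) b
        simp [a,b,c,d]
      · by_cases c : x ∈ E (1,true)
        · have d := hd _ (1,false) (by simp) c
          simp [a,b,c,d]
        · by_cases d : x ∈ E (1,false)
          · simp [a,b,c,d]
          · simp [a,b,c,d, hsq]
  have := hasSum_le key ((((s _).hasSum.add (s _).hasSum).add (s _).hasSum).add (s _).hasSum) hv
  have p1 : 0 ≤ ∑' x, (E (0,true)).indicator (fun x => (v x)^2) x :=
    tsum_nonneg fun _ => Set.indicator_nonneg (fun _ _ => sq_nonneg _) _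
  have p2 : 0 ≤ ∑' x, (E (1,true)).indicator (fun x => (v x)^2) x :=
    tsum_nonneg fun _ => Set.indicator_nonneg (fun _ _ => sq_nonneg _) _
  simp only [hE] at this p1 p2
  linarith

lemma closure_bound (S : Set Γ) (g : Γ) (hg : g ∈ Subgroup.closure S) :
    ∃ (F : Finset Γ) (n : ℕ), (F : Set Γ) ⊆ S ∧ ∀ (v : lp (fun _ : Γ => ℝ) 2) (σ : ℝ), 0 ≤ σ →
      (∀ s ∈ F, ‖Rt s v - v‖ ≤ σ) → ‖Rt g v - v‖ ≤ n * σ := by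
  induction hg using Subgroup.closure_induction with
  | mem x hx => exact ⟨{x}, 1, by simpa using hx, fun v σ _ h => by simpa using h x (by simp)⟩
  | one => exact ⟨∅, 0, by simp, fun v σ _ h => by simp [Rt_one]⟩
  | mul x y _ _ hx hy =>
    obtain ⟨F1, n1, hF1, h1⟩ := hx
    obtain ⟨F2, n2, hF2, h2⟩ := hy
    refine ⟨F1 ∪ F2, n1 + n2, by simp [hF1, hF2], fun v σ hσ h => ?_⟩
    have e1 := h1 v σ hσ fun s hs => h s (by simp [hs])
    have e2 := h2 v σ hσ fun s hs => h s (by simp [hs])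
    have : Rt (x*y) v - v = Rt x (Rt y v - v) + (Rt x v - v) := by
      rw [map_sub, Rt_mul]; abel
    rw [this]
    refine (norm_add_le _ _).trans ?_
    rw [Rt_norm]; push_cast; linarith
  | inv x _ hx =>
    obtain ⟨F1, n1, hF1, h1⟩ := hx
    exact ⟨F1, n1, hF1, fun v σ hσ h => by rw [Rt_inv_sub]; exact h1 v σ hσ h⟩

lemma support_gap (S : Set Γ) (h : IsNonElementarySubgroup (Subgroup.closure S)) :
    ∃ (F : Finset Γ) (κ : ℝ), (F : Set Γ) ⊆ S ∧ 0 < κ ∧ ∀ v : lp (fun _ : Γ => ℝ) 2, v ≠ 0 →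
      ∃ s ∈ F, κ * ‖v‖ ≤ ‖Rt s v - v‖ := by
  obtain ⟨φ, hφ, hr⟩ := h
  obtain ⟨F1, n1, hF1, h1⟩ := closure_bound S (φ (FreeGroup.of 0)) (hr ⟨_, rfl⟩)
  obtain ⟨F2, n2, hF2, h2⟩ := closure_bound S (φ (FreeGroup.of 1)) (hr ⟨_, rfl⟩)
  refine ⟨F1 ∪ F2, 1 / (4 * (n1 + n2 + 1)), by simp [hF1, hF2], by positivity, fun v hv => ?_⟩
  by_contra hcon
  push Not at hcon
  have hv0 : 0 < ‖v‖ := norm_pos_iff.2 hv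
  set σ := 1 / (4 * ((n1:ℝ) + n2 + 1)) * ‖v‖ with hσ
  have hσ0 : 0 ≤ σ := by positivity
  have e1 := h1 v σ hσ0 fun s hs => (hcon s (by simp [hs])).le
  have e2 := h2 v σ hσ0 fun s hs => (hcon s (by simp [hs])).le
  have b : ((n1:ℝ) + n2 + 1) * σ = ‖v‖/4 := by rw [hσ]; field_simp
  have q1 : ‖Rt (φ (FreeGroup.of 0)) v - v‖ + ‖Rt (φ (FreeGroup.of 1)) v - v‖ ≤ ‖v‖/4 := by
    nlinarith
  have := free_gap φ hφ v
  nlinarith [norm_nonneg (Rt (φ (FreeGroup.of 0)) v - v), norm_nonneg (Rt (φ (FreeGroup.of 1)) v - v)]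

/-- The convolution operator `v ↦ ∑ μ(g) v(· g⁻¹)`. -/
def Tm (μ : Γ → ℝ) (v : lp (fun _ : Γ => ℝ) 2) : lp (fun _ : Γ => ℝ) 2 :=
  ∑' g, μ g • Rt g⁻¹ v

lemma Tm_summable {μ : Γ → ℝ} (h0 : ∀ g, 0 ≤ μ g) (h1 : HasSum μ 1) (v : lp (fun _ : Γ => ℝ) 2) :
    Summable (fun g => μ g • Rt g⁻¹ v) := by
  refine Summable.of_norm ?_
  simp_rw [norm_smul, Rt_norm, Real.norm_of_nonneg (h0 _)]
  exact h1.summable.mul_right _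

lemma Tm_apply {μ : Γ → ℝ} (h0 : ∀ g, 0 ≤ μ g) (h1 : HasSum μ 1) (v : lp (fun _ : Γ => ℝ) 2) (x : Γ) :
    HasSum (fun g => μ g * v (x * g⁻¹)) (Tm μ v x) := by
  have := (Tm_summable h0 h1 v).hasSum.mapL (lp.evalCLM ℝ (fun _ : Γ => ℝ) 2 x)
  simp only [map_smul] at this
  exact this

lemma Tm_smul {μ : Γ → ℝ} (c : ℝ) (v : lp (fun _ : Γ => ℝ) 2) :
    Tm μ (c • v) = c • Tm μ v := by
  simp only [Tm, map_smul]
  rw [← tsum_const_smul'']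
  simp_rw [smul_comm c]

lemma Tm_add {μ : Γ → ℝ} (h0 : ∀ g, 0 ≤ μ g) (h1 : HasSum μ 1) (v w : lp (fun _ : Γ => ℝ) 2) :
    Tm μ (v + w) = Tm μ v + Tm μ w := by
  simp only [Tm, map_add, smul_add]
  exact (Tm_summable h0 h1 v).tsum_add (Tm_summable h0 h1 w)

lemma Tm_contract {μ : Γ → ℝ} (h0 : ∀ g, 0 ≤ μ g) (h1 : HasSum μ 1)
    (h : IsNonElementarySubgroup (Subgroup.closure {x : Γ | μ x ≠ 0})) :
    ∃ ρ : ℝ, 0 < ρ ∧ ρ < 1 ∧ ∀ v : lp (fun _ : Γ => ℝ) 2, ‖(1/2 : ℝ) • (v + Tm μ v)‖ ≤ ρ * ‖v‖ := by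
  obtain ⟨F, κ, hF, hκ, hgap⟩ := support_gap _ h
  -- a uniform lower bound for the masses on `F`
  obtain ⟨m, hm0, hm1, hm⟩ : ∃ m : ℝ, 0 < m ∧ m < 1 ∧ ∀ s ∈ F, m ≤ μ s := by
    rcases F.eq_empty_or_nonempty with he | hne
    · exact ⟨1/2, by norm_num, by norm_num, by simp [he]⟩
    · obtain ⟨s0, hs0, hmin⟩ := F.exists_min_image μ hne
      have hp : 0 < μ s0 := lt_of_le_of_ne (h0 _) (Ne.symm (hF hs0))
      refine ⟨min (μ s0) (1/2), by positivity, by norm_num, fun s hs => (min_le_left _ _).trans (hmin s hs)⟩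
  set θ := Real.sqrt (max 0 (1 - κ^2/4)) with hθ
  have hθ1 : θ < 1 := by
    rw [hθ, Real.sqrt_lt' one_pos]
    have : 0 < κ^2 := by positivity
    simp; linarith
  have hθ0 : 0 ≤ θ := Real.sqrt_nonneg _
  refine ⟨1 - m * (1 - θ), by nlinarith, by nlinarith, fun v => ?_⟩
  by_cases hv : v = 0
  · subst hv; simp [Tm]
  obtain ⟨s, hs, hgs⟩ := hgap v hv
  have hvn := norm_nonneg v
  have e1 : HasSum (fun g => μ g • ((1/2 : ℝ) • (v + Rt g⁻¹ v))) ((1/2 : ℝ) • (v + Tm μ v)) := by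
    have a := (Tm_summable h0 h1 v).hasSum
    have b := (h1.smul_const v).add a
    rw [one_smul] at b
    have c := b.const_smul (1/2 : ℝ)
    refine c.congr_fun ?_ 
    intro g
    rw [smul_comm, smul_add]
  have hle : ∀ g, ‖(1/2 : ℝ) • (v + Rt g⁻¹ v)‖ ≤ ‖v‖ := by
    intro g
    rw [norm_smul]
    have := norm_add_le v (Rt g⁻¹ v)
    rw [Rt_norm] at this
    norm_num; linarith
  have hlt : ‖(1/2 : ℝ) • (v + Rt s⁻¹ v)‖ ≤ θ * ‖v‖ := by
    have par := parallelogram_law_with_norm ℝ v (Rt s⁻¹ v)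
    rw [Rt_norm, norm_sub_rev, Rt_inv_sub] at par
    rw [norm_smul]
    have hh : ‖v + Rt s⁻¹ v‖ ≤ 2 * (θ * ‖v‖) := by
      refine abs_le_of_sq_le_sq' ?_ (by positivity) |>.2
      have : 1 - κ^2/4 ≤ θ^2 := by rw [hθ, Real.sq_sqrt (le_max_left _ _)]; exact le_max_right _ _
      have q : (κ * ‖v‖)^2 ≤ ‖Rt s v - v‖^2 := by gcongr
      have q2 : (1 - κ^2/4) * ‖v‖^2 ≤ θ^2 * ‖v‖^2 := by gcongr
      nlinarith
    norm_num; linarith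
  set d : Γ → ℝ := fun g => if g = s then m * (1-θ) * ‖v‖ else 0 with hd
  have e2 : HasSum (fun g => μ g * ‖v‖ - d g) (1 * ‖v‖ - m * (1-θ) * ‖v‖) :=
    (h1.mul_right _).sub (hasSum_ite_eq s _)
  have key : ∀ g, ‖μ g • ((1/2 : ℝ) • (v + Rt g⁻¹ v))‖ ≤ μ g * ‖v‖ - d g := by
    intro g
    rw [norm_smul, Real.norm_of_nonneg (h0 g)]
    by_cases hgs : g = s
    · subst hgs
      simp only [hd, if_true]
      have a1 := mul_le_mul_of_nonneg_left hlt (h0 g)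
      have a2 : m * ((1-θ)*‖v‖) ≤ μ g * ((1-θ)*‖v‖) :=
        mul_le_mul_of_nonneg_right (hm g hs) (mul_nonneg (by linarith) hvn)
      linarith
    · simp only [hd, if_neg hgs, sub_zero]
      exact mul_le_mul_of_nonneg_left (hle g) (h0 g)
  rw [← e1.tsum_eq]
  refine (tsum_of_norm_bounded e2 key).trans (le_of_eq ?_)
  ring

/-- `Tm` as a linear map. -/
def TmL {μ : Γ → ℝ} (h0 : ∀ g, 0 ≤ μ g) (h1 : HasSum μ 1) :
    Module.End ℝ (lp (fun _ : Γ => ℝ) 2) where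
  toFun := Tm μ
  map_add' := Tm_add h0 h1
  map_smul' := Tm_smul

lemma lazy_bound {μ : Γ → ℝ} (h0 : ∀ g, 0 ≤ μ g) (h1 : HasSum μ 1)
    (h : IsNonElementarySubgroup (Subgroup.closure {x : Γ | μ x ≠ 0})) :
    ∃ ρ : ℝ, 0 < ρ ∧ ρ < 1 ∧ ∀ (n : ℕ) (x : Γ),
      ∑ j ∈ Finset.range (n+1), (n.choose j : ℝ) / 2^n * (((TmL h0 h1)^j) (lp.single 2 1 (1:ℝ))) x ≤ ρ^n := by
  obtain ⟨ρ, hρ0, hρ1, hc⟩ := Tm_contract h0 h1 h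
  refine ⟨ρ, hρ0, hρ1, fun n x => ?_⟩
  set T := TmL h0 h1 with hT
  set L : Module.End ℝ (lp (fun _ : Γ => ℝ) 2) := (1/2 : ℝ) • (T + 1) with hL
  have hLn : ∀ n v, ‖(L^n) v‖ ≤ ρ^n * ‖v‖ := by
    intro n
    induction n with
    | zero => intro v; simp
    | succ n ih =>
      intro v
      rw [pow_succ', Module.End.mul_apply]
      have e : L ((L^n) v) = (1/2 : ℝ) • ((L^n) v + Tm μ ((L^n) v)) := by
        rw [hL]; simp [hT, TmL, add_comm]
      rw [e]
      refine (hc _).trans ?_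
      have := mul_le_mul_of_nonneg_left (ih v) hρ0.le
      rw [pow_succ']; linarith
  have hexp : (L^n) = ∑ j ∈ Finset.range (n+1), ((n.choose j : ℝ) / 2^n) • T^j := by
    rw [hL, smul_pow, (Commute.one_right T).add_pow, Finset.smul_sum]
    refine Finset.sum_congr rfl fun j _ => ?_
    rw [one_pow, mul_one, ← nsmul_eq_mul', ← Nat.cast_smul_eq_nsmul ℝ, smul_smul]
    congr 1
    rw [one_div, inv_pow]; ring
  have h2 := hLn n (lp.single 2 1 (1:ℝ))
  rw [lp.norm_single (by norm_num), norm_one, mul_one] at h2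
  have h3 := (lp.norm_apply_le_norm (p := 2) (by norm_num) ((L^n) (lp.single 2 (1:Γ) (1:ℝ))) x).trans h2
  have h4 := (le_abs_self _).trans h3
  refine le_trans (le_of_eq ?_) h4
  rw [hexp]
  simp only [LinearMap.sum_apply, lp.coeFn_sum]
  exact (Finset.sum_apply (M := fun _ : Γ => ℝ) x (Finset.range (n+1))
    (fun j => ⇑((((n.choose j : ℝ) / 2^n) • T^j) (lp.single 2 (1:Γ) (1:ℝ))))).symm

end Drift

section DriftP
open ProbabilityTheory

variable {G : Type*} [Group G] [Countable G] [MeasurableSpace G] [DiscreteMeasurableSpace G]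
  {p : G → ℝ≥0∞} {P : Measure (ℕ → G)}
  {H : Type*} [Group H] [Countable H] [MeasurableSpace H] [DiscreteMeasurableSpace H]

lemma piN_TmL (hp : IsProb p) (hP : IsRWMeasure p P) (φ : G →* H) (μ : H → ℝ≥0∞)
    (hμ : ∀ h, μ h = ∑' g, (φ ⁻¹' {h}).indicator p g)
    (h0 : ∀ g, 0 ≤ (μ g).toReal) (h1 : HasSum (fun g => (μ g).toReal) 1) (n : ℕ) (x : H) :
    (((TmL h0 h1)^n) (lp.single 2 1 (1:ℝ))) x = (piN μ n x).toReal := by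
  have hpr := hP.1
  have hfin : ∀ n h, piN μ n h ≠ ∞ := fun n h => by
    rw [← law_walk hp hP φ μ hμ n h]; exact measure_ne_top _ _
  have hμfin : ∀ g, μ g ≠ ∞ := by
    intro g
    rw [hμ g]
    refine ne_top_of_le_ne_top ENNReal.one_ne_top ?_
    rw [← (hp : ∑' x, p x = 1)]
    exact ENNReal.tsum_le_tsum fun _ => Set.indicator_le_self _ _ _
  induction n generalizing x with
  | zero =>
    simp only [pow_zero, Module.End.one_apply, piN]
    by_cases hx : x = 1
    · subst hx; simp
    · simp [hx, lp.single_apply_ne]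
  | succ n ih =>
    rw [pow_succ', Module.End.mul_apply]
    have a := Tm_apply h0 h1 (((TmL h0 h1)^n) (lp.single 2 1 (1:ℝ))) x
    have b : TmL h0 h1 (((TmL h0 h1)^n) (lp.single 2 1 (1:ℝ))) =
      Tm (fun g => (μ g).toReal) (((TmL h0 h1)^n) (lp.single 2 1 (1:ℝ))) := rfl
    rw [b, ← a.tsum_eq]
    simp_rw [ih]
    simp only [piN, conv]
    rw [← ((Equiv.inv H).trans (Equiv.mulLeft x)).tsum_eq (fun y => piN μ n y * μ (y⁻¹ * x)),
      ENNReal.tsum_toReal_eq (fun g => ENNReal.mul_ne_top (hfin _ _) (hμfin _))]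
    refine tsum_congr fun g => ?_
    simp [ENNReal.toReal_mul, mul_comm]

lemma drift_pos (hp : IsProb p) (hP : IsRWMeasure p P) (φ : G →* H) (μ : H → ℝ≥0∞)
    (hμ : ∀ h, μ h = ∑' g, (φ ⁻¹' {h}).indicator p g) [MetricSpace H]
    (hgrow : Grow (fun x : H => dist 1 x)) (hne : IsNonElemMeasure μ) {l : ℝ}
    (S : SubC P (fun _ g => dist (1:H) (φ g)) l) : 0 < l := by
  have hpr := hP.1
  have hμfin : ∀ g, μ g ≠ ∞ := by
    intro g
    rw [hμ g]
    refine ne_top_of_le_ne_top ENNReal.one_ne_top ?_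
    rw [← (hp : ∑' x, p x = 1)]
    exact ENNReal.tsum_le_tsum fun _ => Set.indicator_le_self _ _ _
  have h0 : ∀ g, 0 ≤ (μ g).toReal := fun g => ENNReal.toReal_nonneg
  have hs : ∑' h, μ h = 1 := by
    simp_rw [hμ]
    rw [ENNReal.tsum_comm, ← (hp : ∑' x, p x = 1)]
    refine tsum_congr fun g => ?_
    rw [tsum_eq_single (φ g)]
    · simp
    · intro h hh; simp [Set.indicator, hh.symm]
  have h1 : HasSum (fun g => (μ g).toReal) 1 := by
    have := (ENNReal.summable_toReal (f := μ) (by rw [hs]; simp)).hasSum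
    rwa [← ENNReal.tsum_toReal_eq hμfin, hs, ENNReal.toReal_one] at this
  have hne' : IsNonElementarySubgroup (Subgroup.closure {x : H | (μ x).toReal ≠ 0}) := by
    have : {x : H | (μ x).toReal ≠ 0} = {x | μ x ≠ 0} := by
      ext x; simp [ENNReal.toReal_eq_zero_iff, hμfin]
    rw [this]; exact hne
  obtain ⟨ρ, hρ0, hρ1, hρ⟩ := lazy_bound h0 h1 hne'
  simp_rw [piN_TmL hp hP φ μ hμ h0 h1] at hρ
  by_contra hcon
  have hl0 : l = 0 := le_antisymm (not_lt.1 hcon) S.h_nonneg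
  obtain ⟨A, B, hA, hB, hg⟩ := hgrow
  set c := -Real.log ρ / (2*B) with hc
  have hlog : Real.log ρ < 0 := Real.log_neg hρ0 hρ1
  have hc0 : 0 < c := by rw [hc]; apply div_pos <;> linarith
  set a : ℕ → ℝ := fun n => ∫ ω, dist (1:H) (φ (walk ω n)) ∂P with ha
  have hlim : Tendsto (fun n : ℕ => a n / n) atTop (𝓝 0) := hl0 ▸ S.lim
  obtain ⟨C, hC⟩ : ∃ C, ∀ j : ℕ, a j ≤ c/8 * j + C := by
    have := hlim.eventually (gt_mem_nhds (show (0:ℝ) < c/8 by positivity))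
    obtain ⟨N, hN⟩ := Filter.eventually_atTop.1 this
    refine ⟨∑ i ∈ Finset.range (N+1), |a i|, fun j => ?_⟩
    rcases le_or_gt j N with hj | hj
    · have := Finset.single_le_sum (f := fun i => |a i|) (fun i _ => abs_nonneg _)
        (Finset.mem_range.2 (Nat.lt_succ_of_le hj))
      have : a j ≤ ∑ i ∈ Finset.range (N+1), |a i| := (le_abs_self _).trans this
      have : 0 ≤ c/8 * j := by positivity
      linarith
    · have h3 := hN j hj.le
      have hj0 : (0:ℝ) < j := by exact_mod_cast (by omega : 0 < j)
      rw [div_lt_iff₀ hj0] at h3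
      have : 0 ≤ ∑ i ∈ Finset.range (N+1), |a i| := Finset.sum_nonneg fun _ _ => abs_nonneg _
      linarith
  have e1 : Tendsto (fun n : ℕ => A * (Real.exp (Real.log ρ / 2))^n) atTop (𝓝 0) := by
    have : Real.exp (Real.log ρ / 2) < 1 := by rw [Real.exp_lt_one_iff]; linarith
    simpa using (tendsto_pow_atTop_nhds_zero_of_lt_one (Real.exp_pos _).le this).const_mul A
  have e2 := e1.eventually (gt_mem_nhds (show (0:ℝ) < 1/4 by norm_num))
  have e3 := (tendsto_natCast_atTop_atTop (R := ℝ)).eventually_ge_atTop (max 1 (8*C/c))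
  obtain ⟨n, hn1, hn2⟩ := (e2.and e3).exists
  have hn0 : (1:ℝ) ≤ n := (le_max_left _ _).trans hn2
  have hnC : C ≤ c/8 * n := by
    have := (le_max_right _ _).trans hn2
    rw [div_le_iff₀ hc0] at this; linarith
  obtain ⟨hfin, hcard⟩ := hg (c*n) (by positivity)
  set Bn := hfin.toFinset with hBn
  have hcardB : (Bn.card : ℝ) * ρ^n ≤ 1/4 := by
    rw [hBn, ← Set.ncard_eq_toFinset_card _ hfin]
    refine (mul_le_mul_of_nonneg_right hcard (by positivity)).trans (le_trans (le_of_eq ?_) hn1.le)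
    rw [mul_assoc]; congr 1
    rw [← Real.exp_nat_mul, ← Real.exp_log hρ0, ← Real.exp_nat_mul, ← Real.exp_add, Real.log_exp]
    congr 1
    rw [hc]; field_simp; ring
  -- each convolution power has most of its mass in the ball
  have hmass : ∀ j ≤ n, (3/4:ℝ) ≤ ∑ x ∈ Bn, (piN μ j x).toReal := by
    intro j hj
    have hm : Measurable (fun ω : ℕ → G => φ (walk ω j)) :=
      (Measurable.of_discrete (f := φ)).comp (measurable_walk j)
    have hsum : ∑ x ∈ Bn, (piN μ j x).toReal = P.real {ω | φ (walk ω j) ∈ (Bn : Set H)} := by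
      have e : {ω : ℕ → G | φ (walk ω j) ∈ (Bn : Set H)} = ⋃ x ∈ Bn, {ω | φ (walk ω j) = x} := by
        ext ω; simp
      rw [e, measureReal_biUnion_finset]
      · refine Finset.sum_congr rfl fun x _ => ?_
        rw [← law_walk hp hP φ μ hμ j x]; rfl
      · intro x _ y _ hxy
        rw [Function.onFun, Set.disjoint_left]
        intro ω h1 h2; exact hxy (h1.symm.trans h2)
      · intro x _; exact hm (MeasurableSet.of_discrete (s := {x}))
    have hmk := mul_meas_ge_le_integral_of_nonneg (μ := P) (f := fun ω => dist (1:H) (φ (walk ω j)))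
      (Filter.Eventually.of_forall fun _ => dist_nonneg) (S.int j) (c*n)
    have haj : a j ≤ c/4 * n := by
      have := hC j
      have : (j:ℝ) ≤ n := by exact_mod_cast hj
      nlinarith
    have hq : P.real {ω | c*n ≤ dist (1:H) (φ (walk ω j))} ≤ 1/4 := by
      have h6 : c * n * P.real {ω | c*n ≤ dist (1:H) (φ (walk ω j))} ≤ c/4*n := hmk.trans haj
      have h7 : 0 < c * n := by positivity
      by_contra h8
      push Not at h8
      nlinarith
    have hcompl : {ω : ℕ → G | φ (walk ω j) ∈ (Bn : Set H)}ᶜ ⊆ {ω | c*n ≤ dist (1:H) (φ (walk ω j))} := by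
      intro ω hω
      simp only [hBn, Set.mem_compl_iff, Set.mem_ofPred_eq, Set.Finite.coe_toFinset, not_le] at hω ⊢
      exact hω.le
    have hms : MeasurableSet {ω : ℕ → G | φ (walk ω j) ∈ (Bn : Set H)} :=
      hm (MeasurableSet.of_discrete)
    have h9 := measureReal_mono (μ := P) hcompl
    rw [probReal_compl_eq_one_sub hms] at h9
    rw [hsum]; linarith
  have hfinal : (3/4 : ℝ) ≤ 1/4 := by
    calc (3/4 : ℝ) = ∑ j ∈ Finset.range (n+1), (n.choose j : ℝ) / 2^n * (3/4) := by
          rw [← Finset.sum_mul, ← Finset.sum_div]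
          have : (∑ j ∈ Finset.range (n+1), (n.choose j : ℝ)) = 2^n := by
            exact_mod_cast Nat.sum_range_choose n
          rw [this, div_self (by positivity)]; ring
      _ ≤ ∑ j ∈ Finset.range (n+1), (n.choose j : ℝ) / 2^n * ∑ x ∈ Bn, (piN μ j x).toReal := by
          refine Finset.sum_le_sum fun j hj => ?_
          have := hmass j (Nat.lt_succ_iff.1 (Finset.mem_range.1 hj))
          gcongr
      _ = ∑ x ∈ Bn, ∑ j ∈ Finset.range (n+1), (n.choose j : ℝ) / 2^n * (piN μ j x).toReal := by
          rw [Finset.sum_comm]; simp_rw [Finset.mul_sum]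
      _ ≤ ∑ x ∈ Bn, ρ^n := Finset.sum_le_sum fun x _ => hρ n x
      _ ≤ 1/4 := by rw [Finset.sum_const, nsmul_eq_mul]; exact hcardB
  norm_num at hfinal

end DriftP

/-! ### The product quasi-metric, and transfer of the moment hypothesis -/

section ProdQ
variable {Γ Γs : Type*} [Group Γ] [Group Γs] [MetricSpace Γ] [MetricSpace Γs]

lemma qbb_QM (hΓ : IsHypGroupMetric Γ) (hΓs : IsHypGroupMetric Γs) {δ : ℝ} (hδ : 0 ≤ δ)
    (h1 : IsHyperbolicWith Γ δ) (h2 : IsHyperbolicWith Γs δ) :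
    QM (qbb (1:Γ) (1:Γs)) (Real.exp (9 * δ)) where
  one_le := Real.one_le_exp (by positivity)
  nonneg x y := le_max_of_le_left (qB_nonneg _ _)
  refl x := by simp [qbb, qB]
  symm x y := by
    unfold qbb
    refine max_le ((qB_symm_le hδ h1 _ _).trans ?_) ((qB_symm_le hδ h2 _ _).trans ?_)
    · gcongr; exact le_max_left _ _
    · gcongr; exact le_max_right _ _
  tri x y z := by
    unfold qbb
    refine max_le ((qB_tri hδ h1 _ y.1 _).trans ?_) ((qB_tri hδ h2 _ y.2 _).trans ?_)
    · gcongr <;> exact le_max_left _ _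
    · gcongr <;> exact le_max_right _ _
  meas x r := by
    have : qball (qbb (1:Γ) (1:Γs)) x r = (qball (qB 1) x.1 r) ×ˢ (qball (qB 1) x.2 r) := by
      ext y; simp [qball, qbb]
    rw [this]
    exact MeasurableSet.prod (MeasurableSpace.measurableSet_generateFrom ⟨_, _, rfl⟩)
      (MeasurableSpace.measurableSet_generateFrom ⟨_, _, rfl⟩)
  net := by
    obtain ⟨A, B, hA, hB, h⟩ := exists_net hΓ
    obtain ⟨A', B', hA', hB', h'⟩ := exists_net hΓs
    refine ⟨A * A', B + B', by positivity, by positivity, fun t ht => ?_⟩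
    obtain ⟨F, hF, hF2⟩ := h t ht
    obtain ⟨F', hF', hF2'⟩ := h' t ht
    refine ⟨F ×ˢ F', ?_, fun ξ => ?_⟩
    · rw [Finset.card_product]; push_cast
      calc (F.card : ℝ) * F'.card ≤ (A * Real.exp (B*t)) * (A' * Real.exp (B'*t)) := by gcongr
        _ = _ := by rw [add_mul, Real.exp_add]; ring
    · obtain ⟨ζ, hζ, hq⟩ := hF2 ξ.1
      obtain ⟨ζ', hζ', hq'⟩ := hF2' ξ.2
      exact ⟨(ζ, ζ'), Finset.mem_product.2 ⟨hζ, hζ'⟩, max_le hq hq'⟩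

lemma grow_prod (h1 : Grow (fun x : Γ => dist 1 x)) (h2 : Grow (fun x : Γs => dist 1 x)) :
    Grow (fun x : Γ × Γs => dist 1 x) := by
  obtain ⟨A, B, hA, hB, h⟩ := h1
  obtain ⟨A', B', hA', hB', h'⟩ := h2
  refine ⟨A * A', B + B', by positivity, by positivity, fun t ht => ?_⟩
  have e : {x : Γ × Γs | dist 1 x ≤ t} = {x : Γ | dist 1 x ≤ t} ×ˢ {x : Γs | dist 1 x ≤ t} := by
    ext x; simp [Prod.dist_eq]
  obtain ⟨f, hf⟩ := h t ht
  obtain ⟨f', hf'⟩ := h' t ht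
  simp only at f f' hf hf' ⊢
  rw [e]
  refine ⟨f.prod f', ?_⟩
  rw [Set.ncard_prod]; push_cast
  calc _ ≤ (A * Real.exp (B*t)) * (A' * Real.exp (B'*t)) := by gcongr
    _ = _ := by rw [add_mul, Real.exp_add]; ring

lemma min_hyp {X : Type*} [MetricSpace X] {δ δ' : ℝ} (h : IsHyperbolicWith X δ) (hd : δ ≤ δ') :
    IsHyperbolicWith X δ' := fun x y z w => by have := h x y z w; linarith

end ProdQ

section Mom
variable {G : Type*} [Group G] [Countable G] [MeasurableSpace G] [DiscreteMeasurableSpace G]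
  {p : G → ℝ≥0∞} {P : Measure (ℕ → G)}

lemma int_of_moment (hp : IsProb p) (hP : IsRWMeasure p P) {f : G → ℝ} (hf : ∀ g, 0 ≤ f g)
    (hm : FiniteFirstMoment p f) : Integrable (fun ω : ℕ → G => f (ω 0)) P := by
  have hm0 : Measurable (fun ω : ℕ → G => ω 0) := measurable_pi_apply 0
  have hmf : Measurable f := Measurable.of_discrete
  refine ⟨(hmf.comp hm0).aestronglyMeasurable, ?_⟩
  rw [hasFiniteIntegral_iff_ofReal (Filter.Eventually.of_forall fun ω => hf _)]
  have e : ∫⁻ ω, ENNReal.ofReal (f (ω 0)) ∂P = ∫⁻ g, ENNReal.ofReal (f g) ∂(P.map (fun ω => ω 0)) := by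
    rw [lintegral_map Measurable.of_discrete hm0]
  rw [e, lintegral_countable']
  have h2 : ∀ g, (P.map (fun ω : ℕ → G => ω 0)) {g} = p g := by
    intro g
    rw [Measure.map_apply hm0 (MeasurableSet.of_discrete)]
    have := rw_marg hp hP 0 {g}
    rw [show ((fun ω : ℕ → G => ω 0) ⁻¹' {g}) = {ω | ω 0 ∈ ({g} : Set G)} from rfl, this,
      tsum_eq_single g]
    · simp
    · intro x hx; simp [hx]
  simp_rw [h2, mul_comm (ENNReal.ofReal _)]
  exact lt_top_iff_ne_top.2 hm

end Mom

section Marg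
variable {Γ Γs : Type*} [Group Γ] [Group Γs] 

lemma marg_fst (p : Γ × Γs → ℝ≥0∞) (h : Γ) :
    (∑' y, p (h, y)) = ∑' g, ((MonoidHom.fst Γ Γs) ⁻¹' {h}).indicator p g := by
  rw [ENNReal.tsum_prod', tsum_eq_single h]
  · simp [Set.indicator]
  · intro x hx; simp [Set.indicator, hx]

lemma marg_snd (p : Γ × Γs → ℝ≥0∞) (h : Γs) :
    (∑' x, p (x, h)) = ∑' g, ((MonoidHom.snd Γ Γs) ⁻¹' {h}).indicator p g := by
  rw [ENNReal.tsum_prod']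
  refine tsum_congr fun x => ?_
  rw [tsum_eq_single h]
  · simp [Set.indicator]
  · intro x hx; simp [Set.indicator, hx]

end Marg

/-! ### Deterministic geometry along good trajectories -/

section Geo
variable {X : Type*} [MetricSpace X] {o : X} {δ : ℝ}

/-- The trajectory `u` is tight at time `n`: linear progress and no backtracking. -/
def Good1 (o : X) (u : ℕ → X) (L e : ℝ) (n : ℕ) : Prop :=
  |dist o (u n) - L * n| ≤ e * n ∧ ∀ m, n ≤ m → (L - 4 * e) * n ≤ gp o (u n) (u m)

/-- `ξ` is the limit of `u`. -/
def LimB (o : X) (u : ℕ → X) (ξ : Boundary X o) : Prop :=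
  ∃ h : IsDivergent o u, ξ = mkB o ⟨u, h⟩

lemma limB_sub {u : ℕ → X} {ξ : Boundary X o} (h : LimB o u ξ) {k : ℕ} (hk : 1 ≤ k) :
    LimB o (fun n => u (k * n)) ξ := by
  obtain ⟨hd, rfl⟩ := h
  have hk' : ∀ n N : ℕ, N ≤ n → N ≤ k * n := fun n N hn => hn.trans (Nat.le_mul_of_pos_left n hk)
  have hd0 := tend_iff.1 hd
  have r2 : Tendsto (fun pr : ℕ × ℕ => gp o (u (k * pr.1)) (u (k * pr.2))) atTop atTop :=
    tend_iff.2 fun T => by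
      obtain ⟨N, hN⟩ := hd0 T
      exact ⟨N, fun n hn m hm => hN _ (hk' n N hn) _ (hk' m N hm)⟩
  have r3 : Tendsto (fun pr : ℕ × ℕ => gp o (u pr.1) (u (k * pr.2))) atTop atTop :=
    tend_iff.2 fun T => by
      obtain ⟨N, hN⟩ := hd0 T
      exact ⟨N, fun n hn m hm => hN _ hn _ (hk' m N hm)⟩
  have r2' : IsDivergent o (fun n => u (k * n)) := r2
  refine ⟨r2', ?_⟩
  have r3' : bndRel o ⟨u, hd⟩ ⟨fun n => u (k * n), r2'⟩ := r3
  exact Quot.sound r3'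

lemma good1_ev (hδ : 0 ≤ δ) (h : IsHyperbolicWith X δ) {u : ℕ → X} {L e : ℝ} (he : 0 < e)
    (hL : 4 * e < L) (hz : ∀ᶠ j : ℕ in atTop, |dist o (u j) - L * j| ≤ e * j)
    (hinc : ∀ᶠ j : ℕ in atTop, dist (u j) (u (j+1)) ≤ L + e * (j+1)) :
    ∀ᶠ n in atTop, Good1 o u L e n := by
  obtain ⟨N0, hN0⟩ := Filter.eventually_atTop.1 ((hz.and hinc).and (Filter.eventually_ge_atTop 1))
  obtain ⟨N1, hN1, hch⟩ := chain_eps hδ h (show 0 < L - 3 * e by linarith) he N0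
  filter_upwards [Filter.eventually_ge_atTop N1] with n hn
  refine ⟨(hN0 n (hN1.trans hn)).1.1, fun m hm => ?_⟩
  rcases eq_or_lt_of_le hm with rfl | hlt
  · rw [gp_self]
    have := (abs_le.1 (hN0 n (hN1.trans hn)).1.1).1
    have : 0 ≤ e * n := by positivity
    nlinarith
  · have := hch o u m (fun k hk _ => ?_) n m hn hlt le_rfl
    · linarith
    · have a := (abs_le.1 (hN0 k hk).1.1).1
      have b := (abs_le.1 (hN0 (k+1) (by omega)).1.1).1
      have c := (hN0 k hk).1.2
      have d := dist_eq_gp (o := o) (u k) (u (k+1))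
      have k1 : (1:ℝ) ≤ k := by exact_mod_cast (hN0 k hk).2
      push_cast at b
      nlinarith

lemma geo_i (hδ : 0 ≤ δ) (h : IsHyperbolicWith X δ) {u u' : ℕ → X} {ξ ξ' : Boundary X o}
    (hu : LimB o u ξ) (hu' : LimB o u' ξ') {L e : ℝ} {n : ℕ} (g : Good1 o u L e n)
    (g' : Good1 o u' L e n) (heq : u n = u' n) :
    qB o ξ ξ' ≤ Real.exp (-((L - 4 * e) * n - 5 * δ)) := by
  obtain ⟨hd, rfl⟩ := hu
  obtain ⟨hd', rfl⟩ := hu'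
  have := qB_le_of hδ h ⟨u, hd⟩ ⟨u', hd'⟩ ((L - 4 * e) * n - δ) n (fun m hm m' hm' => by
    have a := h (u m) (u' m') (u n) o
    have b := g.2 m hm
    have c := g'.2 m' hm'
    rw [gp_comm] at b
    rw [← heq] at c
    have := le_min b c
    show _ ≤ gp o (u m) (u' m')
    linarith)
  refine this.trans (le_of_eq ?_)
  congr 1; ring

lemma geo_ii (hδ : 0 ≤ δ) (h : IsHyperbolicWith X δ) {u u' : ℕ → X} {ξ ξ' : Boundary X o}
    (hu : LimB o u ξ) (hu' : LimB o u' ξ') {L e : ℝ} (he : 0 ≤ e) {n : ℕ} (g : Good1 o u L e n)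
    (g' : Good1 o u' L e n) {s t : ℝ} (ht : 0 ≤ t) (hs : qB o ξ ξ' ≤ Real.exp (-s))
    (hst : L * n - t ≤ s) :
    dist (u n) (u' n) ≤ 10 * (e * n) + 2 * t + 12 * δ := by
  obtain ⟨hd, rfl⟩ := hu
  obtain ⟨hd', rfl⟩ := hu'
  obtain ⟨N, hN⟩ := gp_of_qB_le hδ h ⟨u, hd⟩ ⟨u', hd'⟩ s hs
  set m := max N n
  have a := hN m (le_max_left _ _) m (le_max_left _ _)
  have b := g.2 m (le_max_right _ _)
  have c := g'.2 m (le_max_right _ _)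
  have p1 := h (u n) (u' m) (u m) o
  have p2 := h (u n) (u' n) (u' m) o
  rw [gp_comm] at c
  simp only at a
  have en : 0 ≤ e * n := by positivity
  have q1 : L * n - 4 * (e * n) - t - 4 * δ ≤ min (gp o (u n) (u m)) (gp o (u m) (u' m)) :=
    le_min (by nlinarith) (by linarith)
  have q2 : L * n - 4 * (e * n) - t - 5 * δ ≤ min (gp o (u n) (u' m)) (gp o (u' m) (u' n)) :=
    le_min (by linarith) (by nlinarith)
  have r1 := (abs_le.1 g.1).2
  have r2 := (abs_le.1 g'.1).2
  have d := dist_eq_gp (o := o) (u n) (u' n)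
  linarith

end Geo

section Main
variable {Γ Γs : Type*} [Group Γ] [Group Γs] [MetricSpace Γ] [MetricSpace Γs]
    [Countable Γ] [Countable Γs] [MeasurableSpace Γ] [DiscreteMeasurableSpace Γ]
    [MeasurableSpace Γs] [DiscreteMeasurableSpace Γs]
    {p : Γ × Γs → ℝ≥0∞} {P : Measure (ℕ → Γ × Γs)} {δ : ℝ}

lemma good1_ae {G H : Type*} [Group G] [Countable G] [MeasurableSpace G] [DiscreteMeasurableSpace G]
    [Group H] [MetricSpace H] {P : Measure (ℕ → G)} (hδ : 0 ≤ δ) (h : IsHyperbolicWith H δ)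
    (hinv : LeftInvariantMetric H) (φ : G →* H) {l η : ℝ} {k : ℕ} (hk : 1 ≤ k) (hη : 0 < η)
    (hl : 4 * η < l)
    (hm : ∀ᵐ ω ∂P, ∀ᶠ j : ℕ in atTop, ∀ i1 n, i1 + n ≤ j →
      |dist 1 (φ (walk (sh^[k*i1] ω) (k*n))) - l*(k*n)| ≤ η*(k*j)) :
    ∀ᵐ ω ∂P, ∀ᶠ n in atTop, Good1 1 (fun n => φ (walk ω (k*n))) (l*k) (η*k) n := by
  have hk0 : (0:ℝ) < k := by exact_mod_cast hk
  filter_upwards [hm] with ω hω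
  refine good1_ev hδ h (by positivity) (by nlinarith) ?_ ?_
  · filter_upwards [hω] with j hj
    have := hj 0 j (by simp)
    simp only [mul_zero, Function.iterate_zero, id_eq] at this
    rw [mul_assoc, mul_assoc]; exact this
  · filter_upwards [(tendsto_add_atTop_nat 1).eventually hω] with j hj
    have h1 := hj j 1 le_rfl
    have h2 : dist (φ (walk ω (k*j))) (φ (walk ω (k*(j+1)))) = dist 1 (φ (walk (sh^[k*j] ω) (k*1))) := by
      rw [mul_add, walk_add, map_mul]
      have := hinv (φ (walk ω (k*j))) 1 (φ (walk (sh^[k*j] ω) (k*1)))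
      rwa [mul_one] at this
    rw [h2]
    have := (abs_le.1 h1).2
    push_cast at this
    nlinarith

lemma edata_main (hδ : 0 ≤ δ) (h1 : IsHyperbolicWith Γ δ) (h2 : IsHyperbolicWith Γs δ)
    (hi1 : LeftInvariantMetric Γ) (hi2 : LeftInvariantMetric Γs)
    (hp : IsProb p) (hP : IsRWMeasure p P) {hπ hs l ls : ℝ} (hls0 : 0 < ls) (hll : ls ≤ l)
    {A B A' B' : ℝ} (hA : 0 < A) (hB : 0 < B) (hA' : 0 < A') (hB' : 0 < B')
    (hg : ∀ s : ℝ, 0 ≤ s → {x : Γ × Γs | dist 1 x ≤ s}.Finite ∧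
      ({x : Γ × Γs | dist 1 x ≤ s}.ncard : ℝ) ≤ A * Real.exp (B * s))
    (hg' : ∀ s : ℝ, 0 ≤ s → {x : Γs | dist 1 x ≤ s}.Finite ∧
      ({x : Γs | dist 1 x ≤ s}.ncard : ℝ) ≤ A' * Real.exp (B' * s))
    {μs : Γs → ℝ≥0∞} (hμs : ∀ h, μs h = ∑' g, ((MonoidHom.snd Γ Γs) ⁻¹' {h}).indicator p g)
    (Sπ : SubC P (fun n g => -Real.log (piN p n g).toReal) hπ)
    (Pπ : ∀ᵐ ω ∂P, ∀ k n, 0 < (piN p n (walk (sh^[k] ω) n)).toReal)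
    (Ss : SubC P (fun n g => -Real.log (piN μs n (MonoidHom.snd Γ Γs g)).toReal) hs)
    (Ps : ∀ᵐ ω ∂P, ∀ k n, 0 < (piN μs n (MonoidHom.snd Γ Γs (walk (sh^[k] ω) n))).toReal)
    (Dx : SubC P (fun _ g => dist (1:Γ) (MonoidHom.fst Γ Γs g)) l)
    (Dy : SubC P (fun _ g => dist (1:Γs) (MonoidHom.snd Γ Γs g)) ls)
    {bnd : (ℕ → Γ × Γs) → Boundary Γ (1 : Γ) × Boundary Γs (1 : Γs)}
    (hb : ∀ᵐ ω ∂P, LimB 1 (fun n => (walk ω n).1) (bnd ω).1 ∧ LimB 1 (fun n => (walk ω n).2) (bnd ω).2)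
    {ε : ℝ} (hε : 0 < ε) (hε1 : ε < 1) :
    EData ((Γ × Γs) × Γs) (qbb (1:Γ) (1:Γs)) (Real.exp (9 * δ)) ((hπ - hs) / l + hs / ls) P bnd
      (5/4 * (B + B') + 1) ε := by
  have hl0 : 0 < l := hls0.trans_le hll
  have hπ0 : 0 ≤ hπ := Sπ.h_nonneg
  have hs0 : 0 ≤ hs := Ss.h_nonneg
  set η := ε * ls / 8 with hη
  have hη0 : 0 < η := by positivity
  have hηls : 4 * η < ls := by rw [hη]; nlinarith
  obtain ⟨k1, hk1⟩ := SubC.main hp hP Sπ hη0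
  obtain ⟨k2, hk2⟩ := SubC.main hp hP Ss hη0
  obtain ⟨k3, hk3⟩ := SubC.main hp hP Dx hη0
  obtain ⟨k4, hk4⟩ := SubC.main hp hP Dy hη0
  set k := k1 + k2 + k3 + k4 + 1 with hk
  have hk1' : 1 ≤ k := by omega
  have hk0 : (0:ℝ) < k := by exact_mod_cast hk1'
  have m1 := hk1 k (by omega) hk1'
  have m2 := hk2 k (by omega) hk1'
  have m3 := good1_ae hδ h1 hi1 (MonoidHom.fst Γ Γs) hk1' hη0 (by linarith) (hk3 k (by omega) hk1')
  have m4 := good1_ae hδ h2 hi2 (MonoidHom.snd Γ Γs) hk1' hη0 hηls (hk4 k (by omega) hk1')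
  clear_value k
  clear hk1 hk2 hk3 hk4
  set L := l * k with hL
  set Ls := ls * k with hLs
  set e := η * k with he
  have hL0 : 0 < L := by positivity
  have hLs0 : 0 < Ls := by positivity
  have he0 : 0 < e := by positivity
  have heLs : e = ε / 8 * Ls := by rw [he, hη, hLs]; ring
  have hLL : Ls ≤ L := by rw [hL, hLs]; gcongr
  set i : ℕ → ℕ := fun R => ⌊(R:ℝ) / L⌋₊ with hi
  set j : ℕ → ℕ := fun R => ⌊(R:ℝ) / Ls⌋₊ with hj
  have hij : ∀ R, i R ≤ j R := fun R => Nat.floor_le_floor (by gcongr)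
  have ti : Tendsto i atTop atTop :=
    tendsto_nat_floor_atTop.comp (tendsto_natCast_atTop_atTop.atTop_div_const hL0)
  have tj : Tendsto j atTop atTop :=
    tendsto_nat_floor_atTop.comp (tendsto_natCast_atTop_atTop.atTop_div_const hLs0)
  have iub : ∀ R : ℕ, L * i R ≤ R := fun R => by
    have := Nat.floor_le (show (0:ℝ) ≤ (R:ℝ)/L by positivity)
    rw [le_div_iff₀ hL0] at this; linarith
  have jub : ∀ R : ℕ, Ls * j R ≤ R := fun R => by
    have := Nat.floor_le (show (0:ℝ) ≤ (R:ℝ)/Ls by positivity)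
    rw [le_div_iff₀ hLs0] at this; linarith
  have ilb : ∀ R : ℕ, R ≤ L * i R + L := fun R => by
    have := (Nat.lt_floor_add_one ((R:ℝ)/L)).le
    rw [div_le_iff₀ hL0] at this
    have e : (i R : ℝ) = (⌊(R:ℝ)/L⌋₊ : ℝ) := rfl
    rw [e]; linarith
  have jlb : ∀ R : ℕ, R ≤ Ls * j R + Ls := fun R => by
    have := (Nat.lt_floor_add_one ((R:ℝ)/Ls)).le
    rw [div_le_iff₀ hLs0] at this
    have e : (j R : ℝ) = (⌊(R:ℝ)/Ls⌋₊ : ℝ) := rfl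
    rw [e]; linarith
  clear_value i j
  have hijr : ∀ R, (i R : ℝ) ≤ j R := fun R => by exact_mod_cast hij R
  have ejub : ∀ R : ℕ, e * j R ≤ ε / 8 * R := fun R => by
    rw [heLs, mul_assoc]; exact mul_le_mul_of_nonneg_left (jub R) (by positivity)
  have eiub : ∀ R : ℕ, e * i R ≤ ε / 8 * R := fun R =>
    (mul_le_mul_of_nonneg_left (hijr R) he0.le).trans (ejub R)
  set xs : (ℕ → Γ × Γs) → ℕ → Γ := fun ω n => (walk ω (k*n)).1 with hxs
  set ys : (ℕ → Γ × Γs) → ℕ → Γs := fun ω n => (walk ω (k*n)).2 with hys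
  set τ : ℕ → (ℕ → Γ × Γs) → (Γ × Γs) × Γs := fun R ω =>
    (walk ω (k * i R), (walk (sh^[k * i R] ω) (k * (j R - i R))).2) with hτ
  have hyj : ∀ R ω, ys ω (j R) = (τ R ω).1.2 * (τ R ω).2 := by
    intro R ω
    have : k * j R = k * i R + k * (j R - i R) := by rw [← mul_add, Nat.add_sub_cancel' (hij R)]
    simp only [hys, hτ, this, walk_add]
    rfl
  have hyi : ∀ R ω, ys ω (i R) = (τ R ω).1.2 := fun R ω => rfl
  have hxi : ∀ R ω, xs ω (i R) = (τ R ω).1.1 := fun R ω => rfl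
  have hlaw : ∀ R t, P {ω | τ R ω = t} = piN p (k * i R) t.1 * piN μs (k * (j R - i R)) t.2 := by
    intro R t
    rw [← law_pair hp hP (MonoidHom.snd Γ Γs) μs hμs]
    congr 1; ext ω
    simp only [hτ, Set.mem_ofPred_eq, Prod.ext_iff (x := ((_ : Γ × Γs), (_ : Γs)))]
    rfl
  set Gd : ℕ → Set (ℕ → Γ × Γs) := fun R => {ω |
    Good1 1 (xs ω) L e (i R) ∧ Good1 1 (ys ω) Ls e (i R) ∧ Good1 1 (ys ω) Ls e (j R) ∧
    LimB 1 (xs ω) (bnd ω).1 ∧ LimB 1 (ys ω) (bnd ω).2 ∧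
    0 < (piN p (k * i R) (τ R ω).1).toReal ∧ 0 < (piN μs (k * (j R - i R)) (τ R ω).2).toReal ∧
    |-Real.log (piN p (k * i R) (τ R ω).1).toReal - hπ * (k * i R)| ≤ η * (k * i R) ∧
    |-Real.log (piN μs (k * (j R - i R)) (τ R ω).2).toReal - hs * (k * (j R - i R : ℕ))| ≤ η * (k * j R)}
    with hGd
  refine ⟨τ, Gd, ?_, ?_, ?_⟩
  · intro R t
    have hm : Measurable (τ R) := by
      refine (measurable_walk _).prodMk (measurable_snd.comp ((measurable_walk _).comp ?_))
      exact measurable_sh.iterate _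
    exact hm (MeasurableSet.of_discrete (s := {t}))
  · filter_upwards [m1, m2, m3, m4, Pπ, Ps, hb] with ω a1 a2 a3 a4 a5 a6 a7
    filter_upwards [ti.eventually a1, tj.eventually a2, ti.eventually a3, ti.eventually a4,
      tj.eventually a4] with R b1 b2 b3 b4 b5
    refine ⟨b3, b4, b5, limB_sub a7.1 hk1', limB_sub a7.2 hk1', ?_, a6 _ _, ?_, ?_⟩
    · exact a5 0 _
    · have := b1 0 (i R) (by simp)
      simpa using this
    · exact b2 (i R) (j R - i R) (by have := hij R; omega)
  -- large `R`
  set c1 := Real.log (A * A') + (B + B') * (48 * δ) with hc1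
  have tR := (tendsto_natCast_atTop_atTop (R := ℝ)).eventually_ge_atTop
    (2 * (L + 5 * δ + (hπ + hs) * k + |c1|) / ε)
  filter_upwards [tR] with R hR ω hω
  rw [div_le_iff₀ hε] at hR
  obtain ⟨gx, gyi, gyj, lx, ly, p1, p2, H1, H2⟩ := hω
  have hR0 : (0:ℝ) ≤ R := Nat.cast_nonneg R
  have hc1a := abs_nonneg c1
  have hhk : 0 ≤ (hπ + hs) * k := by positivity
  have hεR : 0 ≤ ε * R := by positivity
  refine ⟨?_, ?_, ?_⟩
  · rw [hlaw, ENNReal.toReal_mul]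
    set a := (piN p (k * i R) (τ R ω).1).toReal with ha
    set b := (piN μs (k * (j R - i R)) (τ R ω).2).toReal with hb'
    have hab : a * b = Real.exp (Real.log a + Real.log b) := by
      rw [Real.exp_add, Real.exp_log p1, Real.exp_log p2]
    rw [hab, Real.exp_le_exp, Real.exp_le_exp]
    rw [abs_le] at H1 H2
    rw [Nat.cast_sub (hij R)] at H2
    set x : ℝ := k * i R with hx
    set y : ℝ := k * j R with hy
    have x1 : x ≤ R / l := by rw [le_div_iff₀ hl0]; have := iub R; rw [hL] at this; linarith
    have x2 : R / l ≤ x + k := by rw [div_le_iff₀ hl0]; have := ilb R; rw [hL] at this; linarith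
    have y1 : y ≤ R / ls := by rw [le_div_iff₀ hls0]; have := jub R; rw [hLs] at this; linarith
    have y2 : R / ls ≤ y + k := by rw [div_le_iff₀ hls0]; have := jlb R; rw [hLs] at this; linarith
    have hD : ((hπ - hs) / l + hs / ls) * R = hπ * (R / l) + hs * (R / ls - R / l) := by ring
    have e1 : η * x ≤ ε / 8 * R := by have := eiub R; rw [he] at this; linarith
    have e2 : η * y ≤ ε / 8 * R := by have := ejub R; rw [he] at this; linarith
    have q1 : hπ * x ≤ hπ * (R / l) := by gcongr
    have q2 : hπ * (R / l) ≤ hπ * (x + k) := by gcongr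
    have q3 : hs * (y - x) ≤ hs * (R / ls - R / l + k) := mul_le_mul_of_nonneg_left (by linarith) hs0
    have q4 : hs * (R / ls - R / l - k) ≤ hs * (y - x) := mul_le_mul_of_nonneg_left (by linarith) hs0
    have L0 := hL0.le
    have e5 : hs * (k * ((j R : ℝ) - i R)) = hs * (y - x) := by rw [hx, hy]; ring
    constructor
    · rw [add_mul, hD]; linarith
    · rw [sub_mul, hD]; linarith
  · intro ω' hω' heq
    obtain ⟨gx', gyi', gyj', lx', ly', -⟩ := hω'
    have r1 := geo_i hδ h1 lx lx' gx gx' (by rw [hxi, hxi, heq])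
    have r2 := geo_i hδ h2 ly ly' gyj gyj' (by rw [hyj, hyj, heq])
    have hK : ε * R ≤ (5/4 * (B + B') + 1) * ε * R := by
      have : 0 ≤ 5/4 * (B + B') * (ε * R) := by positivity
      linarith
    refine max_le (r1.trans (Real.exp_le_exp.2 ?_)) (r2.trans (Real.exp_le_exp.2 ?_))
    · have := ilb R; have := eiub R; linarith
    · have := jlb R; have := ejub R; linarith
  · set r := 5/4 * (ε * R) + 48 * δ with hr
    have hr0 : 0 ≤ r := by positivity
    obtain ⟨f1, c1'⟩ := hg r hr0
    obtain ⟨f2, c2'⟩ := hg' r hr0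
    refine ⟨(f1.toFinset ×ˢ f2.toFinset).image (fun gh : (Γ × Γs) × Γs =>
      ((τ R ω).1 * gh.1, ((τ R ω).1.2 * gh.1.2)⁻¹ * (ys ω (j R) * gh.2))), ?_, ?_⟩
    · refine (Nat.cast_le.2 Finset.card_image_le).trans ?_
      rw [Finset.card_product, ← Set.ncard_eq_toFinset_card _ f1, ← Set.ncard_eq_toFinset_card _ f2]
      push_cast
      calc _ ≤ (A * Real.exp (B * r)) * (A' * Real.exp (B' * r)) := by gcongr
        _ = Real.exp (Real.log (A * A') + (B + B') * r) := by
            rw [Real.exp_add, Real.exp_log (by positivity), add_mul, Real.exp_add]; ring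
        _ ≤ _ := by
            rw [Real.exp_le_exp, hr]
            have := le_abs_self c1
            have e6 : Real.log (A * A') + (B + B') * (5/4 * (ε * R) + 48 * δ)
              = c1 + 5/4 * (B + B') * (ε * R) := by rw [hc1]; ring
            rw [e6]; linarith
    · intro ω' hω' hq
      obtain ⟨gx', gyi', gyj', lx', ly', -⟩ := hω'
      have hCC : Real.exp (9*δ) * Real.exp (9*δ) * Real.exp (-(R:ℝ)) = Real.exp (-((R:ℝ) - 18*δ)) := by
        rw [← Real.exp_add, ← Real.exp_add]; congr 1; ring
      rw [hCC] at hq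
      have hq1 := (le_max_left _ _).trans hq
      have hq2 := (le_max_right _ _).trans hq
      have ht : 0 ≤ 18 * δ := by positivity
      have yiub : Ls * i R ≤ R :=
        (mul_le_mul_of_nonneg_right hLL (Nat.cast_nonneg _)).trans (iub R)
      have d1 := geo_ii hδ h1 lx lx' he0.le gx gx' ht hq1 (by have := iub R; linarith)
      have d2 := geo_ii hδ h2 ly ly' he0.le gyi gyi' ht hq2 (by linarith)
      have d3 := geo_ii hδ h2 ly ly' he0.le gyj gyj' ht hq2 (by have := jub R; linarith)
      have u1 := eiub R
      have u2 := ejub R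
      have dd1 : dist (xs ω (i R)) (xs ω' (i R)) ≤ r := by rw [hr]; linarith
      have dd2 : dist (ys ω (i R)) (ys ω' (i R)) ≤ r := by rw [hr]; linarith
      have dd3 : dist (ys ω (j R)) (ys ω' (j R)) ≤ r := by rw [hr]; linarith
      have inv1 : ∀ x x' : Γ, dist 1 (x⁻¹ * x') = dist x x' := fun x x' => by
        have := hi1 x 1 (x⁻¹ * x'); simpa using this.symm
      have inv2 : ∀ x x' : Γs, dist 1 (x⁻¹ * x') = dist x x' := fun x x' => by
        have := hi2 x 1 (x⁻¹ * x'); simpa using this.symm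
      rw [Finset.mem_image]
      refine ⟨((τ R ω).1⁻¹ * (τ R ω').1, (ys ω (j R))⁻¹ * ys ω' (j R)), ?_, ?_⟩
      · rw [Finset.mem_product, Set.Finite.mem_toFinset, Set.Finite.mem_toFinset]
        refine ⟨?_, ?_⟩
        · show max (dist (1:Γ) _) (dist (1:Γs) _) ≤ r
          exact max_le ((inv1 _ _).trans_le dd1) ((inv2 _ _).trans_le dd2)
        · exact (inv2 _ _).trans_le dd3
      · refine Prod.ext ?_ ?_
        · simp
        · simp only [hyj R ω', mul_inv_cancel_left, Prod.snd_mul, Prod.snd_inv]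
          rw [inv_mul_cancel_left]

end Main

/-- Theorem 1.1: exact dimensionality and the dimension formula for
the harmonic measure on the product of the boundaries of two non-elementary hyperbolic
groups, assuming `l(Γ,μ) ≥ l(Γ*,μ*)`. -/
theorem statement0
    (Γ Γs : Type*) [Group Γ] [Group Γs] [MetricSpace Γ] [MetricSpace Γs]
    [Countable Γ] [Countable Γs]
    [MeasurableSpace Γ] [DiscreteMeasurableSpace Γ]
    [MeasurableSpace Γs] [DiscreteMeasurableSpace Γs]
    (hΓ : IsHypGroupMetric Γ) (hΓs : IsHypGroupMetric Γs)
    (hneΓ : HasFreeSubgroup Γ) (hneΓs : HasFreeSubgroup Γs)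
    (p : Γ × Γs → ℝ≥0∞) (hp : IsProb p)
    (hmom : FiniteFirstMoment p fun g => dist (1 : Γ × Γs) g)
    (hμne : IsNonElemMeasure fun x : Γ => ∑' y : Γs, p (x, y))
    (hμsne : IsNonElemMeasure fun y : Γs => ∑' x : Γ, p (x, y))
    (hπ hs l ls : ℝ)
    (hhπ : HasEntropy p hπ)
    (hhs : HasEntropy (fun y : Γs => ∑' x : Γ, p (x, y)) hs)
    (hl : HasDrift (fun x : Γ => ∑' y : Γs, p (x, y)) (fun x => dist (1 : Γ) x) l)
    (hls : HasDrift (fun y : Γs => ∑' x : Γ, p (x, y)) (fun y => dist (1 : Γs) y) ls)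
    (P : Measure (ℕ → Γ × Γs)) (hP : IsRWMeasure p P)
    (ν : Measure (Boundary Γ (1 : Γ) × Boundary Γs (1 : Γs)))
    (hν : IsJointHarmonic (1 : Γ) (1 : Γs) P (fun ω n => (walk ω n).1)
      (fun ω n => (walk ω n).2) ν)
    (hll : ls ≤ l) :
    ExactDim (qbb (1 : Γ) (1 : Γs)) ν ((hπ - hs) / l + hs / ls) ∧
      HasDim (qbb (1 : Γ) (1 : Γs)) ν ((hπ - hs) / l + hs / ls) := by
  have hpr := hP.1
  obtain ⟨δ1, hδ1, hy1⟩ := hΓ.2.1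
  obtain ⟨δ2, hδ2, hy2⟩ := hΓs.2.1
  have hδ : 0 ≤ max δ1 δ2 := le_max_of_le_left hδ1
  have hh1 := min_hyp hy1 (le_max_left δ1 δ2)
  have hh2 := min_hyp hy2 (le_max_right δ1 δ2)
  have gr1 : Grow (fun x : Γ => dist 1 x) := growth hΓ
  have gr2 : Grow (fun x : Γs => dist 1 x) := growth hΓs
  have gr := grow_prod gr1 gr2
  have int0 := int_of_moment hp hP (f := fun g => dist (1 : Γ × Γs) g) (fun _ => dist_nonneg) hmom
  have int1 : Integrable (fun ω : ℕ → Γ × Γs => dist (1:Γ) (MonoidHom.fst Γ Γs (ω 0))) P := by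
    refine int0.mono' ?_ (Filter.Eventually.of_forall fun ω => ?_)
    · exact ((Measurable.of_discrete (f := fun g : Γ × Γs => dist (1:Γ) g.1)).comp
        (measurable_pi_apply 0)).aestronglyMeasurable
    · rw [Real.norm_of_nonneg dist_nonneg]; exact le_max_left _ _
  have int2 : Integrable (fun ω : ℕ → Γ × Γs => dist (1:Γs) (MonoidHom.snd Γ Γs (ω 0))) P := by
    refine int0.mono' ?_ (Filter.Eventually.of_forall fun ω => ?_)
    · exact ((Measurable.of_discrete (f := fun g : Γ × Γs => dist (1:Γs) g.2)).comp
        (measurable_pi_apply 0)).aestronglyMeasurable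
    · rw [Real.norm_of_nonneg dist_nonneg]; exact le_max_right _ _
  have Dx := SubC.of_dist hp hP (MonoidHom.fst Γ Γs) _ (marg_fst p) hΓ.1 int1 hl
  have Dy := SubC.of_dist hp hP (MonoidHom.snd Γ Γs) _ (marg_snd p) hΓs.1 int2 hls
  have hls0 : 0 < ls := drift_pos hp hP (MonoidHom.snd Γ Γs) _ (marg_snd p) gr2 hμsne Dy
  obtain ⟨Sπ, Pπ⟩ := SubC.of_entropy hp hP (MonoidHom.id (Γ × Γs)) p (marg_id p)
    (d := fun g => dist 1 g) (fun _ => dist_nonneg) gr int0 hhπ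
  obtain ⟨Ss, Ps⟩ := SubC.of_entropy hp hP (MonoidHom.snd Γ Γs) _ (marg_snd p)
    (d := fun g => dist 1 g) (fun _ => dist_nonneg) gr2 int2 hhs
  obtain ⟨bnd, hbm, rfl, hb⟩ := hν
  obtain ⟨A, B, hA, hB, hg⟩ := gr
  obtain ⟨A', B', hA', hB', hg'⟩ := gr2
  have hb' : ∀ᵐ ω ∂P, LimB 1 (fun n => (walk ω n).1) (bnd ω).1 ∧
      LimB 1 (fun n => (walk ω n).2) (bnd ω).2 := by
    filter_upwards [hb] with ω hω
    obtain ⟨d1, d2, e⟩ := hω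
    exact ⟨⟨d1, by rw [e]⟩, ⟨d2, by rw [e]⟩⟩
  have hq := qbb_QM hΓ hΓs hδ hh1 hh2
  have hπ0 : 0 ≤ hπ := Sπ.h_nonneg
  have hs0 : 0 ≤ hs := Ss.h_nonneg
  have hD : 0 ≤ (hπ - hs) / l + hs / ls := by
    have h1 : hs / l ≤ hs / ls := by gcongr
    have h2 : 0 ≤ hπ / l := div_nonneg hπ0 (hls0.trans_le hll).le
    rw [sub_div]; linarith
  have := Measure.isProbabilityMeasure_map (μ := P) hbm.aemeasurable
  have hreg : Reg (qbb (1:Γ) (1:Γs)) (P.map bnd) ((hπ - hs) / l + hs / ls) :=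
    edata_reg (T := (Γ × Γs) × Γs) hq hbm (K := 5/4 * (B + B') + 1) (by positivity) one_pos hD
      fun ε h0 h1 => edata_main hδ hh1 hh2 hΓ.1 hΓs.1 hp hP hls0 hll hA hB hA' hB' hg hg'
        (marg_snd p) Sπ Pπ Ss Ps Dx Dy hb' h0 h1
  exact ⟨reg_exactDim hreg, reg_hasDim hq hreg⟩

end HMDim
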